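/- Let X be an irreducible closed subvariety of the torus G_m^n defined over a number field K, let s be a non-negative integer, and let L ⊇ K be a subfield of the algebraic numbers with the Bogomolov property. Then X^{oa,s} ∩ G̃^{[s]}(L) is finite, where G̃^{[s]} is the union of all connected algebraic subgroups of G_m^n of codimension at least s. In particular, X^{oa} ∩ G̃^{[dim X]}(L) is finite. -/

import Mathlib

noncomputable section

abbrev Qbar : Type := AlgebraicClosure ℚ

/-- The absolute logarithmic Weil height of an algebraic number, via the
Mahler-measure formula applied to its (integer-scaled) minimal polynomial. -/
noncomputable def weilHeight (α : Qbar) : ℝ :=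
  (Real.log (((minpoly ℚ α).support.lcm fun i => ((minpoly ℚ α).coeff i).den : ℕ) : ℝ) +
      (((minpoly ℚ α).aroots ℂ).map fun z => Real.log (max 1 ‖z‖)).sum) /
    ((minpoly ℚ α).natDegree : ℝ)

/-- Points of the torus `G_m^n` over the algebraic numbers. -/
abbrev TorusPt (n : ℕ) : Type := Fin n → Qbarˣ

/-- Zariski-closed subsets of the torus: zero sets of families of polynomials. -/
def ZClosed {n : ℕ} (S : Set (TorusPt n)) : Prop :=
  ∃ I : Set (MvPolynomial (Fin n) Qbar),
    S = {x : TorusPt n | ∀ f ∈ I, MvPolynomial.eval (fun i => (x i : Qbar)) f = 0}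

/-- Irreducibility (of a subset of the torus) for the Zariski topology. -/
def ZIrred {n : ℕ} (S : Set (TorusPt n)) : Prop :=
  S.Nonempty ∧ ∀ Z₁ Z₂ : Set (TorusPt n), ZClosed Z₁ → ZClosed Z₂ →
    S ⊆ Z₁ ∪ Z₂ → S ⊆ Z₁ ∨ S ⊆ Z₂

/-- Dimension via lengths of chains of irreducible closed subsets. -/
def zdim {n : ℕ} (S : Set (TorusPt n)) : ℕ :=
  sSup {d : ℕ | ∃ Z : Fin (d + 1) → Set (TorusPt n),
    (∀ i, ZClosed (Z i) ∧ ZIrred (Z i) ∧ Z i ⊆ S) ∧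
    ∀ i j : Fin (d + 1), i < j → Z i ⊂ Z j}

/-- An algebraic subgroup of the torus: a Zariski-closed subgroup. -/
def IsAlgSubgroup {n : ℕ} (H : Set (TorusPt n)) : Prop :=
  ZClosed H ∧ (1 : TorusPt n) ∈ H ∧ (∀ x ∈ H, ∀ y ∈ H, x * y ∈ H) ∧ ∀ x ∈ H, x⁻¹ ∈ H

/-- A coset: a translate of an algebraic subgroup. -/
def IsCoset {n : ℕ} (C : Set (TorusPt n)) : Prop :=
  ∃ (g : TorusPt n) (H : Set (TorusPt n)), IsAlgSubgroup H ∧ C = (g * ·) '' H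

/-- Zariski connectedness of a subset of the torus. -/
def ZConnected {n : ℕ} (H : Set (TorusPt n)) : Prop :=
  ∀ Z₁ Z₂ : Set (TorusPt n), ZClosed Z₁ → ZClosed Z₂ → H ⊆ Z₁ ∪ Z₂ →
    H ∩ Z₁ ∩ Z₂ = ∅ → H ⊆ Z₁ ∨ H ⊆ Z₂

/-- `Y` is an `s`-anomalous subvariety of `X`. -/
def IsAnomalous {n : ℕ} (X Y : Set (TorusPt n)) (s : ℕ) : Prop :=
  Y ⊆ X ∧ ZClosed Y ∧ ZIrred Y ∧ 1 ≤ zdim Y ∧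
    ∃ H : Set (TorusPt n), IsCoset H ∧ Y ⊆ H ∧
      (s : ℤ) + (zdim H : ℤ) - (n : ℤ) < (zdim Y : ℤ)

/-- `X^{oa,s}` : the complement in `X` of the union of all `s`-anomalous subvarieties. -/
def openAnom {n : ℕ} (X : Set (TorusPt n)) (s : ℕ) : Set (TorusPt n) :=
  X \ ⋃ (Y : Set (TorusPt n)) (_ : IsAnomalous X Y s), Y

/-- `X` is defined over (the subfield) `K`: cut out by polynomials with coefficients in `K`. -/
def DefinedOver {n : ℕ} (K : IntermediateField ℚ Qbar) (X : Set (TorusPt n)) : Prop :=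
  ∃ I : Set (MvPolynomial (Fin n) Qbar),
    (∀ f ∈ I, ∀ m, MvPolynomial.coeff m f ∈ K) ∧
    X = {x : TorusPt n | ∀ f ∈ I, MvPolynomial.eval (fun i => (x i : Qbar)) f = 0}

def IsRootOfUnity (α : Qbar) : Prop := ∃ k : ℕ, 1 ≤ k ∧ α ^ k = 1

/-- The Bogomolov property for a subfield of the algebraic numbers. -/
def HasBogomolov (L : IntermediateField ℚ Qbar) : Prop :=
  ∃ C : ℝ, 0 < C ∧ ∀ α : Qbar, α ∈ L → α ≠ 0 → ¬ IsRootOfUnity α → C ≤ weilHeight α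


section
open MvPolynomial

/-- monomials with integer exponents -/
def mon {n : ℕ} {K : Type} [Field K] (a : Fin n → ℤ) (x : Fin n → K) : K :=
  ∏ i, x i ^ a i

section mon
variable {n : ℕ} {K : Type} [Field K] {x : Fin n → K}

theorem mon_zero : mon 0 x = 1 := by simp [mon]

theorem mon_add (hx : ∀ i, x i ≠ 0) (a b : Fin n → ℤ) : mon (a + b) x = mon a x * mon b x := by
  simp only [mon, ← Finset.prod_mul_distrib, Pi.add_apply]
  exact Finset.prod_congr rfl fun i _ => zpow_add₀ (hx i) _ _

theorem mon_zsmul (m : ℤ) (a : Fin n → ℤ) : mon (m • a) x = mon a x ^ m := by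
  simp only [mon, ← Finset.prod_zpow, Pi.smul_apply, smul_eq_mul]
  exact Finset.prod_congr rfl fun i _ => by rw [mul_comm, zpow_mul]

theorem mon_neg (a : Fin n → ℤ) : mon (-a) x = (mon a x)⁻¹ := by
  have := mon_zsmul (x := x) (-1) a
  simpa using this

theorem mon_ne_zero (hx : ∀ i, x i ≠ 0) (a : Fin n → ℤ) : mon a x ≠ 0 :=
  Finset.prod_ne_zero_iff.mpr fun i _ => zpow_ne_zero _ (hx i)

theorem mon_sub (hx : ∀ i, x i ≠ 0) (a b : Fin n → ℤ) : mon (a - b) x = mon a x / mon b x := by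
  rw [sub_eq_add_neg, mon_add hx, mon_neg, div_eq_mul_inv]

theorem mon_single (i : Fin n) : mon (Pi.single i 1) x = x i := by
  rw [mon, Finset.prod_eq_single i]
  · simp
  · intro j _ hj; simp [Pi.single_eq_of_ne hj]
  · simp

theorem mon_sum (hx : ∀ i, x i ≠ 0) {ι : Type} (s : Finset ι) (c : ι → ℤ) (b : ι → Fin n → ℤ) :
    mon (∑ j ∈ s, c j • b j) x = ∏ j ∈ s, mon (b j) x ^ c j := by
  classical
  induction s using Finset.induction_on with
  | empty => simp [mon_zero]
  | insert a s ha ih => rw [Finset.sum_insert ha, Finset.prod_insert ha, mon_add hx, mon_zsmul, ih]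

theorem mon_map {K' : Type} [Field K'] (f : K →+* K') (a : Fin n → ℤ) :
    f (mon a x) = mon a (fun i => f (x i)) := by
  simp [mon, map_prod, map_zpow₀]

theorem mon_mul (a : Fin n → ℤ) (y : Fin n → K) :
    mon a (fun i => x i * y i) = mon a x * mon a y := by
  simp [mon, mul_zpow, Finset.prod_mul_distrib]

def monPos {n : ℕ} (k : Type) [Field k] (a : Fin n → ℤ) : MvPolynomial (Fin n) k :=
  ∏ i, X i ^ (a i).toNat

theorem aeval_monPos {k : Type} [Field k] [Algebra k K] (hx : ∀ i, x i ≠ 0) (a : Fin n → ℤ) :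
    aeval x (monPos k a) = mon a x * aeval x (monPos k (-a)) := by
  simp only [monPos, map_prod, map_pow, aeval_X, mon, ← Finset.prod_mul_distrib]
  refine Finset.prod_congr rfl fun i _ => ?_
  rw [← zpow_natCast, ← zpow_natCast, ← zpow_add₀ (hx i)]
  congr 1
  simp only [Pi.neg_apply]
  omega

theorem aeval_monPos_ne_zero {k : Type} [Field k] [Algebra k K] (hx : ∀ i, x i ≠ 0)
    (a : Fin n → ℤ) : aeval x (monPos k a) ≠ 0 := by
  simp only [monPos, map_prod, map_pow, aeval_X]
  exact Finset.prod_ne_zero_iff.mpr fun i _ => pow_ne_zero _ (hx i)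
end mon

/-- cast to rational vectors -/
def cq {n : ℕ} (a : Fin n → ℤ) : Fin n → ℚ := fun i => (a i : ℚ)

theorem cq_span {n : ℕ} {ι : Type} [Fintype ι] (v : ι → Fin n → ℤ) (w : Fin n → ℤ)
    (h : cq w ∈ Submodule.span ℚ (Set.range fun i => cq (v i))) :
    ∃ (D : ℤ) (c : ι → ℤ), D ≠ 0 ∧ D • w = ∑ i, c i • v i := by
  obtain ⟨q, hq⟩ := (Submodule.mem_span_range_iff_exists_fun ℚ).mp h
  obtain ⟨⟨D, hD⟩, hb⟩ := IsLocalization.exist_integer_multiples_of_finite (nonZeroDivisors ℤ) q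
  choose c hc using hb
  refine ⟨D, c, nonZeroDivisors.ne_zero hD, ?_⟩
  funext l
  have h1 := congrFun hq l
  simp only [Finset.sum_apply, Pi.smul_apply, smul_eq_mul, cq] at h1 ⊢
  have : ((D * w l : ℤ) : ℚ) = ((∑ i, c i * v i l : ℤ) : ℚ) := by
    push_cast
    rw [← h1, Finset.mul_sum]
    refine Finset.sum_congr rfl fun i _ => ?_
    have := hc i
    simp only [algebraMap_int_eq, eq_intCast, Algebra.smul_def] at this
    rw [this, mul_assoc]
  exact_mod_cast this

theorem algInd_card_le {k L : Type} [Field k] [Field L] [Algebra k L] {ι : Type} [Fintype ι]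
    (y : ι → L) (hy : AlgebraicIndependent k y) (T : Set L)
    (h : ∀ i, IsAlgebraic (IntermediateField.adjoin k T) (y i)) :
    (Fintype.card ι : ℕ∞) ≤ T.encard := by
  have hI : (AlgebraicIndependent.matroid k L).Indep (Set.range y) :=
    AlgebraicIndependent.matroid_indep_iff.mpr (AlgebraicIndependent.coe_range hy)
  have hsub : Set.range y ⊆ (AlgebraicIndependent.matroid k L).closure T := by
    rintro _ ⟨i, rfl⟩
    rw [AlgebraicIndependent.matroid_closure_eq]
    exact IntermediateField.isAlgebraic_adjoin_iff.mp (h i)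
  have h1 := (AlgebraicIndependent.matroid k L).eRk_mono hsub
  rw [hI.eRk_eq_encard, Matroid.eRk_closure_eq] at h1
  have h2 := h1.trans (Matroid.eRk_le_encard _ _)
  have h3 : (Set.range y).encard = Fintype.card ι := by
    rw [← Set.image_univ, hy.injective.encard_image, Set.encard_univ]
    simp
  rwa [h3] at h2

end

section
open MvPolynomial

theorem trd_step {k R : Type} [Field k] [CommRing R] [Algebra k R] {p q : Ideal R}
    [hp : p.IsPrime] (h : p < q) {m : ℕ} (y : Fin m → R)
    (hy : AlgebraicIndependent k (fun i => Ideal.Quotient.mkₐ k q (y i))) :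
    ∃ y' : Fin (m+1) → R, AlgebraicIndependent k (fun i => Ideal.Quotient.mkₐ k p (y' i)) := by
  obtain ⟨g, hgq, hgp⟩ := Set.exists_of_ssubset h
  let φ : (R ⧸ p) →ₐ[k] (R ⧸ q) := Ideal.Quotient.factorₐ k h.le
  have hφ : ∀ r, φ (Ideal.Quotient.mkₐ k p r) = Ideal.Quotient.mkₐ k q r := fun r => rfl
  have hyp : AlgebraicIndependent k (fun i => Ideal.Quotient.mkₐ k p (y i)) :=
    AlgebraicIndependent.of_comp φ hy
  have hg0 : Ideal.Quotient.mkₐ k p g ≠ 0 := by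
    intro h0
    exact hgp (Ideal.Quotient.eq_zero_iff_mem.mp h0)
  have htr : Transcendental (Algebra.adjoin k (Set.range fun i => Ideal.Quotient.mkₐ k p (y i)))
      (Ideal.Quotient.mkₐ k p g) := by
    intro halg
    obtain ⟨P, hP0, hPe⟩ := halg.exists_nonzero_coeff_and_aeval_eq_zero
      (mem_nonZeroDivisors_of_ne_zero hg0)
    apply hP0
    set c := P.coeff 0 with hc
    have h1 : φ (c : R ⧸ p) = 0 := by
      have h2 : (c : R ⧸ p) = - (Ideal.Quotient.mkₐ k p g) *
          Polynomial.aeval (Ideal.Quotient.mkₐ k p g) P.divX := by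
        have h3 := Polynomial.divX_mul_X_add P
        rw [← h3] at hPe
        simp only [map_add, map_mul, Polynomial.aeval_X, Polynomial.aeval_C] at hPe
        have : (c : R ⧸ p) = algebraMap _ (R ⧸ p) (P.coeff 0) := rfl
        rw [this]
        linear_combination hPe
      rw [h2, map_mul, map_neg, hφ]
      have : Ideal.Quotient.mkₐ k q g = 0 := Ideal.Quotient.eq_zero_iff_mem.mpr hgq
      rw [this]; simp
    obtain ⟨F, hF⟩ : (c : R ⧸ p) ∈ (aeval (fun i => Ideal.Quotient.mkₐ k p (y i)) :
        MvPolynomial (Fin m) k →ₐ[k] _).range := by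
      have h5 := Algebra.adjoin_range_eq_range_aeval k (fun i => Ideal.Quotient.mkₐ k p (y i))
      exact h5.le c.2
    have hF' : aeval (fun i => Ideal.Quotient.mkₐ k p (y i)) F = (c : R ⧸ p) := hF
    have : aeval (fun i => Ideal.Quotient.mkₐ k q (y i)) F = 0 := by
      have h7 := MvPolynomial.comp_aeval_apply (fun i => Ideal.Quotient.mkₐ k p (y i)) φ F
      rw [hF', h1] at h7
      simp only [hφ] at h7
      exact h7.symm
    have hF0 := hy.eq_zero_of_aeval_eq_zero _ this
    rw [hF0] at hF'
    ext
    rw [← hF']; simp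
  have := (hyp.option_iff_transcendental (Ideal.Quotient.mkₐ k p g)).mpr htr
  refine ⟨fun i => ((finSuccEquiv m) i).elim g y, ?_⟩
  have h2 := this.comp (finSuccEquiv m) (finSuccEquiv m).injective
  convert h2 using 1
  funext i
  simp only [Function.comp]
  cases (finSuccEquiv m) i <;> rfl

/-- existence of `m` algebraically independent elements modulo `p` -/
def IndN {n : ℕ} (p : Ideal (MvPolynomial (Fin n) Qbar)) (m : ℕ) : Prop :=
  ∃ y : Fin m → MvPolynomial (Fin n) Qbar,
    AlgebraicIndependent Qbar (fun i => Ideal.Quotient.mkₐ Qbar p (y i))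

theorem IndN.zero {n : ℕ} (p : Ideal (MvPolynomial (Fin n) Qbar)) [p.IsPrime] : IndN p 0 := by
  refine ⟨fun i => i.elim0, ?_⟩
  rw [algebraicIndependent_empty_type_iff]
  exact (algebraMap Qbar (MvPolynomial (Fin n) Qbar ⧸ p)).injective

theorem IndN.chain {n : ℕ} {m : ℕ} : ∀ (r : ℕ) (q : Fin (r+1) → Ideal (MvPolynomial (Fin n) Qbar))
    (_ : ∀ i, (q i).IsPrime) (_ : StrictMono q) (_ : IndN (q (Fin.last r)) m),
    IndN (q 0) (m + r) := by
  intro r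
  induction r with
  | zero => intro q hq hs h; exact h
  | succ r ih =>
    intro q hq hs h
    have h1 := ih (fun i => q i.succ) (fun i => hq _)
      (fun i j hij => hs (Fin.succ_lt_succ_iff.mpr hij)) h
    obtain ⟨y, hy⟩ := h1
    have := hq 0
    exact trd_step (hs (Fin.succ_pos 0)) y hy

theorem IndN.le_card {n m : ℕ} {p : Ideal (MvPolynomial (Fin n) Qbar)} [p.IsPrime] (h : IndN p m)
    (S : Finset (Fin n))
    (hS : ∀ i, IsAlgebraic (Algebra.adjoin Qbar ((fun i => Ideal.Quotient.mkₐ Qbar p (X i)) '' S))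
      (Ideal.Quotient.mkₐ Qbar p (X i))) : m ≤ S.card := by
  obtain ⟨y, hy⟩ := h
  classical
  set T := ((fun i => Ideal.Quotient.mkₐ Qbar p (X i)) '' (S : Set (Fin n))) with hT
  have halg : Algebra.IsAlgebraic (Algebra.adjoin Qbar T) (MvPolynomial (Fin n) Qbar ⧸ p) := by
    have : Algebra.adjoin Qbar (Set.range fun i => Ideal.Quotient.mkₐ Qbar p (X i)) = ⊤ := by
      rw [Algebra.adjoin_range_eq_range_aeval, AlgHom.range_eq_top]
      intro z
      obtain ⟨f, rfl⟩ := Ideal.Quotient.mk_surjective z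
      refine ⟨f, ?_⟩
      have : aeval (fun i => Ideal.Quotient.mkₐ Qbar p (X i)) = Ideal.Quotient.mkₐ Qbar p := by
        ext i; simp
      rw [this]; rfl
    refine ⟨fun z => ?_⟩
    have hz : z ∈ Algebra.adjoin Qbar (Set.range fun i => Ideal.Quotient.mkₐ Qbar p (X i)) := by
      rw [this]; trivial
    induction hz using Algebra.adjoin_induction with
    | mem x hx => obtain ⟨i, rfl⟩ := hx; exact hS i
    | algebraMap r =>
      exact isAlgebraic_algebraMap (algebraMap Qbar (Algebra.adjoin Qbar T) r)
    | add x y _ _ hx hy => exact hx.add hy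
    | mul x y _ _ hx hy => exact hx.mul hy
  have h1 := Algebra.IsAlgebraic.trdeg_le_cardinalMk Qbar T
  have h2 := hy.cardinalMk_le_trdeg
  have h3 := h2.trans h1
  have h4 : Cardinal.mk T ≤ (S.card : Cardinal) := by
    rw [hT]
    refine Cardinal.mk_image_le.trans ?_
    simp
  have h5 := h3.trans h4
  simpa using h5

def emb {n : ℕ} (x : TorusPt n) : Fin n → Qbar := fun i => (x i : Qbar)

def vI {n : ℕ} (Y : Set (TorusPt n)) : Ideal (MvPolynomial (Fin n) Qbar) :=
  vanishingIdeal Qbar (emb '' Y)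

theorem mem_vI {n : ℕ} {Y : Set (TorusPt n)} {f : MvPolynomial (Fin n) Qbar} :
    f ∈ vI Y ↔ ∀ x ∈ Y, eval (emb x) f = 0 := by
  simp [vI, mem_vanishingIdeal_iff]

def zV {n : ℕ} (p : Ideal (MvPolynomial (Fin n) Qbar)) : Set (TorusPt n) :=
  {x | ∀ f ∈ p, eval (emb x) f = 0}

theorem zV_closed {n : ℕ} (p : Ideal (MvPolynomial (Fin n) Qbar)) : ZClosed (zV p) := ⟨p, rfl⟩

theorem ZClosed.eq_zV {n : ℕ} {Y : Set (TorusPt n)} (h : ZClosed Y) : zV (vI Y) = Y := by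
  obtain ⟨I, rfl⟩ := h
  ext x
  constructor
  · intro hx f hf
    exact hx f (mem_vI.mpr fun y hy => hy f hf)
  · intro hx f hf
    exact mem_vI.mp hf x hx

theorem vI_anti {n : ℕ} {Y Z : Set (TorusPt n)} (h : Y ⊆ Z) : vI Z ≤ vI Y := fun _ hf =>
  mem_vI.mpr fun x hx => mem_vI.mp hf x (h hx)

theorem vI_lt {n : ℕ} {Y Z : Set (TorusPt n)} (hY : ZClosed Y) (hZ : ZClosed Z) (h : Y ⊂ Z) :
    vI Z < vI Y := by
  refine lt_of_le_of_ne (vI_anti h.1) fun he => h.2 ?_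
  rw [← hZ.eq_zV, he, hY.eq_zV]

theorem ZIrred.vI_prime {n : ℕ} {Y : Set (TorusPt n)} (h : ZIrred Y) : (vI Y).IsPrime := by
  constructor
  · intro h1
    obtain ⟨x, hx⟩ := h.1
    have : (1 : MvPolynomial (Fin n) Qbar) ∈ vI Y := by rw [h1]; trivial
    simpa using mem_vI.mp this x hx
  · intro f g hfg
    have := h.2 {x | ∀ f' ∈ ({f} : Set (MvPolynomial (Fin n) Qbar)), eval (fun i => (x i : Qbar)) f' = 0}
      {x | ∀ f' ∈ ({g} : Set (MvPolynomial (Fin n) Qbar)), eval (fun i => (x i : Qbar)) f' = 0}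
      ⟨_, rfl⟩ ⟨_, rfl⟩ (by
        intro x hx
        have := mem_vI.mp hfg x hx
        rw [map_mul, mul_eq_zero] at this
        rcases this with h | h
        · left; intro f' hf'; rw [Set.mem_singleton_iff.mp hf']; exact h
        · right; intro f' hf'; rw [Set.mem_singleton_iff.mp hf']; exact h)
    rcases this with h | h
    · left; exact mem_vI.mpr fun x hx => h hx f rfl
    · right; exact mem_vI.mpr fun x hx => h hx g rfl

theorem vI_zV {n : ℕ} (p : Ideal (MvPolynomial (Fin n) Qbar)) [hp : p.IsPrime]
    (P : TorusPt n) (hP : P ∈ zV p) : vI (zV p) = p := by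
  apply le_antisymm
  · intro f hf
    have h1 : f * ∏ i, X i ∈ vanishingIdeal Qbar (zeroLocus Qbar p) := by
      rw [mem_vanishingIdeal_iff]
      intro x hx
      by_cases h0 : ∀ i, x i ≠ 0
      · have := mem_vI.mp hf (fun i => Units.mk0 (x i) (h0 i)) (by
          intro g hg
          have : eval x g = 0 := by simpa using hx g hg
          exact this)
        have h2 : eval x f = 0 := this
        rw [map_mul]; simp [h2]
      · push Not at h0
        obtain ⟨i, hi⟩ := h0
        rw [map_mul, map_prod, Finset.prod_eq_zero (Finset.mem_univ i) (by simp [hi]), mul_zero]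
    rw [IsPrime.vanishingIdeal_zeroLocus] at h1
    refine (hp.mem_or_mem h1).resolve_right fun h2 => ?_
    have := hP _ h2
    rw [map_prod] at this
    obtain ⟨i, -, hi⟩ := Finset.prod_eq_zero_iff.mp this
    simp [emb] at hi
  · intro f hf
    exact mem_vI.mpr fun x hx => hx f hf

theorem zV_irred {n : ℕ} (p : Ideal (MvPolynomial (Fin n) Qbar)) [hp : p.IsPrime]
    (P : TorusPt n) (hP : P ∈ zV p) : ZIrred (zV p) := by
  refine ⟨⟨P, hP⟩, fun Z₁ Z₂ h1 h2 h => ?_⟩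
  by_contra hcon
  push Not at hcon
  obtain ⟨hc1, hc2⟩ := hcon
  have key : ∀ Z : Set (TorusPt n), ZClosed Z → ¬ zV p ⊆ Z → ∃ f ∈ vI Z, f ∉ p := by
    intro Z hZ hn
    by_contra hcon
    push Not at hcon
    apply hn
    intro x hx
    rw [← hZ.eq_zV]
    intro f hf
    exact hx f (hcon f hf)
  obtain ⟨f, hf, hfp⟩ := key _ h1 hc1
  obtain ⟨g, hg, hgp⟩ := key _ h2 hc2
  have : f * g ∈ vI (zV p) := mem_vI.mpr fun x hx => by
    rw [map_mul]
    rcases h hx with h | h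
    · rw [mem_vI.mp hf x h, zero_mul]
    · rw [mem_vI.mp hg x h, mul_zero]
  rw [vI_zV p P hP] at this
  rcases hp.mem_or_mem this with h | h
  · exact hfp h
  · exact hgp h

theorem chain_le {n : ℕ} (S : Set (TorusPt n)) (N : ℕ)
    (hN : ∀ Z : Set (TorusPt n), ZIrred Z → Z ⊆ S → ∀ m, IndN (vI Z) m → m ≤ N)
    (d : ℕ) (hd : ∃ Z : Fin (d + 1) → Set (TorusPt n),
    (∀ i, ZClosed (Z i) ∧ ZIrred (Z i) ∧ Z i ⊆ S) ∧
    ∀ i j : Fin (d + 1), i < j → Z i ⊂ Z j) : d ≤ N := by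
  obtain ⟨Z, hZ, hlt⟩ := hd
  have hp : ∀ i, (vI (Z i)).IsPrime := fun i => (hZ i).2.1.vI_prime
  have h1 := IndN.chain (m := 0) d (fun i => vI (Z i.rev)) (fun i => hp _)
    (fun i j hij => vI_lt (hZ _).1 (hZ _).1 (hlt _ _ (Fin.rev_lt_rev.mpr hij)))
    (by have := hp (Fin.last d).rev; exact IndN.zero _)
  have := hN (Z (Fin.rev 0)) (hZ _).2.1 (hZ _).2.2 _ h1
  omega

theorem zdim_le {n : ℕ} (S : Set (TorusPt n)) (N : ℕ)
    (hN : ∀ Z : Set (TorusPt n), ZIrred Z → Z ⊆ S → ∀ m, IndN (vI Z) m → m ≤ N) :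
    zdim S ≤ N := by
  unfold zdim
  rcases Set.eq_empty_or_nonempty {d : ℕ | ∃ Z : Fin (d + 1) → Set (TorusPt n),
    (∀ i, ZClosed (Z i) ∧ ZIrred (Z i) ∧ Z i ⊆ S) ∧
    ∀ i j : Fin (d + 1), i < j → Z i ⊂ Z j} with h | h
  · rw [h]; simp
  · exact csSup_le h fun d hd => chain_le S N hN d hd

theorem IndN.le_n {n m : ℕ} {p : Ideal (MvPolynomial (Fin n) Qbar)} [p.IsPrime] (h : IndN p m) :
    m ≤ n := by
  have := h.le_card Finset.univ (fun i => by
    exact isAlgebraic_algebraMap (⟨_, Algebra.subset_adjoin ⟨i, by simp, rfl⟩⟩ :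
      Algebra.adjoin Qbar ((fun i => Ideal.Quotient.mkₐ Qbar p (X i)) '' (Finset.univ : Finset (Fin n)))))
  simpa using this

theorem le_zdim {n : ℕ} (S : Set (TorusPt n)) (d : ℕ) (hd : ∃ Z : Fin (d + 1) → Set (TorusPt n),
    (∀ i, ZClosed (Z i) ∧ ZIrred (Z i) ∧ Z i ⊆ S) ∧
    ∀ i j : Fin (d + 1), i < j → Z i ⊂ Z j) : d ≤ zdim S := by
  unfold zdim
  apply le_csSup ⟨n, ?_⟩ hd
  intro d hd
  exact chain_le S n (fun Z hZ _ m hm => by have := hZ.vI_prime; exact hm.le_n) d hd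

theorem zdim_mono {n : ℕ} {S T : Set (TorusPt n)} (h : S ⊆ T) : zdim S ≤ zdim T := by
  refine (csSup_le' ?_ : zdim S ≤ _)
  intro d ⟨Z, hZ, hlt⟩
  exact le_zdim T d ⟨Z, fun i => ⟨(hZ i).1, (hZ i).2.1, (hZ i).2.2.trans h⟩, hlt⟩

end

section
open MvPolynomial

theorem emb_ne {n : ℕ} (P : TorusPt n) (i : Fin n) : emb P i ≠ 0 := (P i).ne_zero

/-- completing independent integer vectors by coordinate vectors -/
theorem complete_basis {n ρ : ℕ} (a : Fin ρ → Fin n → ℤ)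
    (ha : LinearIndependent ℚ (fun j => cq (a j))) :
    ∃ S : Finset (Fin n), S.card + ρ = n ∧ ∀ w : Fin n → ℤ,
      ∃ (D : ℤ) (c : Fin ρ → ℤ) (e : Fin n → ℤ), D ≠ 0 ∧ (∀ i ∉ S, e i = 0) ∧
        D • w = ∑ j, c j • a j + e := by
  classical
  let v : Fin ρ ⊕ Fin n → Fin n → ℤ := Sum.elim a (fun i => Pi.single i 1)
  have hinl : LinearIndepOn ℚ (fun b => cq (v b)) (Set.range Sum.inl) := by
    rw [LinearIndepOn, ← linearIndependent_equiv (Equiv.ofInjective _ Sum.inl_injective)]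
    exact ha
  obtain ⟨b, -, hsb, hspan, hb⟩ := exists_linearIndepOn_extension (K := ℚ)
    (v := fun b => cq (v b)) hinl (Set.subset_univ _)
  have htop : ⊤ ≤ Submodule.span ℚ ((fun b => cq (v b)) '' b) := by
    rw [← (Pi.basisFun ℚ (Fin n)).span_eq, Submodule.span_le]
    rintro _ ⟨i, rfl⟩
    apply hspan
    refine ⟨Sum.inr i, trivial, ?_⟩
    funext j
    simp [cq, v, Pi.single_apply]
  have htop' : ⊤ ≤ Submodule.span ℚ (Set.range fun (x : b) => cq (v x)) := by
    rw [Set.image_eq_range] at htop; exact htop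
  let B := Module.Basis.mk hb htop'
  have hcard : Fintype.card b = n := by
    have := Module.finrank_eq_card_basis B
    simpa using this.symm
  let S : Finset (Fin n) := Finset.univ.filter fun i => Sum.inr i ∈ b
  refine ⟨S, ?_, ?_⟩
  · have h1 : b.toFinset = (Finset.univ : Finset (Fin ρ)).disjSum S := by
      ext z
      rcases z with j | i
      · simp [hsb ⟨j, rfl⟩]
      · simp [S]
    have h2 : b.toFinset.card = n := by rw [Set.toFinset_card, hcard]
    rw [h1, Finset.card_disjSum] at h2
    simp at h2; omega
  · intro w
    obtain ⟨D, c, hD, hc⟩ := cq_span (fun x : b => v x) w (htop' trivial)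
    let c' : Fin ρ ⊕ Fin n → ℤ := fun z => if h : z ∈ b then c ⟨z, h⟩ else 0
    have h3 : ∑ i : b, c i • v i = ∑ z, c' z • v z := by
      rw [← Finset.sum_subset (Finset.subset_univ b.toFinset)]
      · rw [← Finset.sum_coe_sort b.toFinset]
        refine Fintype.sum_equiv (Equiv.subtypeEquivRight (by simp)) _ _ ?_
        intro x; simp [c']
      · intro z _ hz
        simp only [Set.mem_toFinset] at hz
        simp [c', hz]
    refine ⟨D, fun j => c' (Sum.inl j), fun i => c' (Sum.inr i), hD, ?_, ?_⟩
    · intro i hi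
      simp only [S, Finset.mem_filter, Finset.mem_univ, true_and] at hi
      simp [c', hi]
    · rw [hc, h3, Fintype.sum_sum_type]
      congr 1
      funext l
      simp [v, Finset.sum_apply, Pi.single_apply]

theorem coset_bound {n ρ : ℕ} (a : Fin ρ → Fin n → ℤ)
    (ha : LinearIndependent ℚ (fun j => cq (a j))) (Z : Set (TorusPt n)) (hZ : ZIrred Z)
    (c : Fin ρ → Qbar) (hc : ∀ j, ∀ x ∈ Z, mon (a j) (emb x) = c j) (m : ℕ)
    (hm : IndN (vI Z) m) : m + ρ ≤ n := by
  obtain ⟨S, hS, hw⟩ := complete_basis a ha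
  have hp := hZ.vI_prime
  obtain ⟨P0, hP0⟩ := hZ.1
  let B := MvPolynomial (Fin n) Qbar ⧸ vI Z
  let L := FractionRing B
  let π : MvPolynomial (Fin n) Qbar →ₐ[Qbar] L :=
    (IsScalarTower.toAlgHom Qbar B L).comp (Ideal.Quotient.mkₐ Qbar (vI Z))
  have hπ : ∀ f, π f = 0 ↔ f ∈ vI Z := by
    intro f
    rw [← Ideal.Quotient.eq_zero_iff_mem]
    exact (FaithfulSMul.algebraMap_eq_zero_iff B L)
  let ξ : Fin n → L := fun i => π (X i)
  have hπa : ∀ f, π f = aeval ξ f := by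
    intro f
    have : π = aeval ξ := by ext i; simp [ξ]
    rw [this]
  have hξ : ∀ i, ξ i ≠ 0 := by
    intro i h
    have := mem_vI.mp ((hπ _).mp h) P0 hP0
    simp [emb] at this
  have hmon : ∀ j, mon (a j) ξ = algebraMap Qbar L (c j) := by
    intro j
    have h1 : monPos Qbar (a j) - C (c j) * monPos Qbar (-a j) ∈ vI Z := by
      refine mem_vI.mpr fun x hx => ?_
      have := aeval_monPos (k := Qbar) (emb_ne x) (a j)
      rw [hc j x hx] at this
      simp only [aeval_eq_eval, Qbar, RingHom.coe_coe, RingHom.toIntAlgHom_coe] at this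
      rw [map_sub, map_mul, eval_C]
      linear_combination this
    have h2 := (hπ _).mpr h1
    rw [hπa, map_sub, map_mul, aeval_monPos hξ, aeval_C, ← sub_mul] at h2
    rcases mul_eq_zero.mp h2 with h | h
    · exact sub_eq_zero.mp h
    · exact absurd h (aeval_monPos_ne_zero hξ _)
  obtain ⟨y, hy⟩ := hm
  have hy' : AlgebraicIndependent Qbar (fun i => π (y i)) :=
    hy.map' (f := IsScalarTower.toAlgHom Qbar B L) (FaithfulSMul.algebraMap_injective B L)
  have h4 : ∀ i, IsAlgebraic (IntermediateField.adjoin Qbar (ξ '' S)) (ξ i) := by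
    intro i
    obtain ⟨D, d, e, hD, he, h⟩ := hw (Pi.single i 1)
    have h5 : ξ i ^ D = (∏ j, algebraMap Qbar L (c j) ^ d j) * mon e ξ := by
      rw [← mon_single (x := ξ) i, ← mon_zsmul, h, mon_add hξ, mon_sum hξ]
      simp [hmon, mon_single]
    have h6 : ξ i ^ D ∈ IntermediateField.adjoin Qbar (ξ '' S) := by
      rw [h5]
      refine mul_mem (prod_mem fun j _ => zpow_mem (IntermediateField.algebraMap_mem _ _) _)
        (prod_mem fun l _ => ?_)
      by_cases hl : l ∈ S
      · have h0 : ξ l ∈ IntermediateField.adjoin Qbar (ξ '' S) :=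
          IntermediateField.subset_adjoin _ _ (Set.mem_image_of_mem _ (Finset.mem_coe.mpr hl))
        exact zpow_mem h0 _
      · rw [he l hl]; simp
    have h7 : ξ i ^ D.natAbs ∈ IntermediateField.adjoin Qbar (ξ '' S) := by
      rcases Int.natAbs_eq D with h | h
      · rw [h, zpow_natCast] at h6; exact h6
      · rw [h, zpow_neg, zpow_natCast] at h6
        have := inv_mem h6
        rwa [inv_inv] at this
    refine IsAlgebraic.of_pow (Int.natAbs_pos.mpr hD) (n := D.natAbs) ?_
    exact isAlgebraic_algebraMap (⟨_, h7⟩ : IntermediateField.adjoin Qbar (ξ '' S))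
  have h5 := algInd_card_le _ hy' (ξ '' S) (fun i => by
    rw [hπa]
    induction y i using MvPolynomial.induction_on with
    | C r => rw [aeval_C]; exact isAlgebraic_algebraMap (algebraMap Qbar (IntermediateField.adjoin Qbar (ξ '' S)) r)
    | add p q hp hq => rw [map_add]; exact hp.add hq
    | mul_X p i hp => rw [map_mul, aeval_X]; exact hp.mul (h4 i))
  have h6 : (ξ '' (S : Set (Fin n))).encard ≤ S.card := by
    refine (Set.encard_image_le _ _).trans ?_
    simp
  have h7 := h5.trans h6
  simp only [Fintype.card_fin, Nat.cast_le] at h7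
  omega

end

section
open MvPolynomial

def mP {n : ℕ} (P : TorusPt n) : Ideal (MvPolynomial (Fin n) Qbar) := RingHom.ker (eval (emb P))

instance mP_prime {n : ℕ} (P : TorusPt n) : (mP P).IsPrime := RingHom.ker_isPrime _

theorem mem_mP {n : ℕ} {P : TorusPt n} {f : MvPolynomial (Fin n) Qbar} :
    f ∈ mP P ↔ eval (emb P) f = 0 := Iff.rfl

theorem mP_height {n : ℕ} (P : TorusPt n) : (n : ℕ∞) ≤ (mP P).height := by
  let φ : ℕ → (MvPolynomial (Fin n) Qbar →ₐ[Qbar] MvPolynomial (Fin n) Qbar) := fun j =>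
    aeval (fun i => if (i : ℕ) < j then C (emb P i) else X i)
  let q : ℕ → Ideal (MvPolynomial (Fin n) Qbar) := fun j => RingHom.ker (φ j)
  have hq : ∀ j, (q j).IsPrime := fun j => RingHom.ker_isPrime _
  have hlt : ∀ j, j < n → q j < q (j+1) := by
    intro j hj
    have hle : q j ≤ q (j+1) := by
      intro f hf
      have : (φ (j+1)).comp (φ j) = φ (j+1) := by
        ext i
        simp only [φ, AlgHom.comp_apply, aeval_X]
        split_ifs with h1 h2 h2
        · simp
        · omega
        · simp only [aeval_X, if_pos h2]
        · simp only [aeval_X, if_neg h2]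
      show φ (j+1) f = 0
      rw [← this, AlgHom.comp_apply, show φ j f = 0 from hf, map_zero]
    refine lt_of_le_of_ne hle fun he => ?_
    have h1 : (X ⟨j, hj⟩ - C (emb P ⟨j, hj⟩) : MvPolynomial (Fin n) Qbar) ∈ q (j+1) := by
      show φ (j+1) _ = 0
      simp [φ]
    rw [← he] at h1
    have h2 : φ j (X ⟨j, hj⟩ - C (emb P ⟨j, hj⟩)) = 0 := h1
    simp only [φ, map_sub, aeval_X, lt_irrefl, if_false, algHom_C] at h2
    have h3 := congrArg (eval (fun _ => emb P ⟨j, hj⟩ + 1)) h2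
    simp at h3
  have hh : ∀ j, j ≤ n → (j : ℕ∞) ≤ (q j).height := by
    intro j
    induction j with
    | zero => intro _; simp
    | succ j ih =>
      intro hj
      have := Ideal.height_add_one_le_of_lt_of_isPrime (hlt j (by omega))
      refine le_trans ?_ this
      push_cast
      gcongr
      exact ih (by omega)
  refine (hh n le_rfl).trans (Ideal.height_mono ?_)
  intro f hf
  rw [mem_mP]
  have : (aeval (emb P)).comp (φ n) = (aeval (emb P) : MvPolynomial (Fin n) Qbar →ₐ[Qbar] Qbar) := by
    ext i
    simp [φ]
  have h1 : aeval (emb P) f = 0 := by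
    rw [← this, AlgHom.comp_apply, show φ n f = 0 from hf, map_zero]
  simpa using h1

theorem core0 {n : ℕ} (P : TorusPt n) (S : Finset (MvPolynomial (Fin n) Qbar))
    (hS : ∀ f ∈ S, eval (emb P) f = 0) :
    ∃ q : Ideal (MvPolynomial (Fin n) Qbar), q.IsPrime ∧ (∀ f ∈ S, f ∈ q) ∧ P ∈ zV q ∧
      n ≤ zdim (zV q) + S.card := by
  have hSm : (S : Set (MvPolynomial (Fin n) Qbar)) ⊆ mP P := fun f hf => hS f hf
  have h1 := Ideal.height_le_height_add_encard_of_subset _ hSm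
  set J := Ideal.span (S : Set (MvPolynomial (Fin n) Qbar)) with hJ
  have hJm : J ≤ mP P := Ideal.span_le.mpr hSm
  have hpr : ((mP P).map (Ideal.Quotient.mk J)).IsPrime :=
    Ideal.isPrime_map_quotientMk_of_isPrime hJm
  obtain ⟨l, hl, hlen⟩ := Ideal.exists_ltSeries_length_eq_height ((mP P).map (Ideal.Quotient.mk J))
  have h2 := (mP_height P).trans h1
  rw [← hlen, Set.encard_coe_eq_coe_finsetCard] at h2
  have h3 : n ≤ l.length + S.card := by exact_mod_cast h2
  let Q : Fin (l.length + 1) → Ideal (MvPolynomial (Fin n) Qbar) :=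
    fun i => (l i).asIdeal.comap (Ideal.Quotient.mk J)
  have hQp : ∀ i, (Q i).IsPrime := fun i => inferInstanceAs ((l i).asIdeal.comap _).IsPrime
  have hQ : StrictMono Q := by
    intro i j hij
    have h4 : l i < l j := l.strictMono hij
    refine lt_of_le_of_ne (Ideal.comap_mono h4.le) fun he => h4.ne ?_
    exact PrimeSpectrum.ext (Ideal.comap_injective_of_surjective _ Ideal.Quotient.mk_surjective he)
  have hlast : Q (Fin.last _) = mP P := by
    have : (l (Fin.last _)).asIdeal = (mP P).map (Ideal.Quotient.mk J) := by
      have := congrArg PrimeSpectrum.asIdeal hl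
      exact this
    simp only [Q, this]
    rw [Ideal.comap_map_of_surjective _ Ideal.Quotient.mk_surjective, ← RingHom.ker_eq_comap_bot,
      Ideal.mk_ker]
    exact sup_eq_left.mpr hJm
  have hP : ∀ i, P ∈ zV (Q i) := by
    intro i f hf
    have : f ∈ mP P := hlast ▸ hQ.monotone (Fin.le_last i) hf
    exact this
  refine ⟨Q 0, hQp 0, fun f hf => ?_, hP 0, h3.trans ?_⟩
  · show Ideal.Quotient.mk J f ∈ (l 0).asIdeal
    rw [Ideal.Quotient.eq_zero_iff_mem.mpr (Ideal.subset_span hf)]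
    exact Ideal.zero_mem _
  · gcongr
    refine le_zdim _ _ ⟨fun i => zV (Q i.rev), fun i => ⟨zV_closed _, ?_, ?_⟩, ?_⟩
    · have := hQp i.rev
      exact zV_irred _ P (hP _)
    · intro x hx f hf
      exact hx f (hQ.monotone (Fin.zero_le _) hf)
    · intro i j hij
      have hr := hQ (Fin.rev_lt_rev.mpr hij)
      refine ⟨fun x hx f hf => hx f (hr.le hf), fun hsub => ?_⟩
      have h5 := vI_anti hsub
      have := hQp i.rev
      have := hQp j.rev
      rw [vI_zV _ P (hP _), vI_zV _ P (hP _)] at h5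
      exact absurd h5 (not_le_of_gt hr)

theorem core1 {n w : ℕ} (P : TorusPt n) (G : Finset (MvPolynomial (Fin n) Qbar))
    (hG : ∀ f ∈ G, eval (emb P) f = 0) (b : Fin w → Fin n → ℤ) :
    ∃ q : Ideal (MvPolynomial (Fin n) Qbar), q.IsPrime ∧ (∀ f ∈ G, f ∈ q) ∧ P ∈ zV q ∧
      (∀ j, ∀ x ∈ zV q, mon (b j) (emb x) = mon (b j) (emb P)) ∧
      n ≤ zdim (zV q) + (G.card + w) := by
  classical
  let e : Fin w → MvPolynomial (Fin n) Qbar := fun j =>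
    monPos Qbar (b j) - C (mon (b j) (emb P)) * monPos Qbar (-b j)
  have he : ∀ j x, eval (emb x) (e j) =
      (mon (b j) (emb x) - mon (b j) (emb P)) * eval (emb x) (monPos Qbar (-b j)) := by
    intro j x
    have := aeval_monPos (k := Qbar) (emb_ne x) (b j)
    simp only [aeval_eq_eval, Qbar] at this
    simp only [e]
    rw [map_sub, map_mul, eval_C]
    linear_combination this
  obtain ⟨q, hq, hSq, hPq, hd⟩ := core0 P (G ∪ Finset.univ.image e) (by
    intro f hf
    rcases Finset.mem_union.mp hf with h | h
    · exact hG f h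
    · obtain ⟨j, -, rfl⟩ := Finset.mem_image.mp h
      rw [he]; simp)
  refine ⟨q, hq, fun f hf => hSq f (Finset.mem_union_left _ hf), hPq, ?_, hd.trans ?_⟩
  · intro j x hx
    have h1 := hx _ (hSq (e j) (Finset.mem_union_right _ (Finset.mem_image_of_mem _ (Finset.mem_univ _))))
    rw [he] at h1
    rcases mul_eq_zero.mp h1 with h | h
    · exact sub_eq_zero.mp h
    · have := aeval_monPos_ne_zero (k := Qbar) (emb_ne x) (-b j)
      simp only [aeval_eq_eval, Qbar] at this
      exact absurd h this
  · gcongr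
    refine (Finset.card_union_le _ _).trans ?_
    gcongr
    exact Finset.card_image_le.trans (by simp)

/-- generic uniqueness of the minimal prime -/
theorem generic_min {R : Type} [CommRing R] [IsNoetherianRing R] (p J : Ideal R) [hp : p.IsPrime]
    (hJ : p ∈ J.minimalPrimes) : ∃ g, g ∉ p ∧ ∀ q : Ideal R, q.IsPrime → J ≤ q → g ∉ q → p ≤ q := by
  classical
  have hfin := J.finite_minimalPrimes_of_isNoetherianRing
  have h1 : ∀ p' : Ideal R, p' ∈ J.minimalPrimes → p' ≠ p → ∃ g ∈ p', g ∉ p := by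
    intro p' hp' hne
    by_contra hcon
    push Not at hcon
    exact hne (le_antisymm hcon (hJ.2 hp'.1 hcon))
  choose! f hf1 hf2 using h1
  refine ⟨∏ p' ∈ hfin.toFinset.erase p, f p', ?_, ?_⟩
  · rw [hp.prod_mem_iff]
    push Not
    intro p' hp'
    simp only [Finset.mem_erase, Set.Finite.mem_toFinset] at hp'
    exact hf2 p' hp'.2 hp'.1
  · intro q hq hJq hgq
    obtain ⟨p', hp', hle⟩ := Ideal.exists_minimalPrimes_le hJq
    by_cases h : p' = p
    · rwa [← h]
    · exact absurd (Ideal.prod_mem _ (Finset.mem_erase.mpr ⟨h, hfin.mem_toFinset.mpr hp'⟩) (hle (hf1 p' hp' h))) hgq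

end

section
open MvPolynomial

theorem mon_closed {n : ℕ} (a : Fin n → ℤ) (c : Qbar) :
    ZClosed {x : TorusPt n | mon a (emb x) = c} := by
  refine ⟨{monPos Qbar a - C c * monPos Qbar (-a)}, ?_⟩
  ext x
  have h1 := aeval_monPos (k := Qbar) (emb_ne x) a
  have h2 := aeval_monPos_ne_zero (k := Qbar) (emb_ne x) (-a)
  simp only [aeval_eq_eval, Qbar] at h1 h2
  have h3 : eval (emb x) (monPos Qbar a - C c * monPos Qbar (-a)) =
      (mon a (emb x) - c) * eval (emb x) (monPos Qbar (-a)) := by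
    rw [map_sub, map_mul, eval_C]; linear_combination h1
  show mon a (emb x) = c ↔ ∀ f ∈ _, eval (emb x) f = 0
  simp only [Set.mem_singleton_iff, forall_eq, h3, mul_eq_zero, sub_eq_zero]
  tauto

theorem ZClosed.inter_all {n : ℕ} {ι : Type} {Z : ι → Set (TorusPt n)} (h : ∀ i, ZClosed (Z i)) :
    ZClosed (⋂ i, Z i) := by
  choose I hI using h
  refine ⟨⋃ i, I i, ?_⟩
  ext x
  simp only [Set.mem_iInter, Set.mem_ofPred_eq, Set.mem_iUnion]
  constructor
  · rintro h f ⟨i, hf⟩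
    have := h i
    rw [hI i] at this
    exact this f hf
  · intro h i
    rw [hI i]
    exact fun f hf => h f ⟨i, hf⟩

theorem ZClosed.union {n : ℕ} {Z W : Set (TorusPt n)} (h : ZClosed Z) (h' : ZClosed W) :
    ZClosed (Z ∪ W) := by
  obtain ⟨I, rfl⟩ := h
  obtain ⟨J, rfl⟩ := h'
  refine ⟨{f | ∃ g ∈ I, ∃ h ∈ J, f = g * h}, ?_⟩
  ext x
  simp only [Set.mem_union, Set.mem_ofPred_eq]
  constructor
  · rintro (h | h) f ⟨g, hg, k, hk, rfl⟩
    · rw [map_mul, h g hg, zero_mul]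
    · rw [map_mul, h k hk, mul_zero]
  · intro h
    by_contra hcon
    push Not at hcon
    obtain ⟨⟨g, hg, h1⟩, ⟨k, hk, h2⟩⟩ := hcon
    have := h _ ⟨g, hg, k, hk, rfl⟩
    rw [map_mul] at this
    exact (mul_ne_zero h1 h2) this

theorem ZClosed.empty {n : ℕ} : ZClosed (∅ : Set (TorusPt n)) :=
  ⟨{1}, by ext x; simp⟩

theorem ZClosed.finset {n : ℕ} {ι : Type} (F : Finset ι) (Z : ι → Set (TorusPt n))
    (h : ∀ i, ZClosed (Z i)) : ZClosed (⋃ i ∈ F, Z i) := by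
  classical
  induction F using Finset.induction_on with
  | empty => simpa using ZClosed.empty
  | insert a s ha ih => rw [Finset.set_biUnion_insert]; exact (h a).union ih

theorem ZIrred.finset {n : ℕ} {ι : Type} {S : Set (TorusPt n)} (hS : ZIrred S) (F : Finset ι)
    (Z : ι → Set (TorusPt n)) (h : ∀ i, ZClosed (Z i)) (hF : S ⊆ ⋃ i ∈ F, Z i) :
    ∃ i ∈ F, S ⊆ Z i := by
  classical
  induction F using Finset.induction_on with
  | empty =>
    obtain ⟨x, hx⟩ := hS.1
    have := hF hx
    simp at this
  | insert a s ha ih =>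
    rw [Finset.set_biUnion_insert] at hF
    rcases hS.2 _ _ (h a) (ZClosed.finset s Z h) hF with h1 | h1
    · exact ⟨a, by simp, h1⟩
    · obtain ⟨i, hi, h2⟩ := ih h1
      exact ⟨i, by simp [hi], h2⟩

theorem ZIrred.const {n : ℕ} {S : Set (TorusPt n)} (hS : ZIrred S) (a : Fin n → ℤ)
    (g : Polynomial Qbar) (hg : g ≠ 0) (h : ∀ x ∈ S, g.eval (mon a (emb x)) = 0) :
    ∃ c, ∀ x ∈ S, mon a (emb x) = c := by
  classical
  obtain ⟨c, -, hc⟩ := hS.finset g.roots.toFinset (fun c => {x | mon a (emb x) = c})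
    (fun c => mon_closed a c) (by
      intro x hx
      simp only [Set.mem_iUnion]
      exact ⟨mon a (emb x), by simp [hg, h x hx], rfl⟩)
  exact ⟨c, hc⟩

theorem ZIrred.connected {n : ℕ} {S : Set (TorusPt n)} (hS : ZIrred S) : ZConnected S :=
  fun Z₁ Z₂ h1 h2 h _ => hS.2 Z₁ Z₂ h1 h2 h

theorem mon_one_pt {n : ℕ} (a : Fin n → ℤ) : mon a (emb (1 : TorusPt n)) = 1 := by
  simp [mon, emb]

theorem ZConnected.sat {n : ℕ} {S : Set (TorusPt n)} (hS : ZConnected S) (h1 : (1 : TorusPt n) ∈ S)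
    (a : Fin n → ℤ) (D : ℤ) (hD : D ≠ 0) (h : ∀ x ∈ S, mon (D • a) (emb x) = 1) :
    ∀ x ∈ S, mon a (emb x) = 1 := by
  classical
  have hpow : ∀ x ∈ S, mon a (emb x) ^ D.natAbs = 1 := by
    intro x hx
    have := h x hx
    rw [mon_zsmul] at this
    rcases Int.natAbs_eq D with h | h
    · rw [h, zpow_natCast] at this; exact this
    · rw [h, zpow_neg, zpow_natCast, inv_eq_one] at this; exact this
  have hpos : 0 < D.natAbs := Int.natAbs_pos.mpr hD
  let F := (Polynomial.nthRootsFinset D.natAbs (1 : Qbar)).erase 1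
  rcases hS {x | mon a (emb x) = 1} (⋃ c ∈ F, {x | mon a (emb x) = c}) (mon_closed a 1)
    (ZClosed.finset F _ fun c => mon_closed a c) (by
      intro x hx
      by_cases hx1 : mon a (emb x) = 1
      · exact Or.inl hx1
      · right
        simp only [Set.mem_iUnion]
        exact ⟨mon a (emb x), by simp [F, hx1, Polynomial.mem_nthRootsFinset hpos, hpow x hx], rfl⟩)
    (by
      ext x
      simp only [Set.mem_inter_iff, Set.mem_iUnion, Set.mem_ofPred_eq, Set.mem_empty_iff_false, iff_false]
      rintro ⟨⟨-, h2⟩, c, hc, h3⟩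
      rw [h2] at h3
      simp [F, ← h3] at hc) with h2 | h2
  · exact h2
  · have := h2 h1
    simp only [Set.mem_iUnion] at this
    obtain ⟨c, hc, h3⟩ := this
    have h4 : mon a (emb 1) = c := h3
    rw [mon_one_pt] at h4
    simp [F, ← h4] at hc

def LamH {n : ℕ} (H : Set (TorusPt n)) (a : Fin n → ℤ) : Prop := ∀ x ∈ H, mon a (emb x) = 1

theorem mem_of_LamH {n : ℕ} {H : Set (TorusPt n)} (hH : IsAlgSubgroup H) (y : TorusPt n)
    (hy : ∀ a, LamH H a → mon a (emb y) = 1) : y ∈ H := by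
  classical
  obtain ⟨hcl, h1, hmul, hinv⟩ := hH
  obtain ⟨I, hI⟩ := hcl
  let Hs : Subgroup (TorusPt n) :=
    { carrier := H, mul_mem' := fun {a b} ha hb => hmul a ha b hb, one_mem' := h1, inv_mem' := fun {a} ha => hinv a ha }
  let ψ : (Fin n →₀ ℕ) → (Hs →* Qbar) := fun m =>
    { toFun := fun x => ∏ i, emb (x : TorusPt n) i ^ m i
      map_one' := by simp [emb]
      map_mul' := by intro x y; simp [emb, mul_pow, Finset.prod_mul_distrib] }
  have hψ : ∀ m m', ψ m = ψ m' → ∏ i, emb y i ^ m i = ∏ i, emb y i ^ m' i := by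
    intro m m' h
    have h2 := hy (fun i => (m i : ℤ) - m' i) (by
      intro x hx
      have h3 : ∏ i, emb x i ^ m i = ∏ i, emb x i ^ m' i := DFunLike.congr_fun h ⟨x, hx⟩
      simp only [mon, zpow_sub₀ (emb_ne x _), zpow_natCast, Finset.prod_div_distrib]
      rw [h3, div_self]
      exact Finset.prod_ne_zero_iff.mpr fun i _ => pow_ne_zero _ (emb_ne x i))
    simp only [mon, zpow_sub₀ (emb_ne y _), zpow_natCast, Finset.prod_div_distrib] at h2
    rwa [div_eq_one_iff_eq] at h2
    exact Finset.prod_ne_zero_iff.mpr fun i _ => pow_ne_zero _ (emb_ne y i)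
  rw [hI]
  intro f hf
  have hli := linearIndependent_monoidHom Hs Qbar
  -- group coefficients by character
  let T := f.support.image ψ
  let cc : (Hs →* Qbar) → Qbar := fun χ => ∑ m ∈ f.support with ψ m = χ, coeff m f
  have hgrp : ∀ F : (Fin n →₀ ℕ) → Qbar, (∀ m m', ψ m = ψ m' → F m = F m') → ∀ F' : (Hs →* Qbar) → Qbar,
      (∀ m, F' (ψ m) = F m) →
      ∑ m ∈ f.support, coeff m f * F m = ∑ χ ∈ T, cc χ * F' χ := by
    intro F hF F' hF'
    rw [← Finset.sum_fiberwise_of_maps_to (g := ψ) (t := T) (fun m hm => Finset.mem_image_of_mem _ hm)]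
    refine Finset.sum_congr rfl fun χ hχ => ?_
    simp only [cc]
    rw [Finset.sum_mul]
    refine Finset.sum_congr rfl fun m hm => ?_
    rw [← (Finset.mem_filter.mp hm).2, hF']
  have hzero : ∀ χ ∈ T, cc χ = 0 := by
    refine linearIndependent_iff'.mp hli T cc ?_
    funext x
    have hx : (x : TorusPt n) ∈ H := x.2
    have hx' := hx
    rw [hI] at hx'
    have h3 := hx' f hf
    rw [eval_eq'] at h3
    rw [hgrp (fun m => ∏ i, (x.1 i : Qbar) ^ m i) (fun m m' h => DFunLike.congr_fun h x)
      (fun χ => χ x) (fun m => rfl)] at h3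
    simpa [Finset.sum_apply] using h3
  rw [eval_eq', hgrp (fun m => ∏ i, (y i : Qbar) ^ m i) hψ
    (fun χ => if h : ∃ m, ψ m = χ then ∏ i, (y i : Qbar) ^ (h.choose i) else 0) ?_]
  · exact Finset.sum_eq_zero fun χ hχ => by rw [hzero χ hχ, zero_mul]
  · intro m
    have hex : ∃ m', ψ m' = ψ m := ⟨m, rfl⟩
    rw [dif_pos hex]
    exact hψ _ _ hex.choose_spec

theorem LamH_rank {n s : ℕ} {H : Set (TorusPt n)} (hH : IsAlgSubgroup H) (hs : s + zdim H ≤ n) :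
    ∃ b : Fin s → Fin n → ℤ, LinearIndependent ℚ (fun j => cq (b j)) ∧ ∀ j, LamH H (b j) := by
  classical
  obtain ⟨B, hB1, hB2, hB3⟩ := exists_linearIndependent ℚ (cq '' {a : Fin n → ℤ | LamH H a})
  have hfin : Finite B := hB3.finite
  have hfinset : B.Finite := Set.toFinite B
  have := Fintype.ofFinite B
  let w := Fintype.card B
  let ε : Fin w ≃ B := (Fintype.equivFin B).symm
  have hb : ∀ j : Fin w, ∃ a, LamH H a ∧ cq a = (ε j : Fin n → ℚ) := fun j => hB1 (ε j).2
  choose b hb1 hb2 using hb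
  have hbi : LinearIndependent ℚ (fun j => cq (b j)) := by
    have : (fun j => cq (b j)) = (fun x : B => (x : Fin n → ℚ)) ∘ ε := by
      funext j; exact hb2 j
    rw [this]
    exact hB3.comp _ ε.injective
  obtain ⟨q, hq, -, h1, hcst, hd⟩ := core1 (1 : TorusPt n) ∅ (by simp) b
  have hir := zV_irred q 1 h1
  have hsub : zV q ⊆ H := by
    intro x hx
    refine mem_of_LamH hH x fun a ha => ?_
    have hspan : cq a ∈ Submodule.span ℚ (Set.range (fun j => cq (b j))) := by
      have : Set.range (fun j => cq (b j)) = B := by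
        ext z; constructor
        · rintro ⟨j, rfl⟩; simp only [hb2]; exact (ε j).2
        · intro hz; exact ⟨ε.symm ⟨z, hz⟩, by simp only [hb2]; simp⟩
      rw [this, hB2]
      exact Submodule.subset_span ⟨a, ha, rfl⟩
    obtain ⟨D, c, hD, hc⟩ := cq_span b a hspan
    refine hir.connected.sat h1 a D hD (fun z hz => ?_) x hx
    rw [hc, mon_sum (emb_ne z)]
    refine Finset.prod_eq_one fun j _ => ?_
    rw [hcst j z hz, mon_one_pt, one_zpow]
  have h2 := zdim_mono hsub
  simp only [Finset.card_empty] at hd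
  have hsw : s ≤ w := by omega
  exact ⟨fun j => b (Fin.castLE hsw j), hbi.comp _ (Fin.castLE_injective hsw), fun j => hb1 _⟩

end

section
open MvPolynomial

/-- ultrapower of a field -/
def Ult (U : Ultrafilter ℕ) (k : Type) : Type := Filter.Germ (U : Filter ℕ) k

instance (U : Ultrafilter ℕ) (k : Type) [Field k] : Field (Ult U k) :=
  inferInstanceAs (Field (Filter.Germ (U : Filter ℕ) k))

namespace Ult
variable {U : Ultrafilter ℕ} {k : Type} [Field k]

def mk (U : Ultrafilter ℕ) {k : Type} [Field k] : (ℕ → k) →+* Ult U k :=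
  Filter.Germ.coeRingHom (U : Filter ℕ)

theorem mk_eq {f g : ℕ → k} : mk U f = mk U g ↔ ∀ᶠ j in (U : Filter ℕ), f j = g j :=
  Filter.Germ.coe_eq

theorem mk_eq_zero {f : ℕ → k} : mk U f = 0 ↔ ∀ᶠ j in (U : Filter ℕ), f j = 0 := by
  rw [← map_zero (mk U), mk_eq]; rfl

theorem mk_ne_zero {f : ℕ → k} : mk U f ≠ 0 ↔ ∀ᶠ j in (U : Filter ℕ), f j ≠ 0 := by
  rw [Ne, mk_eq_zero, ← Ultrafilter.eventually_not]

theorem mk_surj (z : Ult U k) : ∃ f, mk U f = z := by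
  induction z using Filter.Germ.inductionOn with
  | _ f => exact ⟨f, rfl⟩

instance : Algebra k (Ult U k) := ((mk U).comp (Pi.constRingHom ℕ k)).toAlgebra

theorem algebraMap_eq (c : k) : algebraMap k (Ult U k) c = mk U (fun _ => c) := rfl

theorem mk_aeval {σ : Type} (x : ℕ → σ → k) (f : MvPolynomial σ k) :
    aeval (fun i => mk U (fun j => x j i)) f = mk U (fun j => eval (x j) f) := by
  induction f using MvPolynomial.induction_on with
  | C a => simp [algebraMap_eq]
  | add p q hp hq =>
    rw [map_add, hp, hq, ← map_add]; congr 1; funext j; simp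
  | mul_X p i hp =>
    rw [map_mul, hp, aeval_X, ← map_mul]; congr 1; funext j; simp

theorem mk_inv (f : ℕ → k) : mk U (fun j => (f j)⁻¹) = (mk U f)⁻¹ := rfl

theorem mk_zpow (f : ℕ → k) (m : ℤ) : mk U (fun j => f j ^ m) = mk U f ^ m := by
  rcases Int.eq_nat_or_neg m with ⟨m, rfl | rfl⟩
  · simp only [zpow_natCast]; rw [← map_pow]; rfl
  · simp only [zpow_neg, zpow_natCast]; rw [← map_pow, ← mk_inv]; rfl

theorem mk_mon {n : ℕ} (x : ℕ → Fin n → k) (a : Fin n → ℤ) :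
    mon a (fun i => mk U (fun j => x j i)) = mk U (fun j => mon a (x j)) := by
  simp only [mon]
  simp only [← mk_zpow]
  rw [← map_prod]
  congr 1; funext j; simp

def map {k' : Type} [Field k'] (f : k →+* k') : Ult U k →+* Ult U k' where
  toFun := Filter.Germ.map f
  map_one' := by
    show Filter.Germ.map f (mk U 1) = mk U 1
    show (mk U (f ∘ 1) : Ult U k') = mk U 1
    congr 1; funext j; simp
  map_zero' := by
    show (mk U (f ∘ 0) : Ult U k') = mk U 0
    congr 1; funext j; simp
  map_mul' := by
    intro x y
    obtain ⟨x, rfl⟩ := mk_surj x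
    obtain ⟨y, rfl⟩ := mk_surj y
    rw [← map_mul]
    show (mk U (f ∘ (x * y)) : Ult U k') = mk U (f ∘ x) * mk U (f ∘ y)
    rw [← map_mul]
    congr 1; funext j; simp
  map_add' := by
    intro x y
    obtain ⟨x, rfl⟩ := mk_surj x
    obtain ⟨y, rfl⟩ := mk_surj y
    rw [← map_add]
    show (mk U (f ∘ (x + y)) : Ult U k') = mk U (f ∘ x) + mk U (f ∘ y)
    rw [← map_add]
    congr 1; funext j; simp

theorem map_mk {k' : Type} [Field k'] (f : k →+* k') (x : ℕ → k) :
    map f (mk U x) = mk U (fun j => f (x j)) := rfl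
end Ult

/-- clearing denominators of Laurent monomials -/
theorem clear {n : ℕ} {ι k : Type} [Field k] (b : ι → Fin n → ℤ) (g : MvPolynomial ι k) :
    ∃ f V : MvPolynomial (Fin n) k, ∀ (K : Type) [Field K] [Algebra k K] (u : Fin n → K),
      (∀ i, u i ≠ 0) → aeval u V ≠ 0 ∧ aeval u f = aeval u V * aeval (fun i => mon (b i) u) g := by
  induction g using MvPolynomial.induction_on with
  | C c => exact ⟨C c, 1, fun K _ _ u hu => by simp⟩
  | add p q hp hq =>
    obtain ⟨f, V, h⟩ := hp
    obtain ⟨f', V', h'⟩ := hq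
    refine ⟨f * V' + f' * V, V * V', fun K _ _ u hu => ?_⟩
    obtain ⟨h1, h2⟩ := h K u hu
    obtain ⟨h1', h2'⟩ := h' K u hu
    refine ⟨by rw [map_mul]; exact mul_ne_zero h1 h1', ?_⟩
    simp only [map_add, map_mul, h2, h2']; ring
  | mul_X p i hp =>
    obtain ⟨f, V, h⟩ := hp
    refine ⟨f * monPos k (b i), V * monPos k (-b i), fun K _ _ u hu => ?_⟩
    obtain ⟨h1, h2⟩ := h K u hu
    refine ⟨by rw [map_mul]; exact mul_ne_zero h1 (aeval_monPos_ne_zero hu _), ?_⟩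
    simp only [map_mul, h2, aeval_X, aeval_monPos hu (b i)]; ring

theorem alg_rel {k K : Type} [Field k] [Field K] [Algebra k K] {w : ℕ} (u : Fin w → K) (z : K)
    (h : IsAlgebraic (Algebra.adjoin k (Set.range u)) z) :
    ∃ H : Polynomial (MvPolynomial (Fin w) k), aeval u H.leadingCoeff ≠ 0 ∧
      H.eval₂ (aeval u : MvPolynomial (Fin w) k →ₐ[k] K).toRingHom z = 0 := by
  obtain ⟨p, hp, hz⟩ := h
  have hl : ∀ c : Algebra.adjoin k (Set.range u), ∃ g : MvPolynomial (Fin w) k, aeval u g = (c : K) := by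
    rintro ⟨c, hc⟩
    rw [Algebra.adjoin_range_eq_range_aeval] at hc
    exact hc
  choose g hg using hl
  let H : Polynomial (MvPolynomial (Fin w) k) :=
    ∑ i ∈ Finset.range (p.natDegree + 1), Polynomial.C (g (p.coeff i)) * Polynomial.X ^ i
  have hco : ∀ i, aeval u (H.coeff i) = ((p.coeff i : Algebra.adjoin k (Set.range u)) : K) := by
    intro i
    simp only [H, Polynomial.finsetSum_coeff, Polynomial.coeff_C_mul, Polynomial.coeff_X_pow]
    by_cases hi : i ≤ p.natDegree
    · rw [Finset.sum_eq_single i]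
      · simp [hg]
      · intro j _ hj; simp [Ne.symm hj]
      · intro h; simp at h; omega
    · rw [Finset.sum_eq_zero]
      · rw [Polynomial.coeff_eq_zero_of_natDegree_lt (by omega)]; simp
      · intro j hj
        have : i ≠ j := by simp at hj; omega
        simp [this]
  have hdeg : H.natDegree = p.natDegree := by
    apply le_antisymm
    · refine Polynomial.natDegree_sum_le_of_forall_le _ _ fun i hi => ?_
      refine (Polynomial.natDegree_C_mul_X_pow_le _ _).trans ?_
      simp at hi; omega
    · apply Polynomial.le_natDegree_of_ne_zero
      intro h0
      have := hco p.natDegree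
      rw [h0, map_zero] at this
      have h1 : p.coeff p.natDegree = 0 := Subtype.ext this.symm
      exact hp (Polynomial.leadingCoeff_eq_zero.mp h1)
  refine ⟨H, ?_, ?_⟩
  · rw [Polynomial.leadingCoeff, hdeg, hco]
    intro h0
    exact hp (Polynomial.leadingCoeff_eq_zero.mp (Subtype.ext h0))
  · rw [Polynomial.eval₂_eq_sum_range, hdeg]
    rw [Polynomial.aeval_eq_sum_range] at hz
    rw [← hz]
    refine Finset.sum_congr rfl fun i _ => ?_
    rw [Algebra.smul_def]
    congr 1
    exact hco i

theorem ker_coset {n ρ : ℕ} (a : Fin ρ → Fin n → ℤ) (P : TorusPt n) :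
    IsCoset {x : TorusPt n | ∀ j, mon (a j) (emb x) = mon (a j) (emb P)} := by
  have hm : ∀ (b : Fin n → ℤ) (x y : TorusPt n), mon b (emb (x * y)) = mon b (emb x) * mon b (emb y) := by
    intro b x y
    simp [mon, emb, mul_zpow, Finset.prod_mul_distrib]
  have hi : ∀ (b : Fin n → ℤ) (x : TorusPt n), mon b (emb x⁻¹) = (mon b (emb x))⁻¹ := by
    intro b x
    simp [mon, emb, Finset.prod_inv_distrib]
  refine ⟨P, {x | ∀ j, mon (a j) (emb x) = 1}, ⟨?_, ?_, ?_, ?_⟩, ?_⟩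
  · have : {x : TorusPt n | ∀ j, mon (a j) (emb x) = 1} = ⋂ j, {x | mon (a j) (emb x) = 1} := by
      ext x; simp
    rw [this]
    exact ZClosed.inter_all fun j => mon_closed _ _
  · intro j; exact mon_one_pt _
  · intro x hx y hy j
    rw [hm, hx j, hy j, one_mul]
  · intro x hx j
    rw [hi, hx j, inv_one]
  · ext x
    constructor
    · intro hx
      refine ⟨P⁻¹ * x, fun j => ?_, by simp⟩
      rw [hm, hi, hx j]
      exact inv_mul_cancel₀ (mon_ne_zero (emb_ne P) _)
    · rintro ⟨y, hy, rfl⟩ j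
      show mon (a j) (emb (P * y)) = _
      rw [hm, hy j, mul_one]

theorem anomaly {n s : ℕ} (U : Ultrafilter ℕ) {X : Set (TorusPt n)} (hX : ZClosed X)
    (P : ℕ → TorusPt n) (hP : ∀ k, P k ∈ X) (xs : Fin n → Ult U Qbar)
    (hxs : xs = fun i => Ult.mk U (fun k => emb (P k) i))
    {d : ℕ} (e : Fin d → Fin n) (he : AlgebraicIndependent Qbar (fun i => xs (e i)))
    {ρ : ℕ} (a : Fin ρ → Fin n → ℤ) (ha : LinearIndependent ℚ (fun j => cq (a j)))
    {w : ℕ} (ι : Fin w → Fin ρ)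
    (halg : ∀ i, IsAlgebraic (Algebra.adjoin Qbar (Set.range fun j => mon (a (ι j)) xs)) (mon (a i) xs))
    (hw : w + 1 ≤ d) (hs : s + w < d + ρ) : ∃ k, ∃ Y, IsAnomalous X Y s ∧ P k ∈ Y := by
  let p : Ideal (MvPolynomial (Fin n) Qbar) := RingHom.ker (aeval xs : MvPolynomial (Fin n) Qbar →ₐ[Qbar] _)
  have hpp : p.IsPrime := RingHom.ker_isPrime _
  have hev : ∀ f : MvPolynomial (Fin n) Qbar, aeval xs f = Ult.mk U (fun k => eval (emb (P k)) f) := by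
    intro f; rw [hxs]; exact Ult.mk_aeval (fun k => emb (P k)) f
  have hmon : ∀ b, mon b xs = Ult.mk U (fun k => mon b (emb (P k))) := by
    intro b; rw [hxs]; exact Ult.mk_mon (fun k => emb (P k)) b
  have hxne : ∀ i, xs i ≠ 0 := by
    intro i; rw [hxs]; exact Ult.mk_ne_zero.mpr (Filter.Eventually.of_forall fun k => emb_ne _ _)
  have hp : ∀ f, f ∈ p ↔ ∀ᶠ k in (U : Filter ℕ), eval (emb (P k)) f = 0 := by
    intro f
    show aeval xs f = 0 ↔ _
    rw [hev, Ult.mk_eq_zero]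
  have hpn : ∀ f, f ∉ p → ∀ᶠ k in (U : Filter ℕ), eval (emb (P k)) f ≠ 0 := by
    intro f hf
    rw [hp] at hf
    exact Ultrafilter.eventually_not.mpr hf
  -- IndN p d
  have hInd : IndN p d := by
    refine ⟨fun i => MvPolynomial.X (e i), ?_⟩
    let κ : (MvPolynomial (Fin n) Qbar ⧸ p) →ₐ[Qbar] Ult U Qbar := Ideal.Quotient.liftₐ p (aeval xs) (fun f hf => hf)
    have : AlgebraicIndependent Qbar (κ ∘ fun i => Ideal.Quotient.mkₐ Qbar p (MvPolynomial.X (e i))) := by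
      have h2 : (κ ∘ fun i => Ideal.Quotient.mkₐ Qbar p (MvPolynomial.X (e i))) = fun i => xs (e i) := by
        funext i
        show aeval xs (MvPolynomial.X (e i)) = _
        rw [aeval_X]
      rw [h2]; exact he
    exact AlgebraicIndependent.of_comp κ this
  -- height bound
  obtain ⟨G, hG1, hG2⟩ := Ideal.exists_finset_card_eq_height_of_isNoetherianRing p
  have hGd : d + G.card ≤ n := by
    obtain ⟨l, hl, hlen⟩ := Ideal.exists_ltSeries_length_eq_height p
    have hlen' : l.length = G.card := by
      rw [← hG2] at hlen
      exact_mod_cast hlen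
    have h1 := IndN.chain (m := d) l.length (fun i => (l i).asIdeal) (fun i => (l i).2)
      (fun i j hij => l.strictMono hij) (by
        have : (l (Fin.last _)).asIdeal = p := congrArg PrimeSpectrum.asIdeal hl
        rw [this]; exact hInd)
    have := (l 0).2
    have := h1.le_n
    omega
  obtain ⟨g, hg, hgen⟩ := generic_min p _ hG1
  have hrel : ∀ i, ∃ H : Polynomial (MvPolynomial (Fin w) Qbar),
      aeval (fun j => mon (a (ι j)) xs) H.leadingCoeff ≠ 0 ∧
      H.eval₂ (aeval (fun j => mon (a (ι j)) xs) : MvPolynomial (Fin w) Qbar →ₐ[Qbar] _).toRingHom (mon (a i) xs) = 0 :=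
    fun i => alg_rel _ _ (halg i)
  choose H hH1 hH2 using hrel
  have hE1 := hpn g hg
  have hE2 : ∀ᶠ k in (U : Filter ℕ), ∀ f ∈ G, eval (emb (P k)) f = 0 := by
    rw [Filter.eventually_all_finset]
    intro f hf
    exact (hp f).mp (hG1.1.2 (Ideal.subset_span hf))
  have hE3 : ∀ᶠ k in (U : Filter ℕ), ∀ i, eval (fun j => mon (a (ι j)) (emb (P k))) (H i).leadingCoeff ≠ 0 := by
    rw [Filter.eventually_all]
    intro i
    have := hH1 i
    simp only [hmon] at this
    rw [Ult.mk_aeval (fun k j => mon (a (ι j)) (emb (P k))), Ult.mk_ne_zero] at this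
    exact this
  obtain ⟨k, hk1, hk2, hk3⟩ := (hE1.and (hE2.and hE3)).exists
  obtain ⟨q, hq, hGq, hPq, hcst, hdim⟩ := core1 (P k) G hk2 (fun j => a (ι j))
  have hpq : p ≤ q := hgen q hq (Ideal.span_le.mpr hGq) fun h => hk1 (hPq g h)
  have hYir := zV_irred q (P k) hPq
  have hYX : zV q ⊆ X := by
    intro x hx
    rw [← hX.eq_zV]
    intro f hf
    refine hx f (hpq ((hp f).mpr (Filter.Eventually.of_forall fun k => mem_vI.mp hf _ (hP k))))
  have hall : ∀ i, ∃ c, ∀ x ∈ zV q, mon (a i) (emb x) = c := by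
    intro i
    refine hYir.const (a i) ((H i).map (eval (fun j => mon (a (ι j)) (emb (P k))))) ?_ ?_
    · intro h0
      have := congrArg (fun f => Polynomial.coeff f (H i).natDegree) h0
      simp only [Polynomial.coeff_map, Polynomial.coeff_zero] at this
      exact hk3 i this
    · intro x hx
      let Hm : MvPolynomial (Option (Fin w)) Qbar :=
        (H i).eval₂ (rename some : MvPolynomial (Fin w) Qbar →ₐ[Qbar] _).toRingHom (MvPolynomial.X none)
      let b : Option (Fin w) → Fin n → ℤ := fun o => o.elim (a i) (fun j => a (ι j))
      have hHm : ∀ (K : Type) [Field K] [Algebra Qbar K] (u : Fin n → K), (∀ i, u i ≠ 0) →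
          aeval (fun o => mon (b o) u) Hm = (H i).eval₂ (aeval (fun j => mon (a (ι j)) u) :
            MvPolynomial (Fin w) Qbar →ₐ[Qbar] _).toRingHom (mon (a i) u) := by
        intro K _ _ u hu
        have := Polynomial.hom_eval₂ (H i) (rename some : MvPolynomial (Fin w) Qbar →ₐ[Qbar] _).toRingHom
          (aeval (fun o => mon (b o) u) : MvPolynomial (Option (Fin w)) Qbar →ₐ[Qbar] K).toRingHom (MvPolynomial.X none)
        refine this.trans ?_
        congr 1
        · ext j
          · simp
          · simp [b]
        · simp [b]
      obtain ⟨f, V, hfV⟩ := clear b Hm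
      have hfp : f ∈ p := by
        show aeval xs f = 0
        rw [(hfV _ xs hxne).2, hHm _ xs hxne, hH2, mul_zero]
      have h4 : aeval (emb x) f = 0 := by
        have := hx f (hpq hfp)
        simpa using this
      rw [(hfV _ (emb x) (emb_ne x)).2] at h4
      have h5 := (mul_eq_zero.mp h4).resolve_left (hfV _ (emb x) (emb_ne x)).1
      rw [hHm _ (emb x) (emb_ne x)] at h5
      rw [Polynomial.eval_map]
      rw [← h5]
      congr 1
      ext j
      · simp
      · simp [hcst j x hx]
  refine ⟨k, zV q, ⟨hYX, zV_closed q, hYir, by omega, _, ker_coset a (P k), ?_, ?_⟩, hPq⟩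
  · intro x hx i
    obtain ⟨c, hc⟩ := hall i
    rw [hc x hx, hc _ hPq]
  · have hρ : zdim {x : TorusPt n | ∀ j, mon (a j) (emb x) = mon (a j) (emb (P k))} + ρ ≤ n := by
      have h0 : ρ ≤ n := by
        have := ha.fintype_card_le_finrank
        simpa using this
      have := zdim_le {x : TorusPt n | ∀ j, mon (a j) (emb x) = mon (a j) (emb (P k))} (n - ρ)
        (fun Z hZ hZS m hm => by
          have := coset_bound a ha Z hZ _ (fun j x hx => hZS hx j) m hm
          omega)
      omega
    omega

end

section
open MvPolynomial

theorem na_int {E : Type} [Field E] (v : AbsoluteValue E ℝ)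
    (hv : ∀ x y, v (x + y) ≤ max (v x) (v y)) (m : ℤ) : v (m : E) ≤ 1 := by
  have hna : IsNonarchimedean v := hv
  exact hna.apply_intCast_le_one

theorem na_coprime {E : Type} [Field E] (v : AbsoluteValue E ℝ)
    (hv : ∀ x y, v (x + y) ≤ max (v x) (v y)) (a b : ℤ) : v ((Int.gcd a b : ℤ) : E) ≤ max (v a) (v b) := by
  rw [Int.gcd_eq_gcd_ab]
  push_cast
  refine (hv _ _).trans (max_le_max ?_ ?_)
  · rw [map_mul]
    exact mul_le_of_le_one_right (v.nonneg _) (na_int v hv _)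
  · rw [map_mul]
    exact mul_le_of_le_one_right (v.nonneg _) (na_int v hv _)

theorem na_lcm {E : Type} [Field E] [CharZero E] (v : AbsoluteValue E ℝ)
    (hv : ∀ x y, v (x + y) ≤ max (v x) (v y)) {ι : Type} (s : Finset ι) (f : ι → ℕ)
    (hf0 : ∀ i, f i ≠ 0) (r : ℝ) (hr : r ≤ 1) (h : ∀ i ∈ s, r ≤ v (f i : E)) :
    r ≤ v ((s.lcm f : ℕ) : E) := by
  classical
  induction s using Finset.induction_on with
  | empty => simpa using hr
  | insert a s ha ih =>
    rw [Finset.lcm_insert]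
    have h1 := h a (by simp)
    have h2 := ih fun i hi => h i (by simp [hi])
    set A := f a
    set B := s.lcm f with hB
    have hB0 : B ≠ 0 := by
      rw [hB, Ne, Finset.lcm_eq_zero_iff]
      simp only [not_exists, not_and]
      intro i _ ; exact hf0 i
    have hA0 : A ≠ 0 := hf0 a
    have h3 : (Nat.gcd A B) * (Nat.lcm A B) = A * B := Nat.gcd_mul_lcm A B
    have h4 : v ((Nat.gcd A B : ℕ) : E) * v ((Nat.lcm A B : ℕ) : E) = v (A : E) * v (B : E) := by
      rw [← map_mul, ← map_mul]; congr 1; exact_mod_cast h3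
    have h5 := na_coprime v hv A B
    simp only [Int.gcd_natCast_natCast, Int.cast_natCast] at h5
    have hA1 : v (A : E) ≤ 1 := by simpa using na_int v hv A
    have hB1 : v (B : E) ≤ 1 := by simpa using na_int v hv B
    have hApos : 0 < v (A : E) := v.pos (by exact_mod_cast hA0)
    have hBpos : 0 < v (B : E) := v.pos (by exact_mod_cast hB0)
    show r ≤ v ((Nat.lcm A B : ℕ) : E)
    have hlpos : 0 ≤ v ((Nat.lcm A B : ℕ) : E) := v.nonneg _
    rcases le_total (v (A : E)) (v (B : E)) with hab | hab
    · rw [max_eq_right hab] at h5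
      have : v (A : E) ≤ v ((Nat.lcm A B : ℕ) : E) := by
        have : v (A : E) * v (B : E) ≤ v (B : E) * v ((Nat.lcm A B : ℕ) : E) := by
          rw [← h4]; gcongr
        nlinarith
      linarith
    · rw [max_eq_left hab] at h5
      have : v (B : E) ≤ v ((Nat.lcm A B : ℕ) : E) := by
        have : v (A : E) * v (B : E) ≤ v (A : E) * v ((Nat.lcm A B : ℕ) : E) := by
          rw [← h4]; gcongr
        nlinarith
      linarith

theorem na_coeff {E : Type} [Field E] (v : AbsoluteValue E ℝ)
    (hv : ∀ x y, v (x + y) ≤ max (v x) (v y)) (R : Multiset E) :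
    1 ≤ (R.map fun a => max 1 (v a)).prod ∧ ∀ i, v (((R.map fun a => Polynomial.X - Polynomial.C a).prod).coeff i) ≤
      (R.map fun a => max 1 (v a)).prod := by
  induction R using Multiset.induction_on with
  | empty =>
    refine ⟨by simp, fun i => ?_⟩
    simp only [Multiset.map_zero, Multiset.prod_zero, Polynomial.coeff_one]
    split_ifs <;> simp
  | cons a R ih =>
    obtain ⟨ih1, ih⟩ := ih
    simp only [Multiset.map_cons, Multiset.prod_cons]
    set M := (R.map fun a => max 1 (v a)).prod
    set p := (R.map fun a => Polynomial.X - Polynomial.C a).prod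
    have hm : 1 ≤ max 1 (v a) := le_max_left _ _
    have hm' : v a ≤ max 1 (v a) := le_max_right _ _
    refine ⟨by nlinarith, fun i => ?_⟩
    have hc : ((Polynomial.X - Polynomial.C a) * p).coeff i = (Polynomial.X * p).coeff i + (- a * p.coeff i) := by
      rw [sub_mul, Polynomial.coeff_sub, Polynomial.coeff_C_mul]; ring
    rw [hc]
    refine (hv _ _).trans (max_le ?_ ?_)
    · have : v ((Polynomial.X * p).coeff i) ≤ M := by
        rcases i with _ | i
        · simp; linarith
        · rw [Polynomial.coeff_X_mul]; exact ih i
      nlinarith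
    · rw [map_mul, v.map_neg]
      exact mul_le_mul hm' (ih i) (v.nonneg _) (by linarith)

/-- lower bound for the `v`-size of the denominator of a minimal polynomial -/
theorem na_den {E : Type} [Field E] [CharZero E] (v : AbsoluteValue E ℝ)
    (hv : ∀ x y, v (x + y) ≤ max (v x) (v y)) (p : Polynomial ℚ) (R : Multiset E)
    (hp : p.map (algebraMap ℚ E) = (R.map fun a => Polynomial.X - Polynomial.C a).prod) :
    (R.map fun a => max 1 (v a)).prod⁻¹ ≤ v ((p.support.lcm fun i => (p.coeff i).den : ℕ) : E) := by
  obtain ⟨h1, h2⟩ := na_coeff v hv R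
  set M := (R.map fun a => max 1 (v a)).prod
  refine na_lcm v hv _ _ (fun i => (p.coeff i).den_ne_zero) _ (inv_le_one_of_one_le₀ h1) fun i _ => ?_
  have h3 := h2 i
  rw [← hp, Polynomial.coeff_map] at h3
  set c := p.coeff i
  have hden : (c.den : E) ≠ 0 := by exact_mod_cast c.den_ne_zero
  have h4 : algebraMap ℚ E c * (c.den : E) = (c.num : E) := by
    have : (c * c.den : ℚ) = c.num := Rat.mul_den_eq_num c
    have := congrArg (algebraMap ℚ E) this
    rwa [map_mul, map_natCast, map_intCast] at this
  have h5 := na_coprime v hv c.num c.den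
  have h6 : Int.gcd c.num c.den = 1 := by
    have := c.reduced
    rwa [Nat.Coprime, ← Int.natAbs_natCast c.den] at this
  rw [h6] at h5
  simp only [Nat.cast_one, Int.cast_one, map_one, Int.cast_natCast] at h5
  rw [← h4, map_mul] at h5
  have hv0 : 0 ≤ v (c.den : E) := v.nonneg _
  rw [inv_le_iff_one_le_mul₀ (by linarith)]
  rcases le_max_iff.mp h5 with h | h <;> nlinarith

theorem sum_galois {E : Type} [Field E] [Algebra ℚ E] [FiniteDimensional ℚ E] [IsGalois ℚ E]
    (α : E) (f : E → ℝ) :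
    ((minpoly ℚ α).natDegree : ℝ) * ∑ g : Gal(E/ℚ), f (g α) =
      (Fintype.card Gal(E/ℚ) : ℝ) * (((minpoly ℚ α).aroots E).map f).sum := by
  classical
  set R := (minpoly ℚ α).aroots E with hR
  have hIntg : IsIntegral ℚ α := Algebra.IsIntegral.isIntegral α
  have hcard : R.card = (minpoly ℚ α).natDegree := by
    have h := IsGalois.splits ℚ α
    rw [hR, Polynomial.aroots, ← h.natDegree_eq_card_roots, Polynomial.natDegree_map]
  have h1 : (R.map fun a => ∑ g : Gal(E/ℚ), f (g a)).sum =
      ((minpoly ℚ α).natDegree : ℝ) * ∑ g : Gal(E/ℚ), f (g α) := by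
    have : ∀ a ∈ R, ∑ g : Gal(E/ℚ), f (g a) = ∑ g : Gal(E/ℚ), f (g α) := by
      intro a ha
      obtain ⟨h, rfl⟩ : ∃ h : Gal(E/ℚ), h α = a := by
        have h0 : Polynomial.aeval a (minpoly ℚ α) = 0 := by
          rw [hR, Polynomial.mem_aroots'] at ha; exact ha.2
        have h5 : minpoly ℚ α = minpoly ℚ a :=
          minpoly.eq_of_irreducible_of_monic (minpoly.irreducible hIntg) h0 (minpoly.monic hIntg)
        exact (Normal.minpoly_eq_iff_mem_orbit E).mp h5.symm
      exact Fintype.sum_equiv (Equiv.mulRight h) _ _ (fun g => rfl)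
    rw [Multiset.map_congr rfl this, Multiset.map_const', Multiset.sum_replicate, hcard, nsmul_eq_mul]
  have h2 : (R.map fun a => ∑ g : Gal(E/ℚ), f (g a)).sum = ∑ g : Gal(E/ℚ), (R.map fun a => f (g a)).sum := by
    rw [Multiset.sum_map_sum]
  have h3 : ∀ g : Gal(E/ℚ), (R.map fun a => f (g a)).sum = (R.map f).sum := by
    intro g
    have h4 : R.map g = R := by
      rw [hR, Polynomial.aroots]
      have h := IsGalois.splits ℚ α
      have := Polynomial.Splits.roots_map h (g : E ≃ₐ[ℚ] E).toRingEquiv.toRingHom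
      rw [Polynomial.map_map] at this
      have h6 : ((g : E ≃ₐ[ℚ] E).toRingEquiv.toRingHom.comp (algebraMap ℚ E)) = algebraMap ℚ E := by
        ext q; simp
      rw [h6] at this
      exact this.symm
    conv_rhs => rw [← h4, Multiset.map_map]
    rfl
  rw [← h1, h2]
  simp [h3]

end

section
open MvPolynomial

open NumberField in
theorem pf {E : Type} [Field E] [NumberField E] (y : E) (hy : y ≠ 0) (F : Finset (FinitePlace E))
    (hF : ∀ w : FinitePlace E, w ∉ F → w y = 1) :
    ∑ w : InfinitePlace E, (w.mult : ℝ) * Real.log (w y) + ∑ w ∈ F, Real.log (w y) = 0 := by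
  have h := prod_abs_eq_one hy
  rw [finprod_eq_prod_of_mulSupport_subset (s := F)] at h
  · have h2 := congrArg Real.log h
    rw [Real.log_one, Real.log_mul, Real.log_prod, Real.log_prod] at h2
    · simpa [Real.log_pow] using h2
    · intro w _
      exact (FinitePlace.pos_iff.2 hy).ne'
    · intro w _
      exact pow_ne_zero _ (InfinitePlace.pos_iff.2 hy).ne'
    · exact Finset.prod_ne_zero_iff.2 fun w _ => pow_ne_zero _ (InfinitePlace.pos_iff.2 hy).ne'
    · exact Finset.prod_ne_zero_iff.2 fun w _ => (FinitePlace.pos_iff.2 hy).ne'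
  · intro w hw
    by_contra hc
    exact hw (hF w hc)

open NumberField in
theorem fp_na {E : Type} [Field E] [NumberField E] (w : FinitePlace E) (x y : E) :
    w.1 (x + y) ≤ max (w.1 x) (w.1 y) := FinitePlace.add_le w x y

open NumberField in
theorem fp_int {E : Type} [Field E] [NumberField E] (w : FinitePlace E) (x : E) (hx : IsIntegral ℤ x) :
    w x ≤ 1 := by
  rw [← FinitePlace.norm_embedding_eq]
  exact FinitePlace.norm_le_one E w.maximalIdeal (⟨x, hx⟩ : 𝓞 E)

theorem sum_log_max {E : Type} (v : E → ℝ) (R : Multiset E) :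
    Real.log (R.map fun a => max 1 (v a)).prod = (R.map fun a => Real.log (max 1 (v a))).sum := by
  induction R using Multiset.induction_on with
  | empty => simp
  | cons a R ih =>
    simp only [Multiset.map_cons, Multiset.prod_cons, Multiset.sum_cons]
    rw [Real.log_mul, ih]
    · positivity
    · refine Multiset.prod_ne_zero ?_
      simp only [Multiset.mem_map, not_exists, not_and]
      intro x _
      positivity

theorem log1_nonneg (x : ℝ) : 0 ≤ Real.log (max 1 x) := Real.log_nonneg (le_max_left _ _)

theorem aroots_map {E : Type} [Field E] [Algebra ℚ E] [FiniteDimensional ℚ E] [IsGalois ℚ E]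
    (α : E) (φ : E →+* ℂ) : (minpoly ℚ α).aroots ℂ = ((minpoly ℚ α).aroots E).map φ := by
  have h := IsGalois.splits ℚ α
  have h2 := Polynomial.Splits.roots_map h φ
  unfold Polynomial.aroots
  rw [← h2, Polynomial.map_map]
  congr 2
  exact Subsingleton.elim _ _

open NumberField in
theorem wh_le {E : Type} [Field E] [NumberField E] [IsGalois ℚ E] (α : E)
    (F : Finset (FinitePlace E)) (hF : ∀ w : FinitePlace E, w ∉ F → ∀ g : Gal(E/ℚ), w (g α) = 1) :
    (Real.log (((minpoly ℚ α).support.lcm fun i => ((minpoly ℚ α).coeff i).den : ℕ) : ℝ) +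
      (((minpoly ℚ α).aroots ℂ).map fun z => Real.log (max 1 ‖z‖)).sum) /
    ((minpoly ℚ α).natDegree : ℝ) * (Module.finrank ℚ E * Fintype.card Gal(E/ℚ)) ≤
      ∑ g : Gal(E/ℚ), (∑ w : InfinitePlace E, (w.mult : ℝ) * Real.log (max 1 (w (g α))) +
        ∑ w ∈ F, Real.log (max 1 (w (g α)))) := by
  classical
  set R := (minpoly ℚ α).aroots E with hR
  set D : ℕ := (minpoly ℚ α).support.lcm fun i => ((minpoly ℚ α).coeff i).den with hD
  have hIntg : IsIntegral ℚ α := Algebra.IsIntegral.isIntegral α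
  have hp : (minpoly ℚ α).map (algebraMap ℚ E) = (R.map fun a => Polynomial.X - Polynomial.C a).prod := by
    have := (IsGalois.splits ℚ α).eq_prod_roots
    rw [this, hR]
    simp [minpoly.monic hIntg, Polynomial.aroots]
  have hD0 : D ≠ 0 := by
    rw [hD, Ne, Finset.lcm_eq_zero_iff]
    rintro ⟨i, _, h⟩
    exact ((minpoly ℚ α).coeff i).den_ne_zero h
  have hRg : ∀ r ∈ R, ∃ g : Gal(E/ℚ), g α = r := by
    intro r hr
    rw [hR, Polynomial.mem_aroots] at hr
    have h1 := minpoly.eq_of_irreducible_of_monic (minpoly.irreducible hIntg) hr.2 (minpoly.monic hIntg)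
    have := (Normal.minpoly_eq_iff_mem_orbit (F := ℚ) E (x := r) (y := α)).1 h1.symm
    obtain ⟨g, hg⟩ := this
    exact ⟨g, hg⟩
  have hDE : (D : E) ≠ 0 := by exact_mod_cast hD0
  have hDle : ∀ w : FinitePlace E, -Real.log (w (D : E)) ≤ (R.map fun a => Real.log (max 1 (w a))).sum := by
    intro w
    have h := na_den w.1 (fp_na w) (minpoly ℚ α) R hp
    rw [← hD] at h
    have h3 : (0:ℝ) < (R.map fun a => max 1 (w.1 a)).prod := lt_of_lt_of_le one_pos (na_coeff w.1 (fp_na w) R).1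
    have h2 := Real.log_le_log (inv_pos.2 h3) h
    rw [Real.log_inv, sum_log_max] at h2
    have : w.1 (D : E) = w (D:E) := rfl
    rw [this] at h2
    have h4 : (R.map fun a => Real.log (max 1 (w.1 a))) = (R.map fun a => Real.log (max 1 (w a))) := rfl
    rw [h4] at h2
    linarith
  have hD1 : ∀ w : FinitePlace E, w ∉ F → w (D : E) = 1 := by
    intro w hw
    have h := na_den w.1 (fp_na w) (minpoly ℚ α) R hp
    rw [← hD] at h
    have h5 : (R.map fun a => max 1 (w.1 a)) = R.map fun _ => 1 := by
      refine Multiset.map_congr rfl fun r hr => ?_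
      obtain ⟨g, rfl⟩ := hRg r hr
      have : w.1 (g α) = 1 := hF w hw g
      rw [this, max_self]
    rw [h5] at h
    simp only [Multiset.map_const', Multiset.prod_replicate, one_pow, inv_one] at h
    have h6 := na_int w.1 (fp_na w) (D : ℤ)
    rw [Int.cast_natCast] at h6
    exact le_antisymm h6 h
  have hpf := pf (D : E) hDE F hD1
  have hinf : ∑ w : InfinitePlace E, (w.mult : ℝ) * Real.log (w (D : E)) = Module.finrank ℚ E * Real.log D := by
    rw [← InfinitePlace.sum_mult_eq, Nat.cast_sum, Finset.sum_mul]
    refine Finset.sum_congr rfl fun w _ => ?_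
    rw [← InfinitePlace.norm_embedding_eq, map_natCast, Complex.norm_natCast]
  have hN : (Module.finrank ℚ E : ℝ) * Real.log D ≤ ∑ w ∈ F, (R.map fun a => Real.log (max 1 (w a))).sum := by
    rw [← hinf]
    calc _ = ∑ w ∈ F, -Real.log (w (D:E)) := by rw [Finset.sum_neg_distrib]; linarith
      _ ≤ _ := Finset.sum_le_sum fun w _ => hDle w
  have hA : (Module.finrank ℚ E : ℝ) * (((minpoly ℚ α).aroots ℂ).map fun z => Real.log (max 1 ‖z‖)).sum =
      ∑ w : InfinitePlace E, (w.mult : ℝ) * (R.map fun a => Real.log (max 1 (w a))).sum := by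
    rw [← InfinitePlace.sum_mult_eq, Nat.cast_sum, Finset.sum_mul]
    refine Finset.sum_congr rfl fun w _ => ?_
    rw [aroots_map α w.embedding, Multiset.map_map]
    congr 2
    refine Multiset.map_congr rfl fun r _ => ?_
    simp [InfinitePlace.norm_embedding_eq]
  have hdeg : (0:ℝ) < (minpoly ℚ α).natDegree := by exact_mod_cast minpoly.natDegree_pos hIntg
  have hG : (0:ℝ) ≤ Fintype.card Gal(E/ℚ) := by positivity
  have hsw : (minpoly ℚ α).natDegree * ∑ g : Gal(E/ℚ), (∑ w : InfinitePlace E, (w.mult : ℝ) * Real.log (max 1 (w (g α))) +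
        ∑ w ∈ F, Real.log (max 1 (w (g α)))) = Fintype.card Gal(E/ℚ) *
        (∑ w : InfinitePlace E, (w.mult : ℝ) * (R.map fun a => Real.log (max 1 (w a))).sum +
          ∑ w ∈ F, (R.map fun a => Real.log (max 1 (w a))).sum) := by
    rw [Finset.sum_add_distrib, mul_add, mul_add, Finset.sum_comm, Finset.sum_comm (t := F)]
    congr 1
    · rw [Finset.mul_sum, Finset.mul_sum]
      refine Finset.sum_congr rfl fun w _ => ?_
      rw [← Finset.mul_sum, mul_left_comm, sum_galois α (fun a => Real.log (max 1 (w a)))]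
      ring
    · rw [Finset.mul_sum, Finset.mul_sum]
      refine Finset.sum_congr rfl fun w _ => ?_
      rw [sum_galois α (fun a => Real.log (max 1 (w a)))]
  refine le_of_mul_le_mul_left ?_ hdeg
  rw [hsw]
  calc _ = Fintype.card Gal(E/ℚ) * ((Module.finrank ℚ E : ℝ) * Real.log D + (Module.finrank ℚ E : ℝ) * (((minpoly ℚ α).aroots ℂ).map fun z => Real.log (max 1 ‖z‖)).sum) := by
        field_simp
    _ ≤ _ := by
        refine mul_le_mul_of_nonneg_left ?_ hG
        rw [hA]
        linarith

end

section
open MvPolynomial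

instance qbar_alg : Algebra.IsAlgebraic ℚ Qbar := by
  have h : @Algebra.IsAlgebraic ℚ Qbar _ _ (AlgebraicClosure.instAlgebra ℚ) := AlgebraicClosure.isAlgebraic ℚ
  have e : (AlgebraicClosure.instAlgebra ℚ : Algebra ℚ Qbar) = DivisionRing.toRatAlgebra := Subsingleton.elim _ _
  rw [e] at h
  exact h

instance : Algebra.IsSeparable ℚ Qbar := inferInstance

instance : Normal ℚ Qbar := by
  have : Algebra.IsIntegral ℚ Qbar := inferInstance
  exact normal_iff.2 fun x => ⟨Algebra.IsIntegral.isIntegral x, IsAlgClosed.splits _⟩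

instance : IsGalois ℚ Qbar where

theorem exists_int_mult (α : Qbar) : ∃ A : ℤ, A ≠ 0 ∧ IsIntegral ℤ ((A : Qbar) * α) := by
  have h : IsAlgebraic ℤ α := by
    exact (IsFractionRing.isAlgebraic_iff ℤ ℚ Qbar).2 (qbar_alg.isAlgebraic α)
  obtain ⟨A, hA, h2⟩ := h.exists_integral_multiple
  exact ⟨A, hA, by simpa [zsmul_eq_mul] using h2⟩

def intMult (α : Qbar) : ℤ := (exists_int_mult α).choose

/-- a crude upper bound for the height of a fixed algebraic number -/
def hB (α : Qbar) : ℝ := Real.log |(intMult α : ℝ)| + (((minpoly ℚ α).aroots ℂ).map fun z => Real.log (max 1 ‖z‖)).sum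

open NumberField in
theorem hB_le {E : Type} [Field E] [NumberField E] [IsGalois ℚ E] (c : E) (A : ℤ) (hA : A ≠ 0)
    (hc : IsIntegral ℤ ((A : E) * c)) (F : Finset (FinitePlace E)) (g : Gal(E/ℚ)) :
    ∑ w : InfinitePlace E, (w.mult : ℝ) * Real.log (max 1 (w (g c))) +
        ∑ w ∈ F, Real.log (max 1 (w (g c))) ≤ Module.finrank ℚ E * (Real.log |(A : ℝ)| +
          (((minpoly ℚ c).aroots ℂ).map fun z => Real.log (max 1 ‖z‖)).sum) := by
  classical
  rw [mul_add, add_comm]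
  have hAE : (A : E) ≠ 0 := by exact_mod_cast hA
  refine add_le_add ?_ ?_
  · have hfin := FinitePlace.hasFiniteMulSupport hAE
    set F' := F ∪ hfin.toFinset with hF'
    have hpf := pf (A : E) hAE F' (by
      intro w hw
      by_contra hh
      apply hw
      rw [hF', Finset.mem_union]
      right
      exact hfin.mem_toFinset.2 hh)
    have hinf : ∑ w : InfinitePlace E, (w.mult : ℝ) * Real.log (w (A : E)) = Module.finrank ℚ E * Real.log |(A:ℝ)| := by
      rw [← InfinitePlace.sum_mult_eq, Nat.cast_sum, Finset.sum_mul]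
      refine Finset.sum_congr rfl fun w _ => ?_
      rw [← InfinitePlace.norm_embedding_eq, map_intCast, Complex.norm_intCast]
    have hle : ∀ w : FinitePlace E, w (A : E) ≤ 1 := fun w => na_int w.1 (fp_na w) A
    calc _ ≤ ∑ w ∈ F, -Real.log (w (A : E)) := by
          refine Finset.sum_le_sum fun w _ => ?_
          have h1 : w ((A : E) * g c) ≤ 1 := by
            apply fp_int
            have := hc.map (g.toAlgHom.restrictScalars ℤ)
            simpa using this
          rw [map_mul] at h1
          have h0 : 0 < w (A : E) := FinitePlace.pos_iff.2 hAE
          rw [← Real.log_inv]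
          apply Real.log_le_log (by positivity)
          refine max_le (one_le_inv_iff₀.2 ⟨h0, hle w⟩) ?_
          rw [← one_div, le_div_iff₀ h0]
          linarith
      _ ≤ ∑ w ∈ F', -Real.log (w (A : E)) := by
          refine Finset.sum_le_sum_of_subset_of_nonneg Finset.subset_union_left fun w _ _ => ?_
          have := Real.log_nonpos (apply_nonneg w (A : E)) (hle w)
          linarith
      _ = _ := by rw [Finset.sum_neg_distrib, ← hinf]; linarith
  · rw [← InfinitePlace.sum_mult_eq, Nat.cast_sum, Finset.sum_mul]
    refine Finset.sum_le_sum fun w _ => ?_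
    refine mul_le_mul_of_nonneg_left ?_ (by positivity)
    refine Multiset.single_le_sum ?_ _ ?_
    · intro y hy
      obtain ⟨z, _, rfl⟩ := Multiset.mem_map.1 hy
      exact log1_nonneg _
    · refine Multiset.mem_map.2 ⟨w.embedding (g c), ?_, by rw [InfinitePlace.norm_embedding_eq]⟩
      rw [Polynomial.mem_aroots]
      refine ⟨minpoly.ne_zero (Algebra.IsIntegral.isIntegral c), ?_⟩
      have h1 : Polynomial.aeval (g c) (minpoly ℚ c) = 0 := by
        rw [show g c = g.toAlgHom c from rfl, Polynomial.aeval_algHom_apply, minpoly.aeval, map_zero]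
      have h2 := congrArg w.embedding h1
      rw [map_zero] at h2
      have h3 := Polynomial.aeval_algHom_apply (RingHom.toRatAlgHom w.embedding) (g c) (minpoly ℚ c)
      exact h3.trans h2

structure Places {κ : Type} [Fintype κ] (x : κ → Qbar) where
  E : IntermediateField ℚ Qbar
  mem : ∀ j, x j ∈ E
  ι : Type
  fin : Fintype ι
  w : ι → ℝ
  v : ι → AbsoluteValue E ℝ
  A : Finset ι
  w0 : ∀ i, 0 ≤ w i
  wA : ∑ i ∈ A, w i = 1
  na : ∀ i, i ∉ A → ∀ y z, v i (y + z) ≤ max (v i y) (v i z)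
  prod : ∀ j, ∑ i, w i * Real.log (v i ⟨x j, mem j⟩) = 0
  height : ∀ a : κ → ℤ, weilHeight (∏ j, x j ^ a j) ≤
    ∑ i, w i * Real.log (max 1 (v i (∏ j, (⟨x j, mem j⟩ : E) ^ a j)))
  bound : ∀ j, ∑ i, w i * Real.log (max 1 (v i ⟨x j, mem j⟩)) ≤ hB (x j)

open NumberField in
theorem places_exist {κ : Type} [Fintype κ] (x : κ → Qbar) (hx : ∀ j, x j ≠ 0) : Nonempty (Places x) := by
  classical
  set E0 := FiniteGaloisIntermediateField.adjoin ℚ (Set.range x) with hE0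
  let E : IntermediateField ℚ Qbar := E0.toIntermediateField
  have hmem : ∀ j, x j ∈ E := fun j => FiniteGaloisIntermediateField.subset_adjoin ℚ (Set.range x) ⟨j, rfl⟩
  have : FiniteDimensional ℚ E := E0.finiteDimensional
  have : IsGalois ℚ E := E0.isGalois
  have : NumberField E := { }
  set x' : κ → E := fun j => ⟨x j, hmem j⟩ with hx'
  have hx0 : ∀ j, x' j ≠ 0 := fun j h => hx j (congrArg Subtype.val h)
  have hg0 : ∀ j (g : Gal(E/ℚ)), g (x' j) ≠ 0 := fun j g => by simpa using hx0 j
  let F : Finset (FinitePlace E) := Finset.univ.biUnion fun j : κ => Finset.univ.biUnion fun g : Gal(E/ℚ) =>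
    (FinitePlace.hasFiniteMulSupport (hg0 j g)).toFinset
  have hF : ∀ w : FinitePlace E, w ∉ F → ∀ (j : κ) (g : Gal(E/ℚ)), w (g (x' j)) = 1 := by
    intro w hw j g
    by_contra hc
    apply hw
    simp only [F, Finset.mem_biUnion, Finset.mem_univ, true_and]
    exact ⟨j, g, (Set.Finite.mem_toFinset _).2 hc⟩
  set c : ℝ := ((Module.finrank ℚ E : ℝ) * Fintype.card Gal(E/ℚ))⁻¹ with hc
  have hN : (0:ℝ) < Module.finrank ℚ E := by exact_mod_cast Module.finrank_pos
  have hG : (0:ℝ) < Fintype.card Gal(E/ℚ) := by exact_mod_cast Fintype.card_pos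
  have hc0 : 0 < c := by positivity
  let ι := Gal(E/ℚ) × (InfinitePlace E ⊕ F)
  let wt : ι → ℝ := fun i => Sum.elim (fun p => c * (p.mult : ℝ)) (fun _ => c) i.2
  let v : ι → AbsoluteValue E ℝ := fun i =>
    Sum.elim (fun p : InfinitePlace E => p.1.comp (f := (i.1 : E →+* E)) (RingHom.injective _))
      (fun p : F => p.1.1.comp (f := (i.1 : E →+* E)) (RingHom.injective _)) i.2
  have key : ∀ (φ : ℝ → ℝ) (y : E), ∑ i : ι, wt i * φ (v i y) =
      c * ∑ g : Gal(E/ℚ), (∑ w : InfinitePlace E, (w.mult : ℝ) * φ (w (g y)) + ∑ w ∈ F, φ (w (g y))) := by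
    intro φ y
    rw [Fintype.sum_prod_type, Finset.mul_sum]
    refine Finset.sum_congr rfl fun g _ => ?_
    rw [Fintype.sum_sum_type, mul_add, Finset.mul_sum, Finset.mul_sum, ← Finset.sum_coe_sort F]
    congr 1
    refine Finset.sum_congr rfl fun w _ => ?_
    exact mul_assoc _ _ _
  refine ⟨⟨E, hmem, ι, inferInstance, wt, v, Finset.univ.filter (fun i => i.2.isLeft), ?_, ?_, ?_, ?_, ?_, ?_⟩⟩
  · rintro ⟨g, p | p⟩
    · show 0 ≤ c * (p.mult : ℝ)
      positivity
    · exact hc0.le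
  · rw [Finset.sum_filter, Fintype.sum_prod_type]
    have : ∀ g : Gal(E/ℚ), ∑ y : InfinitePlace E ⊕ F, (if (Sum.isLeft y) = true then wt (g, y) else 0) = c * Module.finrank ℚ E := by
      intro g
      rw [Fintype.sum_sum_type]
      simp only [Sum.isLeft_inl, Sum.isLeft_inr, if_true, wt, Sum.elim_inl]
      rw [← Finset.mul_sum, ← Nat.cast_sum, InfinitePlace.sum_mult_eq]
      simp
    rw [Finset.sum_congr rfl fun g _ => this g, Finset.sum_const, Finset.card_univ, nsmul_eq_mul, hc]
    field_simp
  · rintro ⟨g, p | p⟩ h y z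
    · simp at h
    · show p.1.1 (g (y + z)) ≤ max (p.1.1 (g y)) (p.1.1 (g z))
      rw [map_add]
      exact fp_na p.1 _ _
  · intro j
    rw [key]
    have : ∀ g : Gal(E/ℚ), (∑ w : InfinitePlace E, (w.mult : ℝ) * Real.log (w (g (x' j))) + ∑ w ∈ F, Real.log (w (g (x' j)))) = 0 :=
      fun g => pf _ (hg0 j g) F fun w hw => hF w hw j g
    rw [Finset.sum_congr rfl fun g _ => this g]
    simp
  · intro a
    set y : E := ∏ j, x' j ^ a j with hy
    have hyx : ((y : E) : Qbar) = ∏ j, x j ^ a j := by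
      rw [hy]
      push_cast
      rfl
    have h := wh_le y F (by
      intro w hw g
      rw [hy, map_prod, map_prod]
      refine Finset.prod_eq_one fun j _ => ?_
      rw [map_zpow₀, map_zpow₀, hF w hw j g, one_zpow])
    refine le_trans ?_ (key (fun t => Real.log (max 1 t)) y).ge
    have hm : minpoly ℚ (∏ j, x j ^ a j) = minpoly ℚ y := by
      rw [← hyx]
      exact minpoly.algebraMap_eq (RingHom.injective (algebraMap E Qbar)) y
    unfold weilHeight
    rw [hm]
    rw [hc, ← div_eq_inv_mul, le_div_iff₀ (by positivity)]
    exact h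
  · intro j
    rw [key (fun t => Real.log (max 1 t))]
    have hm : minpoly ℚ (x j) = minpoly ℚ (x' j) :=
      minpoly.algebraMap_eq (RingHom.injective (algebraMap E Qbar)) (x' j)
    obtain ⟨hA1, hA2⟩ := (exists_int_mult (x j)).choose_spec
    have h2 : IsIntegral ℤ (((exists_int_mult (x j)).choose : E) * x' j) := by
      have : Function.Injective (algebraMap E Qbar) := RingHom.injective _
      rw [← isIntegral_algebraMap_iff this]
      simpa using hA2
    have h3 := fun g => hB_le (x' j) _ hA1 h2 F g
    rw [← hm] at h3
    rw [hc, ← div_eq_inv_mul, div_le_iff₀ (by positivity)]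
    refine (Finset.sum_le_sum fun g _ => h3 g).trans ?_
    rw [Finset.sum_const, Finset.card_univ, nsmul_eq_mul]
    unfold hB intMult
    apply le_of_eq
    ring

end

section
open MvPolynomial

theorem mm_sum {E : Type} [Field E] {w : ℕ} (f : MvPolynomial (Fin w) ℤ) (ζ : Fin w → E) :
    aeval ζ f = ∑ a ∈ f.support, ((f.coeff a : ℤ) : E) * ∏ j, ζ j ^ a j := by
  rw [aeval_def, eval₂_eq']
  simp

theorem mm_prime {E : Type} [Field E] [NumberField E] {w : ℕ} (f : MvPolynomial (Fin w) ℤ)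
    (p : ℕ) [Fact p.Prime] (hp : ∑ a ∈ f.support, |f.coeff a| < p) (ζ : Fin w → E)
    (hζ : ∀ j, ∃ k, 1 ≤ k ∧ ζ j ^ k = 1) (h : aeval ζ f = 0) : aeval (ζ ^ p) f = 0 := by
  have hp0 : p.Prime := Fact.out
  have hd : C (p : ℤ) ∣ expand p f - f ^ p := by
    have := (C_dvd_iff_zmod p (expand p f - f ^ p)).2 (by rw [map_sub, map_pow, map_expand, expand_zmod, sub_self])
    exact this
  obtain ⟨q, hq⟩ := hd
  have h1 := congrArg (aeval ζ) hq
  rw [map_sub, map_pow, h, zero_pow hp0.ne_zero, sub_zero, aeval_expand, map_mul, aeval_C] at h1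
  have hζi : ∀ j, IsIntegral ℤ (ζ j) := by
    intro j
    obtain ⟨k, hk, hk1⟩ := hζ j
    exact IsIntegral.of_pow hk (by rw [hk1]; exact isIntegral_one)
  have hqi : IsIntegral ℤ (aeval ζ q) := by
    rw [mm_sum]
    refine IsIntegral.sum _ fun a _ => IsIntegral.mul ?_ (IsIntegral.prod _ fun j _ => (hζi j).pow _)
    exact isIntegral_algebraMap (A := E) (x := q.coeff a)
  have hnorm : ∀ φ : E →+* ℂ, ‖φ (aeval ζ q)‖ < 1 := by
    intro φ
    have hz : ∀ j, ‖φ (ζ j)‖ = 1 := by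
      intro j
      obtain ⟨k, hk, hk1⟩ := hζ j
      have : φ (ζ j) ^ k = 1 := by rw [← map_pow, hk1, map_one]
      exact Complex.norm_eq_one_of_pow_eq_one this (by omega)
    have h2 : ‖φ (aeval (ζ ^ p) f)‖ ≤ ∑ a ∈ f.support, ((|f.coeff a| : ℤ) : ℝ) := by
      rw [mm_sum, map_sum]
      refine (norm_sum_le _ _).trans (Finset.sum_le_sum fun a _ => ?_)
      rw [map_mul, norm_mul, map_intCast, Complex.norm_intCast, map_prod, norm_prod]
      simp [hz]
    rw [h1, map_mul, norm_mul] at h2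
    have h3 : ‖φ (algebraMap ℤ E (p : ℤ))‖ = p := by simp
    rw [h3] at h2
    have h4 : (∑ a ∈ f.support, ((|f.coeff a| : ℤ) : ℝ)) < p := by exact_mod_cast hp
    have h5 : (0:ℝ) < p := by exact_mod_cast hp0.pos
    by_contra hc
    push Not at hc
    nlinarith
  have hq0 : aeval ζ q = 0 := by
    by_contra hne
    obtain ⟨k, hk, hk1⟩ := NumberField.Embeddings.pow_eq_one_of_norm_le_one E ℂ hne hqi fun φ => (hnorm φ).le
    obtain ⟨φ⟩ : Nonempty (E →+* ℂ) := inferInstance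
    have := hnorm φ
    have h6 : φ (aeval ζ q) ^ k = 1 := by rw [← map_pow, hk1, map_one]
    have := Complex.norm_eq_one_of_pow_eq_one h6 hk.ne'
    linarith
  rw [h1, hq0, mul_zero]

theorem mm_mul {E : Type} [Field E] [NumberField E] {w : ℕ} (f : MvPolynomial (Fin w) ℤ)
    (m : ℕ) : m ≠ 0 → (∀ p : ℕ, p.Prime → p ∣ m → ∑ a ∈ f.support, |f.coeff a| < p) → ∀ (ζ : Fin w → E)
    (_ : ∀ j, ∃ k, 1 ≤ k ∧ ζ j ^ k = 1) (_ : aeval ζ f = 0), aeval (ζ ^ m) f = 0 := by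
  induction m using Nat.recOnMul with
  | zero => intro h; exact absurd rfl h
  | one => intro _ _ ζ _ h; rwa [pow_one]
  | prime p hp =>
    intro _ h ζ hζ hf
    have : Fact p.Prime := ⟨hp⟩
    exact mm_prime f p (h p hp dvd_rfl) ζ hζ hf
  | mul a b iha ihb =>
    intro h0 h ζ hζ hf
    rw [pow_mul]
    refine ihb (right_ne_zero_of_mul h0) (fun p hp hd => h p hp (hd.mul_left _)) _ ?_ ?_
    · intro j
      obtain ⟨k, hk, hk1⟩ := hζ j
      exact ⟨k, hk, by rw [Pi.pow_apply, ← pow_mul, mul_comm, pow_mul, hk1, one_pow]⟩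
    · exact iha (left_ne_zero_of_mul h0) (fun p hp hd => h p hp (hd.mul_right _)) _ hζ hf

theorem mm_field {E : Type} [Field E] [NumberField E] {w : ℕ} (f : MvPolynomial (Fin w) ℤ) (hf0 : f ≠ 0)
    (ζ : Fin w → E) (hζ : ∀ j, ∃ k, 1 ≤ k ∧ ζ j ^ k = 1) (h : aeval ζ f = 0) :
    ∃ a ∈ f.support, ∃ a' ∈ f.support, a ≠ a' ∧
      (∏ j, ζ j ^ a j) ^ (∑ a ∈ f.support, |f.coeff a|).toNat.factorial =
      (∏ j, ζ j ^ a' j) ^ (∑ a ∈ f.support, |f.coeff a|).toNat.factorial := by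
  classical
  set B := ∑ a ∈ f.support, |f.coeff a| with hB
  set M := B.toNat.factorial with hM
  have hB0 : 0 ≤ B := Finset.sum_nonneg fun a _ => abs_nonneg _
  by_contra hcon
  push Not at hcon
  have h1 : ∀ t : ℕ, aeval (ζ ^ (1 + M * t)) f = 0 := by
    intro t
    refine mm_mul f _ (by omega) ?_ ζ hζ h
    intro p hp hd
    by_contra hle
    push Not at hle
    have : p ∣ M := hp.dvd_factorial.2 (by omega)
    have h2 := (Nat.dvd_add_left (this.mul_right t)).1 hd
    exact hp.one_lt.ne' (Nat.dvd_one.1 h2)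
  let e := f.support.equivFin
  have hv := Matrix.eq_zero_of_forall_pow_sum_mul_pow_eq_zero (R := E) (n := f.support.card)
    (f := fun i => (∏ j, ζ j ^ ((e.symm i : Fin w →₀ ℕ) j)) ^ M)
    (v := fun i => ((f.coeff (e.symm i : Fin w →₀ ℕ) : ℤ) : E) * ∏ j, ζ j ^ ((e.symm i : Fin w →₀ ℕ) j))
    (by
      intro i i' hii
      by_contra hne
      exact hcon _ (e.symm i).2 _ (e.symm i').2 (fun hh => hne (e.symm.injective (Subtype.ext hh))) hii)
    (by
      intro i
      have h2 := h1 i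
      rw [mm_sum, ← Finset.sum_coe_sort, ← e.symm.sum_comp] at h2
      rw [← h2]
      refine Finset.sum_congr rfl fun a _ => ?_
      rw [mul_assoc, ← Finset.prod_pow, ← Finset.prod_pow, ← Finset.prod_mul_distrib]
      congr 1
      refine Finset.prod_congr rfl fun j _ => ?_
      rw [Pi.pow_apply, ← pow_mul, ← pow_mul, ← pow_mul, ← pow_add]
      congr 1
      ring)
  obtain ⟨a, ha⟩ : f.support.Nonempty := support_nonempty.2 hf0
  have h3 := congrFun hv (e ⟨a, ha⟩)
  simp only [Equiv.symm_apply_apply, Pi.zero_apply, mul_eq_zero] at h3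
  rcases h3 with h3 | h3
  · exact (mem_support_iff.1 ha) (by exact_mod_cast h3)
  · rw [Finset.prod_eq_zero_iff] at h3
    obtain ⟨j, _, hj⟩ := h3
    obtain ⟨k, hk, hk1⟩ := hζ j
    have h4 : ζ j = 0 := eq_zero_of_pow_eq_zero hj
    rw [h4, zero_pow (by omega)] at hk1
    exact zero_ne_one hk1

theorem mm_qbar {w : ℕ} (f : MvPolynomial (Fin w) ℤ) (hf0 : f ≠ 0)
    (ζ : Fin w → Qbar) (hζ : ∀ j, IsRootOfUnity (ζ j)) (h : ∑ a ∈ f.support, ((f.coeff a : ℤ) : Qbar) * ∏ j, ζ j ^ a j = 0) :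
    ∃ a ∈ f.support, ∃ a' ∈ f.support, a ≠ a' ∧
      (∏ j, ζ j ^ a j) ^ (∑ a ∈ f.support, |f.coeff a|).toNat.factorial =
      (∏ j, ζ j ^ a' j) ^ (∑ a ∈ f.support, |f.coeff a|).toNat.factorial := by
  set E0 := FiniteGaloisIntermediateField.adjoin ℚ (Set.range ζ) with hE0
  let E : IntermediateField ℚ Qbar := E0.toIntermediateField
  have hmem : ∀ j, ζ j ∈ E := fun j => FiniteGaloisIntermediateField.subset_adjoin ℚ (Set.range ζ) ⟨j, rfl⟩
  have : FiniteDimensional ℚ E := E0.finiteDimensional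
  have : NumberField E := { }
  have hinj : Function.Injective (algebraMap E Qbar) := RingHom.injective _
  let ζ' : Fin w → E := fun j => ⟨ζ j, hmem j⟩
  obtain ⟨a, ha, a', ha', hne, heq⟩ := mm_field f hf0 ζ' (by
    intro j
    obtain ⟨k, hk, hk1⟩ := hζ j
    exact ⟨k, hk, Subtype.ext hk1⟩) (by
    apply hinj
    rw [map_zero, ← h, mm_sum, map_sum]
    refine Finset.sum_congr rfl fun a _ => ?_
    rw [map_mul, map_prod, map_intCast]
    rfl)
  refine ⟨a, ha, a', ha', hne, ?_⟩
  have h2 := congrArg (algebraMap E Qbar) heq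
  rw [map_pow, map_pow, map_prod, map_prod] at h2
  exact h2

end

section
open MvPolynomial

theorem mm_ult {n : ℕ} (U : Ultrafilter ℕ) (P : ℕ → TorusPt n) {w : ℕ} (b : Fin w → Fin n → ℤ)
    (hb : ∀ j, ∀ᶠ k in (U : Filter ℕ), IsRootOfUnity (mon (b j) (emb (P k))))
    (hind : ∀ c : Fin w → ℤ, (∀ᶠ k in (U : Filter ℕ), mon (∑ j, c j • b j) (emb (P k)) = 1) → c = 0) :
    AlgebraicIndependent Qbar (fun j => mon (b j) (fun i => Ult.mk U (fun k => emb (P k) i))) := by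
  have halg : Algebra.IsAlgebraic ℤ Qbar := by
    refine ⟨fun α => ?_⟩
    obtain ⟨A, hA, h2⟩ := exists_int_mult α
    exact (IsFractionRing.isAlgebraic_iff ℤ ℚ Qbar).2 (qbar_alg.isAlgebraic α)
  have : IsScalarTower ℤ Qbar (Ult U Qbar) := IsScalarTower.of_algebraMap_eq fun z => by simp
  suffices h : AlgebraicIndependent ℤ (fun j => mon (b j) (fun i => Ult.mk U (fun k => emb (P k) i))) from
    h.extendScalars Qbar
  rw [algebraicIndependent_iff]
  intro f hf
  by_contra hf0
  have h1 : (Ult.mk U fun k => ∑ a ∈ f.support, ((f.coeff a : ℤ) : Qbar) * ∏ j, mon (b j) (emb (P k)) ^ a j) = 0 := by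
    rw [← hf, mm_sum]
    have : (fun k => ∑ a ∈ f.support, ((f.coeff a : ℤ) : Qbar) * ∏ j, mon (b j) (emb (P k)) ^ a j) =
        ∑ a ∈ f.support, ((f.coeff a : ℤ) : ℕ → Qbar) * ∏ j, (fun k => mon (b j) (emb (P k))) ^ a j := by
      funext k
      simp
    rw [this, map_sum]
    refine Finset.sum_congr rfl fun a _ => ?_
    rw [map_mul, map_prod, map_intCast]
    congr 1
    refine Finset.prod_congr rfl fun j _ => ?_
    rw [map_pow, ← Ult.mk_mon]
  rw [Ult.mk_eq_zero] at h1
  set M := (∑ a ∈ f.support, |f.coeff a|).toNat.factorial with hM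
  have h2 : ∀ᶠ k in (U : Filter ℕ), ∃ q ∈ ((f.support ×ˢ f.support : Finset _) : Set ((Fin w →₀ ℕ) × (Fin w →₀ ℕ))),
      q.1 ≠ q.2 ∧ (∏ j, mon (b j) (emb (P k)) ^ q.1 j) ^ M = (∏ j, mon (b j) (emb (P k)) ^ q.2 j) ^ M := by
    filter_upwards [h1, Filter.eventually_all.2 hb] with k hk hk2
    obtain ⟨a, ha, a', ha', hne, h⟩ := mm_qbar f hf0 (fun j => mon (b j) (emb (P k))) hk2 hk
    exact ⟨(a, a'), by simpa using ⟨mem_support_iff.1 ha, mem_support_iff.1 ha'⟩, hne, h⟩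
  rw [Ultrafilter.eventually_exists_mem_iff (Finset.finite_toSet _)] at h2
  obtain ⟨⟨a, a'⟩, _, h3⟩ := h2
  have hne : a ≠ a' := by
    obtain ⟨k, hk⟩ := h3.exists
    exact hk.1
  have h4 := hind (fun j => (M : ℤ) * ((a j : ℤ) - a' j)) (by
    filter_upwards [h3] with k hk
    rw [mon_sum (emb_ne _)]
    have h5 : ∀ j, mon (b j) (emb (P k)) ^ ((M : ℤ) * ((a j : ℤ) - a' j)) =
      (mon (b j) (emb (P k)) ^ a j) ^ M / (mon (b j) (emb (P k)) ^ a' j) ^ M := by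
      intro j
      have hm := mon_ne_zero (emb_ne (P k)) (b j)
      rw [mul_comm, zpow_mul, zpow_sub₀ hm]
      simp [div_pow]
    rw [Finset.prod_congr rfl fun j _ => h5 j, Finset.prod_div_distrib, Finset.prod_pow, Finset.prod_pow, hk.2]
    refine div_self (pow_ne_zero _ (Finset.prod_ne_zero_iff.2 fun j _ => pow_ne_zero _ (mon_ne_zero (emb_ne _) _))))
  apply hne
  ext j
  have := congrFun h4 j
  simp only [Pi.zero_apply, mul_eq_zero] at this
  rcases this with h | h
  · exact absurd (by exact_mod_cast h) (Nat.factorial_ne_zero _)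
  · omega

end

section
open MvPolynomial

/-- real vector attached to an integer vector -/
def cr {n : ℕ} (a : Fin n → ℤ) : EuclideanSpace ℝ (Fin n) := WithLp.toLp 2 fun i => (a i : ℝ)

theorem cr_apply {n : ℕ} (a : Fin n → ℤ) (i : Fin n) : cr a i = (a i : ℝ) := rfl

theorem cq_add {n : ℕ} (a b : Fin n → ℤ) : cq (a + b) = cq a + cq b := by ext i; simp [cq]
theorem cq_smul {n : ℕ} (m : ℤ) (a : Fin n → ℤ) : cq (m • a) = (m : ℚ) • cq a := by ext i; simp [cq]
theorem cq_sum {n : ℕ} {ι : Type} (s : Finset ι) (c : ι → ℤ) (b : ι → Fin n → ℤ) :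
    cq (∑ j ∈ s, c j • b j) = ∑ j ∈ s, (c j : ℚ) • cq (b j) := by
  ext i; simp [cq, Finset.sum_apply]
theorem cr_add {n : ℕ} (a b : Fin n → ℤ) : cr (a + b) = cr a + cr b := by ext i; simp [cr]
theorem cr_smul {n : ℕ} (m : ℤ) (a : Fin n → ℤ) : cr (m • a) = (m : ℝ) • cr a := by ext i; simp [cr]
theorem cr_sum {n : ℕ} {ι : Type} (s : Finset ι) (c : ι → ℤ) (b : ι → Fin n → ℤ) :
    cr (∑ j ∈ s, c j • b j) = ∑ j ∈ s, (c j : ℝ) • cr (b j) := by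
  ext i; simp [cr, Finset.sum_apply]

theorem cq_inj {n : ℕ} : Function.Injective (cq (n := n)) := by
  intro a b h
  ext i
  have : (a i : ℚ) = b i := congrFun h i
  exact_mod_cast this

theorem cr_indep {n r : ℕ} (b : Fin r → Fin n → ℤ) (h : LinearIndependent ℚ fun j => cq (b j)) :
    LinearIndependent ℝ fun j => cr (b j) := by
  classical
  obtain ⟨g, hg⟩ := LinearMap.exists_leftInverse_of_injective (Fintype.linearCombination ℚ fun j => cq (b j))
    (LinearMap.ker_eq_bot.2 (LinearIndependent.fintypeLinearCombination_injective h))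
  have h1 : ∀ i j, ∑ l, (g (Pi.single l 1) i) * (b j l : ℚ) = if j = i then 1 else 0 := by
    intro i j
    have h2 := congrArg (fun f => f (Pi.single j (1:ℚ)) i) hg
    simp only [LinearMap.comp_apply, LinearMap.id_apply, Fintype.linearCombination_apply_single, one_smul] at h2
    rw [Pi.single_apply] at h2
    rw [show (if j = i then (1:ℚ) else 0) = if i = j then 1 else 0 by simp [eq_comm], ← h2]
    conv_rhs => rw [pi_eq_sum_univ' (cq (b j))]
    rw [map_sum, Finset.sum_apply]
    refine Finset.sum_congr rfl fun l _ => ?_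
    rw [map_smul, Pi.smul_apply, smul_eq_mul, mul_comm]
    rfl
  rw [Fintype.linearIndependent_iff]
  intro c hc i
  have h3 : ∀ l, ∑ j, c j * (b j l : ℝ) = 0 := by
    intro l
    have := congrArg (fun v : EuclideanSpace ℝ (Fin n) => v l) hc
    simpa [cr] using this
  have h4 : ∑ l, ((g (Pi.single l 1) i : ℚ) : ℝ) * ∑ j, c j * (b j l : ℝ) = 0 := by simp [h3]
  simp only [Finset.mul_sum] at h4
  rw [Finset.sum_comm] at h4
  have h5 : ∀ j, ∑ l, ((g (Pi.single l 1) i : ℚ) : ℝ) * (c j * (b j l : ℝ)) = c j * if j = i then 1 else 0 := by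
    intro j
    have := congrArg (fun q : ℚ => (q : ℝ)) (h1 i j)
    push_cast at this
    have h6 : (((if j = i then (1:ℚ) else 0 : ℚ)) : ℝ) = if j = i then 1 else 0 := by split_ifs <;> simp
    rw [← h6, ← this, Finset.mul_sum]
    exact Finset.sum_congr rfl fun l _ => by ring
  rw [Finset.sum_congr rfl fun j _ => h5 j] at h4
  simpa using h4

theorem lat_ext {n : ℕ} (S0 S : Set (Fin n → ℤ)) (hS : S0 ⊆ S) :
    ∃ (ρ w : ℕ) (a : Fin ρ → Fin n → ℤ) (b : Fin w → Fin n → ℤ), (∀ i, a i ∈ S0) ∧ (∀ i, b i ∈ S) ∧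
      LinearIndependent ℚ (Sum.elim (fun i => cq (a i)) (fun i => cq (b i))) ∧
      (∀ x ∈ S0, cq x ∈ Submodule.span ℚ (Set.range fun i => cq (a i))) ∧
      (∀ x ∈ S, cq x ∈ Submodule.span ℚ (Set.range (Sum.elim (fun i => cq (a i)) (fun i => cq (b i))))) := by
  classical
  obtain ⟨s, hs1, hs2, hs3⟩ := exists_linearIndependent ℚ (cq '' S0)
  have hs3' : LinearIndepOn ℚ id s := hs3
  obtain ⟨t, ht1, ht2, ht3, ht4⟩ := exists_linearIndepOn_id_extension hs3' (hs1.trans (Set.image_mono hS))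
  have htf : t.Finite := ht4.linearIndependent.setFinite
  have hsf : s.Finite := htf.subset ht2
  have := hsf.fintype
  have := (htf.sdiff (t := s)).fintype
  let e1 := Fintype.equivFin s
  let e2 := Fintype.equivFin (t \ s : Set _)
  have ha : ∀ i, ∃ y ∈ S0, cq y = (e1.symm i : Fin n → ℚ) := fun i => hs1 (e1.symm i).2
  have hb : ∀ i, ∃ y ∈ S, cq y = (e2.symm i : Fin n → ℚ) := fun i => ht1 (e2.symm i).2.1
  choose a ha1 ha2 using ha
  choose b hb1 hb2 using hb
  have hra : Set.range (fun i => cq (a i)) = s := by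
    ext v
    constructor
    · rintro ⟨i, rfl⟩
      simp only [ha2]
      exact (e1.symm i).2
    · intro hv
      exact ⟨e1 ⟨v, hv⟩, by simp [ha2]⟩
  have hrb : Set.range (fun i => cq (b i)) = t \ s := by
    ext v
    constructor
    · rintro ⟨i, rfl⟩
      simp only [hb2]
      exact (e2.symm i).2
    · intro hv
      exact ⟨e2 ⟨v, hv⟩, by simp [hb2]⟩
  refine ⟨_, _, a, b, ha1, hb1, ?_, ?_, ?_⟩
  · have : LinearIndependent ℚ ((fun v : t => (v : Fin n → ℚ)) ∘ (fun x : Fin (Fintype.card s) ⊕ Fin (Fintype.card (t \ s : Set _)) =>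
        (Sum.elim (fun i => (⟨e1.symm i, ht2 (e1.symm i).2⟩ : t)) (fun i => ⟨e2.symm i, (e2.symm i).2.1⟩) x))) := by
      refine LinearIndependent.comp ht4 _ ?_
      rintro (i | i) (j | j) hij
      · simp only [Sum.elim_inl, Subtype.mk.injEq] at hij
        rw [e1.symm.injective (Subtype.ext hij)]
      · simp only [Sum.elim_inl, Sum.elim_inr, Subtype.mk.injEq] at hij
        exact absurd (hij ▸ (e1.symm i).2) (e2.symm j).2.2
      · simp only [Sum.elim_inl, Sum.elim_inr, Subtype.mk.injEq] at hij
        exact absurd (hij ▸ (e1.symm j).2) (e2.symm i).2.2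
      · simp only [Sum.elim_inr, Subtype.mk.injEq] at hij
        rw [e2.symm.injective (Subtype.ext hij)]
    convert this using 1
    ext x
    rcases x with i | i <;> simp [ha2, hb2]
  · intro x hx
    rw [hra, hs2]
    exact Submodule.subset_span ⟨x, hx, rfl⟩
  · intro x hx
    rw [Set.Sum.elim_range, hra, hrb, Set.union_sdiff_cancel ht2]
    exact ht3 ⟨x, hx, rfl⟩

theorem frame {n r : ℕ} (U : Ultrafilter ℕ) (S : ℕ → Set (Fin n → ℤ))
    (h : ∀ᶠ k in (U : Filter ℕ), ∃ b : Fin r → Fin n → ℤ, LinearIndependent ℚ (fun j => cq (b j)) ∧ ∀ j, b j ∈ S k) :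
    ∃ u : Fin r → EuclideanSpace ℝ (Fin n), Orthonormal ℝ u ∧ ∀ ε > 0, ∀ᶠ k in (U : Filter ℕ),
      ∃ u' : Fin r → EuclideanSpace ℝ (Fin n), ∀ i, u' i ∈ Submodule.span ℝ (cr '' S k) ∧ ‖u i - u' i‖ < ε := by
  classical
  have h1 : ∀ᶠ k in (U : Filter ℕ), ∃ u : Fin r → EuclideanSpace ℝ (Fin n), Orthonormal ℝ u ∧
      ∀ i, u i ∈ Submodule.span ℝ (cr '' S k) := by
    filter_upwards [h] with k ⟨b, hb, hbS⟩
    have hi := cr_indep b hb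
    refine ⟨InnerProductSpace.gramSchmidtNormed ℝ (fun j => cr (b j)), InnerProductSpace.gramSchmidtNormed_orthonormal hi, fun i => ?_⟩
    have : InnerProductSpace.gramSchmidtNormed ℝ (fun j => cr (b j)) i ∈ Submodule.span ℝ (Set.range (InnerProductSpace.gramSchmidtNormed ℝ (fun j => cr (b j)))) :=
      Submodule.subset_span ⟨i, rfl⟩
    rw [InnerProductSpace.span_gramSchmidtNormed_range, InnerProductSpace.span_gramSchmidt] at this
    refine Submodule.span_mono ?_ this
    rintro _ ⟨j, rfl⟩
    exact ⟨b j, hbS j, rfl⟩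
  have h2 : ∃ f : ℕ → Fin r → EuclideanSpace ℝ (Fin n), ∀ᶠ k in (U : Filter ℕ), Orthonormal ℝ (f k) ∧
      ∀ i, f k i ∈ Submodule.span ℝ (cr '' S k) := by
    refine ⟨fun k => if h : ∃ u : Fin r → EuclideanSpace ℝ (Fin n), Orthonormal ℝ u ∧
      ∀ i, u i ∈ Submodule.span ℝ (cr '' S k) then h.choose else 0, ?_⟩
    filter_upwards [h1] with k hk
    rw [dif_pos hk]
    exact hk.choose_spec
  obtain ⟨f, hf⟩ := h2
  have hK : IsCompact (Set.pi Set.univ fun _ : Fin r => Metric.closedBall (0 : EuclideanSpace ℝ (Fin n)) 1) :=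
    isCompact_univ_pi fun _ => isCompact_closedBall _ _
  obtain ⟨u, _, hu⟩ := hK.ultrafilter_le_nhds (U.map f) (by
    rw [Filter.le_principal_iff]
    refine Filter.mem_map.2 ?_
    filter_upwards [hf] with k hk
    intro i _
    simp [(hk.1.1 i).le])
  have hu' : Filter.Tendsto f U (nhds u) := hu
  have hui : ∀ i, Filter.Tendsto (fun k => f k i) U (nhds (u i)) := fun i => (tendsto_pi_nhds.1 hu') i
  refine ⟨u, ?_, ?_⟩
  · rw [orthonormal_iff_ite]
    intro i j
    have ht := (hui i).inner (𝕜 := ℝ) (hui j)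
    refine tendsto_nhds_unique ht (tendsto_const_nhds.congr' ?_)
    filter_upwards [hf] with k hk
    exact ((orthonormal_iff_ite.1 hk.1) i j).symm
  · intro ε hε
    have h3 : ∀ i, ∀ᶠ k in (U : Filter ℕ), ‖u i - f k i‖ < ε := by
      intro i
      have := Metric.tendsto_nhds.1 (hui i) ε hε
      filter_upwards [this] with k hk
      rwa [dist_comm, dist_eq_norm] at hk
    filter_upwards [hf, Filter.eventually_all.2 h3] with k hk hk3
    exact ⟨f k, fun i => ⟨hk.2 i, hk3 i⟩⟩

theorem dirichlet {n : ℕ} (u : EuclideanSpace ℝ (Fin n)) (ε : ℝ) (hε : 0 < ε) :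
    ∃ q : ℕ, 1 ≤ q ∧ ∃ a : Fin n → ℤ, ∀ l, |q * u l - a l| < ε := by
  have hK : IsCompact (Set.Icc (0 : Fin n → ℝ) 1) := isCompact_Icc
  obtain ⟨y, _, φ, hφ, hy⟩ := hK.tendsto_subseq (x := fun m : ℕ => fun l => Int.fract ((m : ℝ) * u l))
    (fun m => ⟨fun l => Int.fract_nonneg _, fun l => (Int.fract_lt_one _).le⟩)
  have hc := hy.cauchySeq
  rw [Metric.cauchySeq_iff] at hc
  obtain ⟨N, hN⟩ := hc ε hε
  have h1 := hN (N + 1) (by omega) N le_rfl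
  have hlt : φ N < φ (N + 1) := hφ (by omega)
  refine ⟨φ (N + 1) - φ N, by omega, fun l => ⌊(φ (N + 1) : ℝ) * u l⌋ - ⌊(φ N : ℝ) * u l⌋, fun l => ?_⟩
  have h2 := (dist_pi_lt_iff hε).1 h1 l
  rw [Real.dist_eq] at h2
  simp only [Function.comp] at h2
  unfold Int.fract at h2
  rw [Nat.cast_sub hlt.le]
  push_cast
  convert h2 using 2
  ring

end

section
open MvPolynomial

/-- a seminorm controlling heights of monomials at P -/
def HtSys {n : ℕ} (P : TorusPt n) (B : ℝ) (N : Seminorm ℝ (EuclideanSpace ℝ (Fin n))) : Prop :=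
  (∀ a, weilHeight (mon a (emb P)) ≤ N (cr a)) ∧ (∀ a, IsRootOfUnity (mon a (emb P)) → N (cr a) = 0) ∧
    ∀ l, N (EuclideanSpace.single l 1) ≤ B

theorem HtSys.le {n : ℕ} {P : TorusPt n} {B : ℝ} {N : Seminorm ℝ (EuclideanSpace ℝ (Fin n))} (h : HtSys P B N)
    (v : EuclideanSpace ℝ (Fin n)) (ε : ℝ) (hv : ∀ l, |v l| ≤ ε) : N v ≤ n * (ε * |B|) := by
  have h1 : v = ∑ l, v l • EuclideanSpace.single l (1:ℝ) := by
    ext i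
    simp [Finset.sum_apply, Pi.single_apply]
  calc N v = N (∑ l, v l • EuclideanSpace.single l (1:ℝ)) := by rw [← h1]
    _ ≤ ∑ l, N (v l • EuclideanSpace.single l (1:ℝ)) := by
        have := Finset.le_sum_of_subadditive (f := N) (map_zero N).le (fun x y => map_add_le_add N x y) Finset.univ
          (fun l => v l • EuclideanSpace.single l (1:ℝ))
        exact this
    _ ≤ ∑ l : Fin n, ε * |B| := by
        refine Finset.sum_le_sum fun l _ => ?_
        rw [map_smul_eq_mul, Real.norm_eq_abs]
        exact mul_le_mul (hv l) ((h.2.2 l).trans (le_abs_self _)) (apply_nonneg _ _) ((abs_nonneg _).trans (hv l))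
    _ = _ := by simp

theorem HtSys.span {n : ℕ} {P : TorusPt n} {B : ℝ} {N : Seminorm ℝ (EuclideanSpace ℝ (Fin n))} (h : HtSys P B N)
    (S : Set (Fin n → ℤ)) (hS : ∀ a ∈ S, IsRootOfUnity (mon a (emb P))) (v : EuclideanSpace ℝ (Fin n))
    (hv : v ∈ Submodule.span ℝ (cr '' S)) : N v = 0 := by
  induction hv using Submodule.span_induction with
  | mem x hx =>
    obtain ⟨a, ha, rfl⟩ := hx
    exact h.2.1 a (hS a ha)
  | zero => exact map_zero N
  | add x y _ _ hx hy =>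
    refine le_antisymm ((map_add_le_add N x y).trans (by rw [hx, hy, add_zero])) (apply_nonneg _ _)
  | smul c x _ hx => rw [map_smul_eq_mul, hx, mul_zero]

/-- the asymptotic kernel -/
def asK {n : ℕ} (U : Ultrafilter ℕ) (N : ℕ → Seminorm ℝ (EuclideanSpace ℝ (Fin n))) :
    Submodule ℝ (EuclideanSpace ℝ (Fin n)) where
  carrier := {v | ∀ ε > 0, ∀ᶠ k in (U : Filter ℕ), N k v < ε}
  zero_mem' := by
    intro ε hε
    simp [hε]
  add_mem' := by
    intro x y hx hy ε hε
    filter_upwards [hx (ε / 2) (by positivity), hy (ε / 2) (by positivity)] with k h1 h2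
    have := map_add_le_add (N k) x y
    linarith
  smul_mem' := by
    intro c x hx ε hε
    filter_upwards [hx (ε / (‖c‖ + 1)) (by positivity)] with k h1
    rw [map_smul_eq_mul]
    rw [lt_div_iff₀ (by positivity)] at h1
    have := apply_nonneg (N k) x
    nlinarith

theorem frame_asK {n r : ℕ} (U : Ultrafilter ℕ) (P : ℕ → TorusPt n) (N : ℕ → Seminorm ℝ (EuclideanSpace ℝ (Fin n)))
    (B : ℝ) (hN : ∀ᶠ k in (U : Filter ℕ), HtSys (P k) B (N k))
    (h : ∀ᶠ k in (U : Filter ℕ), ∃ b : Fin r → Fin n → ℤ, LinearIndependent ℚ (fun j => cq (b j)) ∧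
      ∀ j, IsRootOfUnity (mon (b j) (emb (P k)))) : r ≤ Module.finrank ℝ (asK U N) := by
  obtain ⟨u, hu, hu2⟩ := frame U (fun k => {a | IsRootOfUnity (mon a (emb (P k)))}) h
  have hmem : ∀ i, u i ∈ asK U N := by
    intro i ε hε
    have h1 : 0 < ε / (n * |B| + 1) := by positivity
    filter_upwards [hu2 _ h1, hN] with k ⟨u', hu'⟩ hk
    have h2 := hk.span _ (fun a ha => ha) _ (hu' i).1
    have h3 := hk.le (u i - u' i) (ε / (n * |B| + 1)) (fun l => (PiLp.norm_apply_le _ l).trans (hu' i).2.le)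
    have h4 := map_add_le_add (N k) (u i - u' i) (u' i)
    rw [sub_add_cancel, h2] at h4
    have h5 : n * (ε / (n * |B| + 1) * |B|) < ε := by
      rw [div_mul_eq_mul_div, mul_div_assoc', div_lt_iff₀ (by positivity)]
      nlinarith
    linarith
  have hli : LinearIndependent ℝ (fun i => (⟨u i, hmem i⟩ : asK U N)) := by
    apply LinearIndependent.of_comp (asK U N).subtype
    exact hu.linearIndependent
  simpa using hli.fintype_card_le_finrank

theorem asK_span {n : ℕ} (U : Ultrafilter ℕ) (P : ℕ → TorusPt n) (N : ℕ → Seminorm ℝ (EuclideanSpace ℝ (Fin n)))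
    (B : ℝ) (hN : ∀ᶠ k in (U : Filter ℕ), HtSys (P k) B (N k)) (L : IntermediateField ℚ Qbar) (hL : HasBogomolov L)
    (hPL : ∀ k i, emb (P k) i ∈ L) :
    asK U N ≤ Submodule.span ℝ (cr '' {a | ∀ᶠ k in (U : Filter ℕ), IsRootOfUnity (mon a (emb (P k)))}) := by
  obtain ⟨C, hC, hCL⟩ := hL
  intro v hv
  set S := Submodule.span ℝ (cr '' {a | ∀ᶠ k in (U : Filter ℕ), IsRootOfUnity (mon a (emb (P k)))}) with hS
  have hcl : IsClosed (S : Set (EuclideanSpace ℝ (Fin n))) := Submodule.closed_of_finiteDimensional S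
  change v ∈ (S : Set (EuclideanSpace ℝ (Fin n)))
  rw [← hcl.closure_eq, Metric.mem_closure_iff]
  intro δ hδ
  set ε := min (δ / (n + 1)) (C / (2 * (n * |B| + 1))) with hε
  have hε0 : 0 < ε := lt_min (by positivity) (by positivity)
  obtain ⟨q, hq, a, ha⟩ := dirichlet v ε hε0
  have haS : cr a ∈ S := by
    apply Submodule.subset_span
    refine ⟨a, ?_, rfl⟩
    filter_upwards [hN, hv (C / (2 * q)) (by positivity)] with k hk hk2
    by_contra hroot
    have h1 := hCL (mon a (emb (P k))) (by
      unfold mon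
      exact prod_mem fun i _ => zpow_mem (hPL k i) _) (mon_ne_zero (emb_ne _) _) hroot
    have h2 := hk.1 a
    have h3 := hk.le (cr a - (q:ℝ) • v) ε (fun l => by
      have := (ha l).le
      rw [abs_sub_comm] at this
      simpa [cr] using this)
    have h4 := map_add_le_add (N k) (cr a - (q:ℝ) • v) ((q:ℝ) • v)
    rw [sub_add_cancel, map_smul_eq_mul, Real.norm_natCast] at h4
    have hq0 : (0:ℝ) < q := by exact_mod_cast hq
    rw [lt_div_iff₀ (by positivity)] at hk2
    have h5 : n * (ε * |B|) < C / 2 := by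
      have h6 : ε ≤ C / (2 * (n * |B| + 1)) := min_le_right _ _
      rw [le_div_iff₀ (by positivity)] at h6
      nlinarith
    linarith
  refine ⟨(q:ℝ)⁻¹ • cr a, S.smul_mem _ haS, ?_⟩
  have hq0 : (1:ℝ) ≤ q := by exact_mod_cast hq
  have h7 : ‖(q:ℝ) • v - cr a‖ < δ := by
    have h8 : ‖(q:ℝ) • v - cr a‖ ≤ ∑ l, |(q:ℝ) * v l - a l| := by
      rw [EuclideanSpace.norm_eq]
      apply Real.sqrt_le_iff.2 ⟨Finset.sum_nonneg fun _ _ => abs_nonneg _, ?_⟩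
      have := Finset.sum_sq_le_sq_sum_of_nonneg (s := Finset.univ) (f := fun l => |(q:ℝ) * v l - a l|) (fun _ _ => abs_nonneg _)
      refine le_trans (le_of_eq ?_) this
      refine Finset.sum_congr rfl fun l _ => ?_
      simp [cr]
    have h9 : ∑ l, |(q:ℝ) * v l - a l| ≤ n * ε := by
      have := Finset.sum_le_sum fun l (_ : l ∈ Finset.univ) => (ha l).le
      simpa using this
    have h10 : ε ≤ δ / (n + 1) := min_le_left _ _
    rw [le_div_iff₀ (by positivity)] at h10
    nlinarith
  rw [dist_eq_norm]
  have h11 : v - (q:ℝ)⁻¹ • cr a = (q:ℝ)⁻¹ • ((q:ℝ) • v - cr a) := by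
    rw [smul_sub, smul_smul, inv_mul_cancel₀ (by positivity), one_smul]
  rw [h11, norm_smul, norm_inv, Real.norm_natCast]
  refine lt_of_le_of_lt (mul_le_of_le_one_left (norm_nonneg _) (inv_le_one_of_one_le₀ hq0)) h7

end

section
open MvPolynomial

theorem isRootOfUnity_of_one {α : Qbar} (h : α = 1) : IsRootOfUnity α := ⟨1, le_rfl, by simp [h]⟩

theorem cr_mem_of_cq {n : ℕ} {ι : Type} [Fintype ι] (v : ι → Fin n → ℤ) (w : Fin n → ℤ)
    (h : cq w ∈ Submodule.span ℚ (Set.range fun i => cq (v i))) :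
    cr w ∈ Submodule.span ℝ (Set.range fun i => cr (v i)) := by
  obtain ⟨D, c, hD, h2⟩ := cq_span v w h
  have h3 : (D:ℝ) • cr w = ∑ i, (c i : ℝ) • cr (v i) := by rw [← cr_smul, h2, cr_sum]
  have hD' : (D:ℝ) ≠ 0 := by exact_mod_cast hD
  have h4 : cr w = (D:ℝ)⁻¹ • ∑ i, (c i : ℝ) • cr (v i) := by
    rw [← h3, smul_smul, inv_mul_cancel₀ hD', one_smul]
  rw [h4]
  exact Submodule.smul_mem _ _ (Submodule.sum_mem _ fun i _ => Submodule.smul_mem _ _ (Submodule.subset_span ⟨i, rfl⟩))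

theorem case1 {n s : ℕ} (U : Ultrafilter ℕ) {X : Set (TorusPt n)} (hX : ZClosed X) (P : ℕ → TorusPt n)
    (hP : ∀ k, P k ∈ X) (L : IntermediateField ℚ Qbar) (hL : HasBogomolov L)
    (hPL : ∀ k i, emb (P k) i ∈ L) (H : ℕ → Set (TorusPt n)) (hH : ∀ k, IsAlgSubgroup (H k))
    (hHc : ∀ k, ZConnected (H k)) (hHs : ∀ k, s + zdim (H k) ≤ n) (hPH : ∀ k, P k ∈ H k)
    {d : ℕ} (hd : 1 ≤ d) (e : Fin d → Fin n) (xs : Fin n → Ult U Qbar)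
    (hxs : xs = fun i => Ult.mk U (fun k => emb (P k) i))
    (he : AlgebraicIndependent Qbar (fun i => xs (e i)))
    (hmax : ∀ i, IsAlgebraic (IntermediateField.adjoin Qbar (Set.range fun i => xs (e i))) (xs i))
    (N : ℕ → Seminorm ℝ (EuclideanSpace ℝ (Fin n))) (B : ℝ)
    (hN : ∀ᶠ k in (U : Filter ℕ), HtSys (P k) B (N k)) :
    ∃ k, ∃ Y, IsAnomalous X Y s ∧ P k ∈ Y := by
  classical
  have hmk : ∀ a, mon a xs = Ult.mk U (fun k => mon a (emb (P k))) := by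
    intro a; rw [hxs]; exact Ult.mk_mon _ _
  set S0 : Set (Fin n → ℤ) := {a | ∀ᶠ k in (U : Filter ℕ), mon a (emb (P k)) = 1} with hS0
  set S : Set (Fin n → ℤ) := {a | ∀ᶠ k in (U : Filter ℕ), IsRootOfUnity (mon a (emb (P k)))} with hS
  have hsub : S0 ⊆ S := fun a ha => Filter.Eventually.mono ha fun k hk => isRootOfUnity_of_one hk
  obtain ⟨ρ, w, a, b, ha, hb, hli, hsa, hsb⟩ := lat_ext S0 S hsub
  have hone : ∀ i, mon (a i) xs = 1 := by
    intro i
    rw [hmk, ← map_one (Ult.mk U), Ult.mk_eq]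
    exact ha i
  -- conclusion from s < d + ρ
  have concl : s < d + ρ → ∃ k, ∃ Y, IsAnomalous X Y s ∧ P k ∈ Y := by
    intro h
    refine anomaly U hX P hP xs hxs e he a (hli.comp Sum.inl Sum.inl_injective) (w := 0) Fin.elim0 ?_ (by omega) (by omega)
    intro i
    rw [hone]
    exact isAlgebraic_one
  have hfr : Module.finrank ℝ (asK U N) ≤ ρ + w := by
    have h1 : asK U N ≤ Submodule.span ℝ (Set.range fun i => cr ((Sum.elim a b) i)) := by
      refine (asK_span U P N B hN L hL hPL).trans (Submodule.span_le.2 ?_)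
      rintro _ ⟨x, hx, rfl⟩
      apply cr_mem_of_cq
      have := hsb x hx
      convert this using 3
      funext i; rcases i with i | i <;> rfl
    refine (Submodule.finrank_mono h1).trans ((finrank_range_le_card _).trans (by simp))
  choose bH hbH1 hbH2 using fun k => LamH_rank (hH k) (hHs k)
  have hsf : s ≤ Module.finrank ℝ (asK U N) := by
    apply frame_asK U P N B hN
    refine Filter.Eventually.of_forall fun k => ⟨bH k, hbH1 k, fun j => isRootOfUnity_of_one (hbH2 k j _ (hPH k))⟩
  have hind : ∀ c : Fin w → ℤ, (∀ᶠ k in (U : Filter ℕ), mon (∑ j, c j • b j) (emb (P k)) = 1) → c = 0 := by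
    intro c hc
    have h1 := hsa _ hc
    obtain ⟨D, c', hD, h2⟩ := cq_span a _ h1
    have h3 : ∑ i, Sum.elim (fun i => (c' i : ℚ)) (fun j => -(D * c j : ℚ)) i •
        (Sum.elim (fun i => cq (a i)) (fun i => cq (b i))) i = 0 := by
      rw [Fintype.sum_sum_type]
      simp only [Sum.elim_inl, Sum.elim_inr]
      have h4 := congrArg cq h2
      rw [cq_smul, cq_sum, cq_sum] at h4
      rw [← h4, Finset.smul_sum, ← Finset.sum_add_distrib]
      apply Finset.sum_eq_zero
      intro j _
      rw [smul_smul, ← add_smul]; simp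
    have h5 := Fintype.linearIndependent_iff.1 hli _ h3
    funext j
    have h6 := h5 (Sum.inr j)
    simp only [Sum.elim_inr, neg_eq_zero, mul_eq_zero] at h6
    rcases h6 with h6 | h6
    · exact absurd (by exact_mod_cast h6) hD
    · exact_mod_cast h6
  by_cases hA : s + 1 ≤ Module.finrank ℝ (asK U N)
  · have hw : w ≤ d := by
      have h1 := mm_ult U P b hb hind
      rw [← hxs] at h1
      have h2 := algInd_card_le _ h1 (Set.range fun i => xs (e i)) (by
        intro j
        have : mon (b j) xs ∈ algebraicClosure (IntermediateField.adjoin Qbar (Set.range fun i => xs (e i))) (Ult U Qbar) := by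
          unfold mon
          exact prod_mem fun i _ => zpow_mem ((mem_algebraicClosure_iff).2 (hmax i)) _
        exact (mem_algebraicClosure_iff).1 this)
      have h3 : (Set.range fun i => xs (e i)).encard ≤ d := by
        rw [← Set.image_univ]
        refine (Set.encard_image_le _ _).trans ?_
        simp
      have h4 := h2.trans h3
      simpa using h4
    exact concl (by omega)
  · have hnot : ¬ ∀ᶠ k in (U : Filter ℕ), ∃ b : Fin (s+1) → Fin n → ℤ, LinearIndependent ℚ (fun j => cq (b j)) ∧
      ∀ j, IsRootOfUnity (mon (b j) (emb (P k))) := fun h => hA (frame_asK U P N B hN h)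
    rw [← Ultrafilter.eventually_not] at hnot
    have hSS : S ⊆ S0 := by
      intro x hx
      show ∀ᶠ k in (U : Filter ℕ), mon x (emb (P k)) = 1
      filter_upwards [hnot, hx] with k hk hxk
      have h1 : cq x ∈ Submodule.span ℚ (Set.range fun j => cq (bH k j)) := by
        by_contra hcon
        apply hk
        refine ⟨Fin.cons x (bH k), ?_, ?_⟩
        · have := (linearIndependent_finCons (K := ℚ) (x := cq x) (v := fun j => cq (bH k j))).2 ⟨hbH1 k, hcon⟩
          have hfe : (fun j => cq ((Fin.cons x (bH k) : Fin (s+1) → Fin n → ℤ) j)) =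
              Fin.cons (cq x) fun j => cq (bH k j) := by
            funext j
            refine Fin.cases ?_ (fun j => ?_) j <;> simp
          rw [hfe]
          exact this
        · intro j
          refine Fin.cases ?_ (fun j => ?_) j
          · simpa using hxk
          · simpa using isRootOfUnity_of_one (hbH2 k j _ (hPH k))
      obtain ⟨D, c, hD, h2⟩ := cq_span (bH k) x h1
      refine ZConnected.sat (hHc k) (hH k).2.1 x D hD ?_ _ (hPH k)
      intro y hy
      rw [h2, mon_sum (emb_ne _)]
      exact Finset.prod_eq_one fun j _ => by rw [hbH2 k j y hy, one_zpow]
    have hw : w = 0 := by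
      by_contra hw
      have j : Fin w := ⟨0, by omega⟩
      have := hind (Pi.single j 1) (by
        have h2 : ∑ i, (Pi.single j 1 : Fin w → ℤ) i • b i = b j := by
          rw [Finset.sum_eq_single j] <;> simp +contextual [Pi.single_apply]
        rw [h2]; exact hSS (hb j))
      have := congrFun this j
      simp at this
    exact concl (by omega)

end

section
open MvPolynomial
open scoped TensorProduct

/-- extension of derivations along formally etale algebras -/
theorem ext_der (R S T : Type) [CommRing R] [CommRing S] [CommRing T] [Algebra R S] [Algebra R T] [Algebra S T]
    [IsScalarTower R S T] [Algebra.FormallyEtale S T] (D0 : Derivation R S T) :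
    ∃ D : Derivation R T T, ∀ x, D (algebraMap S T x) = D0 x := by
  let e := KaehlerDifferential.tensorKaehlerEquivOfFormallyEtale R S T
  let f : T ⊗[S] KaehlerDifferential R S →ₗ[T] T := LinearMap.liftBaseChange T D0.liftKaehlerDifferential
  refine ⟨(f ∘ₗ e.symm.toLinearMap).compDer (KaehlerDifferential.D R T), fun x => ?_⟩
  show f (e.symm (KaehlerDifferential.D R T (algebraMap S T x))) = _
  rw [KaehlerDifferential.tensorKaehlerEquivOfFormallyEtale_symm_D_algebraMap]
  simp [f]

section
variable {k F ι : Type} [Field k] [Field F] [Algebra k F] [CharZero k]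

theorem etale_of_trbasis (t : ι → F) (ht : IsTranscendenceBasis k t) :
    letI : Algebra (MvPolynomial ι k) F := (aeval t : MvPolynomial ι k →ₐ[k] F).toAlgebra
    Algebra.FormallyEtale (MvPolynomial ι k) F := by
  let : Algebra (MvPolynomial ι k) F := (aeval t : MvPolynomial ι k →ₐ[k] F).toAlgebra
  have : IsScalarTower k (MvPolynomial ι k) F := IsScalarTower.of_algebraMap_eq fun r => by
    show _ = aeval t (algebraMap k _ r); simp
  have : FaithfulSMul (MvPolynomial ι k) F := (faithfulSMul_iff_algebraMap_injective _ _).2 ht.1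
  have h1 : Algebra.IsAlgebraic (MvPolynomial ι k) F := by
    have h2 := ht.isAlgebraic
    refine ⟨fun x => ?_⟩
    have h3 := h2.isAlgebraic x
    obtain ⟨p, hp, hx⟩ := h3
    let e := ht.1.aevalEquiv
    refine ⟨p.map e.symm.toRingEquiv.toRingHom, ?_, ?_⟩
    · exact (Polynomial.map_ne_zero_iff e.symm.injective).2 hp
    · rw [Polynomial.aeval_def, Polynomial.eval₂_map]
      rw [Polynomial.aeval_def] at hx
      have hfe : (algebraMap (MvPolynomial ι k) F).comp e.symm.toRingEquiv.toRingHom =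
          algebraMap (Algebra.adjoin k (Set.range t)) F := by
        refine RingHom.ext fun y => ?_
        show aeval t (e.symm y) = (y : F)
        have := ht.1.algebraMap_aevalEquiv (e.symm y)
        rw [← this]
        show ((e (e.symm y) : _) : F) = y
        rw [e.apply_symm_apply]
      rw [← hfe] at hx
      exact hx
  let := FractionRing.liftAlgebra (MvPolynomial ι k) F
  have := FractionRing.isScalarTower_liftAlgebra (MvPolynomial ι k) F
  have h4 : Algebra.IsAlgebraic (FractionRing (MvPolynomial ι k)) F :=
    (IsFractionRing.comap_isAlgebraic_iff (A := MvPolynomial ι k) (K := FractionRing (MvPolynomial ι k)) (C := F)).1 h1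
  have : CharZero (FractionRing (MvPolynomial ι k)) := by
    have := charZero_of_injective_algebraMap (IsFractionRing.injective (MvPolynomial ι k) (FractionRing (MvPolynomial ι k)))
    exact this
  have : Algebra.FormallyEtale (FractionRing (MvPolynomial ι k)) F := Algebra.FormallyEtale.of_isSeparable _ _
  have : Algebra.FormallyEtale (MvPolynomial ι k) (FractionRing (MvPolynomial ι k)) :=
    Algebra.FormallyEtale.of_isLocalization (nonZeroDivisors _)
  exact Algebra.FormallyEtale.comp (MvPolynomial ι k) (FractionRing (MvPolynomial ι k)) F

theorem ext_trbasis (t : ι → F) (ht : IsTranscendenceBasis k t) (v : ι → F) :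
    ∃ D : Derivation k F F, ∀ i, D (t i) = v i := by
  let : Algebra (MvPolynomial ι k) F := (aeval t : MvPolynomial ι k →ₐ[k] F).toAlgebra
  have : IsScalarTower k (MvPolynomial ι k) F := IsScalarTower.of_algebraMap_eq fun r => by
    show _ = aeval t (algebraMap k _ r); simp
  have := etale_of_trbasis t ht
  obtain ⟨D, hD⟩ := ext_der k (MvPolynomial ι k) F (MvPolynomial.mkDerivation k v)
  refine ⟨D, fun i => ?_⟩
  have := hD (X i)
  rw [mkDerivation_X] at this
  rw [← this]
  congr 1
  show t i = aeval t (X i)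
  simp

/-- a derivation killing a subfield, as a derivation over that subfield -/
def derOver {R : Type} [CommRing R] [Algebra R F] (D : Derivation R F F) (E : Subfield F) (hE : ∀ x ∈ E, D x = 0) :
    Derivation E F F where
  toFun := D
  map_add' := map_add D
  map_smul' := by
    intro c y
    show D ((c : F) * y) = (c : F) * D y
    rw [D.leibniz, hE c c.2]; simp
  map_one_eq_zero' := by simp
  leibniz' := by intro a b; simp

/-- a derivation killing a subfield kills all elements algebraic over it -/
theorem der_alg {R : Type} [CommRing R] [Algebra R F] [CharZero F] (D : Derivation R F F) (E : Subfield F) (hE : ∀ x ∈ E, D x = 0)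
    (x : F) (hx : IsAlgebraic E x) : D x = 0 := by
  have h1 := (derOver D E hE).map_aeval (minpoly E x) x
  rw [minpoly.aeval, map_zero] at h1
  have h2 : Polynomial.aeval x (Polynomial.derivative (minpoly E x)) ≠ 0 :=
    (minpoly.irreducible hx.isIntegral).separable.aeval_derivative_ne_zero (minpoly.aeval _ _)
  have h3 := (smul_eq_zero.1 h1.symm).resolve_left h2
  exact h3


end

section
open MvPolynomial

theorem poly_res {k F : Type} [Field k] [Field F] [Algebra k F] (t : F) (ht : Transcendental k t)
    {ι : Type} [Fintype ι] (p : ι → Polynomial k) (hp : ∀ i, p i ≠ 0) (γ : ι → k)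
    (h : ∑ i, γ i • (Polynomial.aeval t (Polynomial.derivative (p i)) / Polynomial.aeval t (p i)) = 0) :
    ∑ i, γ i * ((p i).rootMultiplicity 0 : k) = 0 := by
  classical
  have hinj : Function.Injective (Polynomial.aeval t : Polynomial k →ₐ[k] F) := transcendental_iff_injective.1 ht
  have ht0 : t ≠ 0 := by rintro rfl; exact ht isAlgebraic_zero
  have h1 : ∀ i, ∃ r : Polynomial k, p i = Polynomial.X ^ (p i).rootMultiplicity 0 * r ∧ r.eval 0 ≠ 0 := by
    intro i
    obtain ⟨r, hr, hr2⟩ := Polynomial.exists_eq_pow_rootMultiplicity_mul_and_not_dvd (p i) (hp i) 0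
    rw [Polynomial.C_0, sub_zero] at hr hr2
    refine ⟨r, hr, fun h0 => hr2 ?_⟩
    rw [Polynomial.X_dvd_iff, Polynomial.coeff_zero_eq_eval_zero, h0]
  choose r hr hr0 using h1
  have hrn : ∀ i, Polynomial.aeval t (r i) ≠ 0 := by
    intro i h0
    have : r i = 0 := hinj (by rw [h0, map_zero])
    exact hr0 i (by rw [this]; simp)
  set v := fun i => (p i).rootMultiplicity 0 with hv
  have h2 : ∀ i, Polynomial.aeval t (Polynomial.derivative (p i)) / Polynomial.aeval t (p i) =
      (v i : F) / t + Polynomial.aeval t (Polynomial.derivative (r i)) / Polynomial.aeval t (r i) := by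
    intro i
    have h3 := hr i
    change p i = Polynomial.X ^ v i * r i at h3
    rw [h3, Polynomial.derivative_mul, Polynomial.derivative_X_pow]
    have := hrn i
    rcases Nat.eq_zero_or_pos (v i) with h0 | h0
    · simp [h0]
    · obtain ⟨m, hm⟩ : ∃ m, v i = m + 1 := ⟨v i - 1, by omega⟩
      rw [hm]
      simp
      field_simp
      ring
  have h3 : (∑ i, γ i • (v i : F)) / t = - ∑ i, γ i • (Polynomial.aeval t (Polynomial.derivative (r i)) / Polynomial.aeval t (r i)) := by
    rw [eq_neg_iff_add_eq_zero, ← h, Finset.sum_div, ← Finset.sum_add_distrib]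
    refine Finset.sum_congr rfl fun i _ => ?_
    rw [h2, smul_add, smul_div_assoc]
  have h4 : Polynomial.C (∑ i, γ i * (v i : k)) * ∏ i, r i =
      - Polynomial.X * ∑ i, Polynomial.C (γ i) * (Polynomial.derivative (r i) * ∏ j ∈ Finset.univ.erase i, r j) := by
    apply hinj
    simp only [map_mul, map_neg, Polynomial.aeval_C, map_sum, Polynomial.aeval_X, map_prod, map_natCast]
    rw [div_eq_iff ht0] at h3
    simp only [Algebra.smul_def] at h3
    rw [h3, ← Finset.sum_neg_distrib, Finset.sum_mul, Finset.sum_mul, Finset.mul_sum]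
    refine Finset.sum_congr rfl fun i _ => ?_
    rw [← Finset.mul_prod_erase Finset.univ _ (Finset.mem_univ i)]
    have := hrn i
    field_simp
  have h5 := congrArg (Polynomial.eval 0) h4
  simp only [Polynomial.eval_mul, Polynomial.eval_C, Polynomial.eval_neg, Polynomial.eval_X, neg_zero, zero_mul,
    Polynomial.eval_prod] at h5
  exact (mul_eq_zero.1 h5).resolve_right (Finset.prod_ne_zero_iff.2 fun i _ => hr0 i)

/-- uniqueness: a twisted derivation F → Ω killing K kills everything algebraic over K -/
theorem tw_der {K F Ω : Type} [Field K] [Field F] [Field Ω] [Algebra K F] [Algebra K Ω] [CharZero K] (σ : F →ₐ[K] Ω)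
    (d : F → Ω) (hadd : ∀ x y, d (x + y) = d x + d y) (hmul : ∀ x y, d (x * y) = σ x * d y + σ y * d x)
    (hK : ∀ c, d (algebraMap K F c) = 0) (x : F) (hx : IsAlgebraic K x) : d x = 0 := by
  let : Module F Ω := Module.compHom Ω σ.toRingHom
  have : IsScalarTower K F Ω := ⟨fun a b c => by
    show σ (a • b) * c = a • (σ b * c)
    rw [map_smul, smul_mul_assoc]⟩
  let D : Derivation K F Ω :=
    { toFun := d
      map_add' := hadd
      map_smul' := by
        intro c y
        rw [Algebra.smul_def, hmul, hK]
        simp [Algebra.smul_def]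
      map_one_eq_zero' := by
        have := hK 1
        rwa [map_one] at this
      leibniz' := by
        intro a b
        exact hmul a b }
  have h1 := D.map_aeval (minpoly K x) x
  rw [minpoly.aeval, map_zero] at h1
  have h2 : Polynomial.aeval x (Polynomial.derivative (minpoly K x)) ≠ 0 :=
    (minpoly.irreducible hx.isIntegral).separable.aeval_derivative_ne_zero (minpoly.aeval _ _)
  have h3 : σ (Polynomial.aeval x (Polynomial.derivative (minpoly K x))) * d x = 0 := h1.symm
  exact (mul_eq_zero.1 h3).resolve_left ((map_ne_zero σ).2 h2)

theorem dlog_prod {R F ι : Type} [CommRing R] [Field F] [Algebra R F] (D : Derivation R F F) (s : Finset ι) (f : ι → F)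
    (hf : ∀ i ∈ s, f i ≠ 0) : D (∏ i ∈ s, f i) / ∏ i ∈ s, f i = ∑ i ∈ s, D (f i) / f i := by
  classical
  induction s using Finset.induction_on with
  | empty => simp
  | insert a s ha ih =>
    rw [Finset.prod_insert ha, Finset.sum_insert ha, ← ih fun i hi => hf i (Finset.mem_insert_of_mem hi), D.leibniz]
    have h1 := hf a (Finset.mem_insert_self _ _)
    have h2 : ∏ i ∈ s, f i ≠ 0 := Finset.prod_ne_zero_iff.2 fun i hi => hf i (Finset.mem_insert_of_mem hi)
    simp only [smul_eq_mul]
    field_simp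
    ring

theorem dlog_zpow {R F : Type} [CommRing R] [Field F] [Algebra R F] (D : Derivation R F F) (x : F) (hx : x ≠ 0) (m : ℤ) :
    D (x ^ m) / x ^ m = m * (D x / x) := by
  rw [D.leibniz_zpow]
  simp only [zsmul_eq_mul, smul_eq_mul]
  rw [zpow_sub_one₀ hx]
  have := zpow_ne_zero m hx
  field_simp

theorem dlog_mon {R F : Type} [CommRing R] [Field F] [Algebra R F] (D : Derivation R F F) {n : ℕ} (x : Fin n → F)
    (hx : ∀ i, x i ≠ 0) (a : Fin n → ℤ) : D (mon a x) / mon a x = ∑ l, (a l : F) * (D (x l) / x l) := by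
  unfold mon
  rw [dlog_prod D _ _ fun i _ => zpow_ne_zero _ (hx i)]
  exact Finset.sum_congr rfl fun l _ => dlog_zpow D _ (hx l) _

end

section
open MvPolynomial

theorem trbasis_single {C F : Type} [Field C] [Field F] [Algebra C F] (g : F) (hg : Transcendental C g) :
    ∃ k : IntermediateField C F, IsTranscendenceBasis k (fun _ : Unit => g) := by
  have h1 : AlgebraicIndepOn C id ({g} : Set F) := by
    have := (algebraicIndependent_unique_type_iff (R := C) (x := fun i : ({g} : Set F) => (i : F))).2 (by
      show Transcendental C ((default : ({g} : Set F)) : F)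
      exact hg)
    exact this
  obtain ⟨T, hT, hT2⟩ := exists_isTranscendenceBasis_superset (R := C) h1
  have hgT : g ∈ T := hT rfl
  have hTi : AlgebraicIndepOn C id T := hT2.1
  have h3 : AlgebraicIndepOn C id (insert g (T \ {g})) := by
    rw [Set.insert_sdiff_singleton, Set.insert_eq_of_mem hgT]; exact hTi
  have h4 := ((AlgebraicIndepOn.insert_iff (by simp)).1 h3).2
  rw [Set.image_id] at h4
  let k := IntermediateField.adjoin C (T \ {g})
  have h5 : Transcendental k g := fun h => h4 ((IntermediateField.isAlgebraic_adjoin_iff).1 h)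
  refine ⟨k, ?_⟩
  have h6 : AlgebraicIndependent k (fun _ : Unit => g) := (algebraicIndependent_unique_type_iff).2 h5
  rw [h6.isTranscendenceBasis_iff_isAlgebraic, hT2.isAlgebraic_iff]
  rintro ⟨y, hy⟩
  by_cases hyg : y = g
  · have := isAlgebraic_algebraMap (A := F) (⟨g, Algebra.subset_adjoin ⟨(), rfl⟩⟩ : Algebra.adjoin k (Set.range fun _ : Unit => g))
    subst hyg
    exact this
  · have hyk : y ∈ k := IntermediateField.subset_adjoin _ _ ⟨hy, hyg⟩
    exact isAlgebraic_algebraMap (A := F) (algebraMap k (Algebra.adjoin k (Set.range fun _ : Unit => g)) ⟨y, hyk⟩)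

theorem lift_emb {K F Ω : Type} [Field K] [Field F] [Field Ω] [Algebra K F] [Algebra K Ω] [Algebra.IsAlgebraic K F]
    [IsAlgClosed Ω] (E : IntermediateField K F) (σ : E →ₐ[K] Ω) : ∃ τ : F →ₐ[K] Ω, ∀ x : E, τ x = σ x := by
  let : Algebra E Ω := σ.toRingHom.toAlgebra
  have : Algebra.IsAlgebraic E F := Algebra.IsAlgebraic.tower_top (K := K) E
  have : IsScalarTower K E Ω := IsScalarTower.of_algebraMap_eq fun c => (σ.commutes c).symm
  let τ0 : F →ₐ[E] Ω := IsAlgClosed.lift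
  exact ⟨τ0.restrictScalars K, fun x => τ0.commutes x⟩

theorem norm_dlog {K F : Type} [Field K] [Field F] [Algebra K F] [CharZero K] [Algebra.IsAlgebraic K F]
    (δ : Derivation ℤ F F) (δK : Derivation ℤ K K) (hδ : ∀ c, δ (algebraMap K F c) = algebraMap K F (δK c))
    {r : ℕ} (g : Fin r → F) (hg : ∀ j, g j ≠ 0) (β : Fin r → K) (h : ∑ j, algebraMap K F (β j) * (δ (g j) / g j) = 0) :
    ∃ (e : ℕ) (N : Fin r → K), e ≠ 0 ∧ (∀ j, N j ≠ 0) ∧ (∀ j c, algebraMap K F c = g j → N j = c ^ e) ∧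
      ∑ j, β j * (δK (N j) / N j) = 0 := by
  classical
  let Ω := AlgebraicClosure F
  have : CharZero F := charZero_of_injective_algebraMap (algebraMap K F).injective
  obtain ⟨Δ, hΔ⟩ : ∃ Δ : Derivation ℤ Ω Ω, ∀ x, Δ (algebraMap F Ω x) = algebraMap F Ω (δ x) := by
    have : Algebra.FormallyEtale F Ω := Algebra.FormallyEtale.of_isSeparable _ _
    obtain ⟨Δ, h1⟩ := ext_der ℤ F Ω ((Algebra.linearMap F Ω).compDer δ)
    exact ⟨Δ, fun x => h1 x⟩
  have hΔK : ∀ c : K, Δ (algebraMap K Ω c) = algebraMap K Ω (δK c) := by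
    intro c
    rw [IsScalarTower.algebraMap_apply K F Ω, hΔ, hδ, ← IsScalarTower.algebraMap_apply]
  let E := IntermediateField.adjoin K (Set.range g)
  have hfin : FiniteDimensional K E := by
    apply IntermediateField.finiteDimensional_adjoin
    rintro x -
    exact (Algebra.IsAlgebraic.isAlgebraic x).isIntegral
  have hgE : ∀ j, g j ∈ E := fun j => IntermediateField.subset_adjoin _ _ ⟨j, rfl⟩
  let gE : Fin r → E := fun j => ⟨g j, hgE j⟩
  have hcom : ∀ (σ : E →ₐ[K] Ω), ∃ τ : F →ₐ[K] Ω, (∀ x : E, τ x = σ x) ∧ ∀ y : F, Δ (τ y) = τ (δ y) := by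
    intro σ
    obtain ⟨τ, hτ⟩ := lift_emb E σ
    refine ⟨τ, hτ, fun y => ?_⟩
    have := tw_der τ (fun y => Δ (τ y) - τ (δ y)) (by intro x y; simp only [map_add]; ring)
      (by intro x y; simp only [map_mul, Derivation.leibniz, smul_eq_mul, map_add]; ring) (by
        intro c
        rw [τ.commutes, hΔK, hδ, τ.commutes, sub_self]) y (Algebra.IsAlgebraic.isAlgebraic y)
    exact sub_eq_zero.1 this
  choose τ hτ1 hτ2 using hcom
  have hN : ∀ j, algebraMap K Ω (Algebra.norm K (gE j)) = ∏ σ : E →ₐ[K] Ω, τ σ (g j) := by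
    intro j
    rw [Algebra.norm_eq_prod_embeddings K Ω (gE j)]
    exact Finset.prod_congr rfl fun σ _ => (hτ1 σ (gE j)).symm
  refine ⟨Module.finrank K E, fun j => Algebra.norm K (gE j), Module.finrank_pos.ne', ?_, ?_, ?_⟩
  · intro j
    rw [Algebra.norm_ne_zero_iff]
    intro h0
    exact hg j (congrArg Subtype.val h0)
  · intro j c hc
    have : gE j = algebraMap K E c := Subtype.ext hc.symm
    show Algebra.norm K (gE j) = _
    rw [this, Algebra.norm_algebraMap]
  · apply (algebraMap K Ω).injective
    rw [map_sum, map_zero]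
    have h1 : ∀ j, algebraMap K Ω (β j * (δK (Algebra.norm K (gE j)) / Algebra.norm K (gE j))) =
        ∑ σ : E →ₐ[K] Ω, τ σ (algebraMap K F (β j) * (δ (g j) / g j)) := by
      intro j
      rw [map_mul, map_div₀, ← hΔK, hN, dlog_prod Δ _ _ fun σ _ => (map_ne_zero _).2 (hg j), Finset.mul_sum]
      refine Finset.sum_congr rfl fun σ _ => ?_
      rw [map_mul, (τ σ).commutes, map_div₀, hτ2]
    rw [Finset.sum_congr rfl fun j _ => h1 j, Finset.sum_comm]
    refine Finset.sum_eq_zero fun σ _ => ?_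
    rw [← map_sum, h, map_zero]

theorem res_core {C F : Type} [Field C] [Field F] [Algebra C F] [CharZero C] {r : ℕ} (g : Fin r → F) (hg : ∀ j, g j ≠ 0)
    (β : Fin r → C) (hβ : ∀ c : Fin r → ℤ, ∑ j, (c j : C) * β j = 0 → c = 0)
    (h : ∀ δ : Derivation C F F, ∑ j, β j • (δ (g j) / g j) = 0) (j0 : Fin r) : IsAlgebraic C (g j0) := by
  classical
  by_contra hj0
  obtain ⟨k, hk⟩ := trbasis_single (g j0) hj0
  set t := g j0 with htdef
  have htr : Transcendental k t := (algebraicIndependent_unique_type_iff).1 hk.1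
  obtain ⟨δ, hδ⟩ := ext_trbasis (fun _ : Unit => t) hk (fun _ => 1)
  have hδt : δ t = 1 := hδ ()
  let K := IntermediateField.adjoin k {t}
  have hKalg : Algebra.IsAlgebraic K F := by
    have := hk.isAlgebraic_field
    rw [Set.range_const] at this
    exact this
  have hδK : ∀ y ∈ K, δ y ∈ K := by
    intro y hy
    induction hy using IntermediateField.adjoin_induction with
    | mem x hx =>
      rw [Set.mem_singleton_iff] at hx
      rw [hx, hδt]; exact one_mem K
    | algebraMap c => rw [Derivation.map_algebraMap]; exact zero_mem K
    | add x y hx hy h1 h2 => rw [map_add]; exact add_mem h1 h2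
    | inv x hx h1 =>
      rw [Derivation.leibniz_inv]
      exact mul_mem (neg_mem (pow_mem (inv_mem hx) 2)) h1
    | mul x y hx hy h1 h2 =>
      rw [Derivation.leibniz]
      exact add_mem (mul_mem hx h2) (mul_mem hy h1)
  have : CharZero k := charZero_of_injective_algebraMap (algebraMap C k).injective
  have : CharZero K := charZero_of_injective_algebraMap (algebraMap k K).injective
  let δK : Derivation ℤ K K :=
    { toFun := fun y => ⟨δ y, hδK y y.2⟩
      map_add' := fun x y => Subtype.ext (map_add δ _ _)
      map_smul' := fun m y => Subtype.ext (by
        show δ ((m • y : K) : F) = ((m • (⟨δ y, hδK y y.2⟩ : K) : K) : F)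
        simp)
      map_one_eq_zero' := Subtype.ext δ.map_one_eq_zero
      leibniz' := fun x y => Subtype.ext (by
        show δ ((x : F) * y) = (x : F) * δ y + (y : F) * δ x
        rw [Derivation.leibniz]; rfl) }
  obtain ⟨e, N, he, hN0, hNc, hN⟩ := norm_dlog (δ.restrictScalars ℤ) δK (fun c => rfl) g hg
    (fun j => algebraMap k K (algebraMap C k (β j))) (by
      have := h (δ.restrictScalars C)
      rw [← this]
      refine Finset.sum_congr rfl fun j _ => ?_
      rw [Algebra.smul_def]
      rfl)
  have hrep : ∀ j, ∃ p q : Polynomial k, ((N j : K) : F) = Polynomial.aeval t p / Polynomial.aeval t q := by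
    intro j
    exact (IntermediateField.mem_adjoin_simple_iff k _).1 (N j).2
  choose p q hpq using hrep
  have hNF : ∀ j, ((N j : K) : F) ≠ 0 := fun j h0 => hN0 j (Subtype.ext h0)
  have hp0 : ∀ j, Polynomial.aeval t (p j) ≠ 0 := by
    intro j h0
    apply hNF j; rw [hpq, h0, zero_div]
  have hq0 : ∀ j, Polynomial.aeval t (q j) ≠ 0 := by
    intro j h0
    apply hNF j; rw [hpq, h0, div_zero]
  have hp : ∀ j, p j ≠ 0 := fun j h0 => hp0 j (by rw [h0, map_zero])
  have hq : ∀ j, q j ≠ 0 := fun j h0 => hq0 j (by rw [h0, map_zero])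
  have hdp : ∀ f : Polynomial k, δ (Polynomial.aeval t f) = Polynomial.aeval t (Polynomial.derivative f) := by
    intro f
    rw [Derivation.map_aeval, hδt, smul_eq_mul, mul_one]
  have hN2 : ∑ j, algebraMap C k (β j) • (δ (N j : F) / (N j : F)) = 0 := by
    have := congrArg (fun y : K => (y : F)) hN
    simp only [ZeroMemClass.coe_zero] at this
    rw [← this]
    rw [← IntermediateField.coe_val, map_sum]
    refine Finset.sum_congr rfl fun j _ => ?_
    rw [Algebra.smul_def]
    rfl
  have key := poly_res t htr (Sum.elim p q) (by rintro (j | j); exacts [hp j, hq j])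
    (Sum.elim (fun j => algebraMap C k (β j)) (fun j => - algebraMap C k (β j))) (by
      rw [Fintype.sum_sum_type, ← Finset.sum_add_distrib, ← hN2]
      refine Finset.sum_congr rfl fun j _ => ?_
      simp only [Sum.elim_inl, Sum.elim_inr]
      rw [neg_smul, ← sub_eq_add_neg, ← smul_sub]
      congr 1
      rw [hpq, ← hdp, ← hdp]
      have := hp0 j
      have := hq0 j
      rw [Derivation.leibniz_div]
      simp only [smul_eq_mul]
      field_simp)
  rw [Fintype.sum_sum_type, ← Finset.sum_add_distrib] at key
  simp only [Sum.elim_inl, Sum.elim_inr] at key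
  have key2 : ∑ j, (((p j).rootMultiplicity 0 - (q j).rootMultiplicity 0 : ℤ) : C) * β j = 0 := by
    apply (algebraMap C k).injective
    rw [map_zero, map_sum]
    refine Eq.trans (Finset.sum_congr rfl fun j _ => ?_) key
    rw [map_mul, map_intCast, Int.cast_sub, Int.cast_natCast, Int.cast_natCast]
    ring
  have key3 := congrFun (hβ _ key2) j0
  have h1 : N j0 = (⟨t, IntermediateField.mem_adjoin_simple_self k t⟩ : K) ^ e := hNc j0 _ rfl
  have h2 : Polynomial.aeval t (p j0) = Polynomial.aeval t (q j0 * Polynomial.X ^ e) := by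
    have h3 := hpq j0
    rw [h1] at h3
    have h4 := hq0 j0
    rw [eq_div_iff h4] at h3
    rw [← h3]
    simp [mul_comm]
  have h3 := (transcendental_iff_injective.1 htr) h2
  have h4 : (p j0).rootMultiplicity 0 = (q j0).rootMultiplicity 0 + e := by
    rw [h3]
    have := Polynomial.rootMultiplicity_mul_X_sub_C_pow (a := (0 : k)) (n := e) (hq j0)
    rw [Polynomial.C_0, sub_zero] at this
    exact this
  simp only [Pi.zero_apply] at key3
  omega

end

section
open MvPolynomial

theorem residue {C F : Type} [Field C] [Field F] [Algebra C F] [CharZero C] {n : ℕ} (x : Fin n → F) (hx : ∀ l, x l ≠ 0)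
    (γ : Fin n → C) (h : ∀ δ : Derivation C F F, ∑ l, γ l • (δ (x l) / x l) = 0) :
    γ ∈ Submodule.span C {v : Fin n → C | ∃ a : Fin n → ℤ, IsAlgebraic C (mon a x) ∧ v = fun l => (a l : C)} := by
  classical
  let S := Submodule.span ℤ (Set.range γ)
  have : Module.Finite ℤ S := Module.Finite.span_of_finite ℤ (Set.finite_range γ)
  have : Module.Free ℤ S := inferInstance
  let b := Module.finBasis ℤ S
  let m : Fin n → Fin (Module.finrank ℤ S) → ℤ := fun l j => b.repr ⟨γ l, Submodule.subset_span ⟨l, rfl⟩⟩ j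
  have hm : ∀ l, γ l = ∑ j, (m l j : C) * (b j : C) := by
    intro l
    have := congrArg Subtype.val (b.sum_repr ⟨γ l, Submodule.subset_span ⟨l, rfl⟩⟩)
    simp only [Submodule.coe_sum, Submodule.coe_smul] at this
    rw [← this]
    refine Finset.sum_congr rfl fun j _ => ?_
    rw [zsmul_eq_mul]
  let g : Fin (Module.finrank ℤ S) → F := fun j => mon (fun l => m l j) x
  have hg : ∀ j, g j ≠ 0 := fun j => mon_ne_zero hx _
  have h1 := res_core g hg (fun j => (b j : C)) (by
    intro c hc
    have hb := b.linearIndependent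
    rw [Fintype.linearIndependent_iff] at hb
    funext j
    refine hb c ?_ j
    apply Subtype.ext
    simp only [Submodule.coe_sum, Submodule.coe_smul, zsmul_eq_mul]
    exact hc) (by
    intro δ
    rw [← h δ]
    simp only [g, dlog_mon δ x hx]
    simp only [hm, Finset.smul_sum, Finset.sum_smul]
    rw [Finset.sum_comm]
    refine Finset.sum_congr rfl fun l _ => Finset.sum_congr rfl fun j _ => ?_
    simp only [Algebra.smul_def, map_mul, map_intCast]
    ring)
  have h2 : γ = ∑ j, (b j : C) • (fun l => (m l j : C)) := by
    funext l
    rw [hm, Finset.sum_apply]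
    exact Finset.sum_congr rfl fun j _ => by simp [mul_comm]
  rw [h2]
  refine Submodule.sum_mem _ fun j _ => Submodule.smul_mem _ _ (Submodule.subset_span ⟨_, h1 j, rfl⟩)

/-- kernel of a derivation as a subfield -/
def kerD {k F : Type} [Field k] [Field F] [Algebra k F] (D : Derivation k F F) : Subfield F where
  carrier := {y | D y = 0}
  mul_mem' := by intro a b ha hb; simp only [Set.mem_ofPred_eq] at *; rw [D.leibniz, ha, hb]; simp
  one_mem' := D.map_one_eq_zero
  add_mem' := by intro a b ha hb; simp only [Set.mem_ofPred_eq] at *; rw [map_add, ha, hb, add_zero]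
  zero_mem' := map_zero D
  neg_mem' := by intro a ha; simp only [Set.mem_ofPred_eq] at *; rw [map_neg, ha, neg_zero]
  inv_mem' := by intro a ha; simp only [Set.mem_ofPred_eq] at *; rw [Derivation.leibniz_inv, ha, smul_zero]

theorem li_ext {k C : Type} [Field k] [Field C] (f : k →+* C) {n s : ℕ} (u : Fin s → Fin n → k) (hu : LinearIndependent k u) (c : Fin s → C)
    (h : ∀ l, ∑ i, c i * f (u i l) = 0) : c = 0 := by
  classical
  let T := Fintype.linearCombination k u
  have hT : Function.Injective T := hu.fintypeLinearCombination_injective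
  obtain ⟨R, hR⟩ := T.exists_leftInverse_of_injective (LinearMap.ker_eq_bot.2 hT)
  have hR1 : ∀ i j, ∑ l, u i l * R (Pi.single l 1) j = if i = j then 1 else 0 := by
    intro i j
    have h1 : R (u i) = Pi.single i 1 := by
      have := congrArg (fun g => g (Pi.single i 1)) hR
      simpa [T] using this
    have h2 : u i = ∑ l, u i l • (Pi.single l 1 : Fin n → k) := by
      funext l'; simp [Finset.sum_apply, Pi.single_apply]
    have h3 := congrFun h1 j
    rw [h2, map_sum, Finset.sum_apply] at h3
    simp only [map_smul, Pi.smul_apply, smul_eq_mul] at h3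
    rw [h3, Pi.single_apply]
    simp [eq_comm]
  funext j
  have : c j = ∑ i, c i * f (∑ l, u i l * R (Pi.single l 1) j) := by
    simp [hR1]
  rw [this]
  simp only [map_sum, map_mul, Finset.mul_sum]
  rw [Finset.sum_comm]
  simp only [← mul_assoc, ← Finset.sum_mul, h, zero_mul, Finset.sum_const_zero, Pi.zero_apply]

end

section
open MvPolynomial

section
variable {k F : Type} [Field k] [Field F] [Algebra k F] [CharZero k]

theorem der_rank (D : Derivation k F F) {d w : ℕ} (t : Fin d → F) (ht : IsTranscendenceBasis k t)
    (b : Fin w → F) (hb : AlgebraicIndependent k b) (hDb : ∀ j, D (b j) = 0) :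
    Module.Finite F (Derivation (kerD D) F F) ∧ Module.finrank F (Derivation (kerD D) F F) + w ≤ d := by
  classical
  have : CharZero F := charZero_of_injective_algebraMap (algebraMap k F).injective
  obtain ⟨T, hT, hT2⟩ := exists_isTranscendenceBasis_superset (R := k) (s := Set.range b) hb.coe_range
  have hcard : Cardinal.mk T = d := by
    rw [hT2.cardinalMk_eq ht]; simp
  have hTf : Finite T := by
    rw [← Cardinal.lt_aleph0_iff_finite, hcard]; exact Cardinal.natCast_lt_aleph0
  let := Fintype.ofFinite T
  have hcardT : T.ncard = d := by
    rw [Set.ncard, Set.encard, ENat.card]; rw [hcard]; simp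
  have hcb : (Set.range b).ncard = w := by
    rw [← Set.image_univ, Set.ncard_image_of_injective _ hb.injective, Set.ncard_univ]; simp
  have hTfin : T.Finite := Set.toFinite T
  have hdiff : (T \ Set.range b).ncard + w = d := by
    have := Set.ncard_sdiff_add_ncard_of_subset hT hTfin
    omega
  let R : Set F := T \ Set.range b
  have : Finite R := (hTfin.subset Set.sdiff_subset)
  let := Fintype.ofFinite R
  let ev : Derivation (kerD D) F F →ₗ[F] (R → F) :=
    { toFun := fun δ y => δ y
      map_add' := fun _ _ => rfl
      map_smul' := fun _ _ => rfl }
  have hinj : Function.Injective ev := by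
    rw [← LinearMap.ker_eq_bot, LinearMap.ker_eq_bot']
    intro δ hδ
    have hk : ∀ c : k, algebraMap k F c ∈ kerD D := fun c => D.map_algebraMap c
    have hkill : ∀ y ∈ kerD D, δ y = 0 := fun y hy => δ.map_algebraMap (⟨y, hy⟩ : kerD D)
    have hTk : ∀ y ∈ T, δ y = 0 := by
      intro y hy
      by_cases h : y ∈ Set.range b
      · obtain ⟨j, rfl⟩ := h
        exact hkill _ (hDb j)
      · exact congrFun hδ ⟨y, hy, h⟩
    ext y
    have hal := hT2.isAlgebraic.isAlgebraic y
    let E := kerD δ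
    refine der_alg (R := kerD D) δ E (fun x hx => hx) y ?_
    let E' : Subalgebra k F :=
      { E with algebraMap_mem' := fun c => hkill _ (hk c) }
    have hle : Algebra.adjoin k (Set.range fun z : T => (z : F)) ≤ E' := by
      rw [Algebra.adjoin_le_iff]
      rintro _ ⟨z, rfl⟩
      exact hTk z z.2
    obtain ⟨p, hp, hpy⟩ := hal
    let f : Algebra.adjoin k (Set.range fun z : T => (z : F)) →+* E := (Subalgebra.inclusion hle).toRingHom
    refine ⟨p.map f, ?_, ?_⟩
    · refine (Polynomial.map_ne_zero_iff ?_).2 hp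
      exact Subalgebra.inclusion_injective hle
    · rw [Polynomial.aeval_def, Polynomial.eval₂_map]
      exact hpy
  refine ⟨Module.Finite.of_injective ev hinj, ?_⟩
  have h1 := LinearMap.finrank_le_finrank_of_injective hinj
  rw [Module.finrank_fintype_fun_eq_card] at h1
  have h2 : Fintype.card R = R.ncard := by rw [← Nat.card_eq_fintype_card]; rfl
  have h3 : R.ncard + w = d := hdiff
  omega

/-- log derivative functional -/
def eta {C : Subfield F} {n : ℕ} (x : Fin n → F) (v : Fin n → F) : Derivation C F F →ₗ[F] F where
  toFun δ := ∑ l, v l * (δ (x l) / x l)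
  map_add' δ1 δ2 := by
    rw [← Finset.sum_add_distrib]
    refine Finset.sum_congr rfl fun l _ => ?_
    rw [Derivation.add_apply]; ring
  map_smul' c δ := by
    rw [RingHom.id_apply, smul_eq_mul, Finset.mul_sum]
    refine Finset.sum_congr rfl fun l _ => ?_
    rw [Derivation.smul_apply, smul_eq_mul]; ring

theorem eta_flat {n : ℕ} (D : Derivation k F F) (x : Fin n → F) (hx : ∀ l, x l ≠ 0) (v : Fin n → F)
    (hv : ∀ l, v l ∈ kerD D) (hD : ∑ l, v l * (D (x l) / x l) = 0) (δ δ' : Derivation (kerD D) F F)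
    (hδ' : ∀ y, δ' y = D (δ y) - δ (D y)) :
    D (eta x v δ) = eta x v δ' := by
  have hkill : ∀ y ∈ kerD D, δ y = 0 := fun y hy => δ.map_algebraMap (⟨y, hy⟩ : kerD D)
  have h1 : δ (∑ l, v l * (D (x l) / x l)) = 0 := by rw [hD, map_zero]
  rw [← sub_zero (D _), ← h1]
  show D (∑ l, v l * (δ (x l) / x l)) - δ (∑ l, v l * (D (x l) / x l)) = ∑ l, v l * (δ' (x l) / x l)
  rw [map_sum, map_sum, ← Finset.sum_sub_distrib]
  refine Finset.sum_congr rfl fun l _ => ?_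
  have hvl : D (v l) = 0 := hv l
  rw [D.leibniz, δ.leibniz, hvl, hkill _ (hv l), hδ', Derivation.leibniz_div, Derivation.leibniz_div]
  have := hx l
  simp only [smul_eq_mul]
  field_simp
  ring

theorem ax {n d w s ρ : ℕ} (x : Fin n → F) (hx : ∀ l, x l ≠ 0) (t : Fin d → F) (ht : IsTranscendenceBasis k t)
    (u : Fin s → Fin n → k) (hu : LinearIndependent k u) (D : Derivation k F F) (hD0 : D ≠ 0)
    (hD : ∀ i, ∑ l, algebraMap k F (u i l) * (D (x l) / x l) = 0)
    (a : Fin ρ → Fin n → ℤ) (ha : ∀ z : Fin n → ℤ, D (mon z x) = 0 → cq z ∈ Submodule.span ℚ (Set.range fun j => cq (a j)))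
    (b : Fin w → F) (hb : AlgebraicIndependent k b) (hDb : ∀ j, D (b j) = 0) : w + 1 ≤ d ∧ s + w < d + ρ := by
  classical
  have : CharZero F := charZero_of_injective_algebraMap (algebraMap k F).injective
  obtain ⟨hfin, hrk⟩ := der_rank D t ht b hb hDb
  let C := kerD D
  let V := Derivation C F F
  let D0 : V := derOver D C (fun x hx => hx)
  have hD0' : D0 ≠ 0 := by
    intro h0; apply hD0; ext y
    exact congrArg (fun δ : V => δ y) h0
  let uF : Fin s → Fin n → F := fun i l => algebraMap k F (u i l)
  have huC : ∀ i l, uF i l ∈ C := fun i l => D.map_algebraMap _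
  let η : Fin s → Module.Dual F V := fun i => eta x (uF i)
  change Module.finrank F V + w ≤ d at hrk
  obtain ⟨κ, c, hc, hspan, hli⟩ := exists_linearIndependent' F η
  have : Finite κ := Finite.of_injective c hc
  let := Fintype.ofFinite κ
  have hκ : Fintype.card κ + 1 ≤ Module.finrank F V := by
    have h1 := Subspace.finrank_add_finrank_dualAnnihilator_eq (F ∙ D0)
    rw [finrank_span_singleton hD0'] at h1
    have h2 := finrank_span_eq_card hli
    have h3 : Submodule.span F (Set.range (η ∘ c)) ≤ (F ∙ D0).dualAnnihilator := by
      rw [Submodule.span_le]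
      rintro _ ⟨j, rfl⟩
      rw [SetLike.mem_coe, Submodule.mem_dualAnnihilator]
      intro y hy
      obtain ⟨r, rfl⟩ := Submodule.mem_span_singleton.1 hy
      rw [map_smul]
      have : (η ∘ c) j D0 = 0 := hD (c j)
      rw [this, smul_zero]
    have h4 := Submodule.finrank_mono h3
    omega
  refine ⟨by omega, ?_⟩
  -- coefficients
  have hcoef : ∀ i, ∃ f : κ → F, ∑ j, f j • η (c j) = η i := by
    intro i
    have : η i ∈ Submodule.span F (Set.range (η ∘ c)) := by rw [hspan]; exact Submodule.subset_span ⟨i, rfl⟩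
    exact (Submodule.mem_span_range_iff_exists_fun F).1 this
  choose f hf using hcoef
  have hfC : ∀ i j, f i j ∈ C := by
    intro i
    have h1 : ∑ j, D (f i j) • (η ∘ c) j = 0 := by
      ext δ
      let δ' : V := ⁅D0, δ⁆
      have hδ' : ∀ y, δ' y = D (δ y) - δ (D y) := fun y => Derivation.commutator_apply _
      have hfl : ∀ i, D (η i δ) = η i δ' := fun i => eta_flat D x hx (uF i) (huC i) (hD i) δ δ' hδ'
      have h2 := congrArg (fun φ : Module.Dual F V => φ δ) (hf i)
      have h3 := congrArg (fun φ : Module.Dual F V => φ δ') (hf i)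
      simp only [LinearMap.sum_apply, LinearMap.smul_apply, smul_eq_mul] at h2 h3
      have h4 := congrArg D h2
      rw [map_sum, hfl, ← h3, ← sub_eq_zero, ← Finset.sum_sub_distrib] at h4
      simp only [LinearMap.sum_apply, LinearMap.smul_apply, smul_eq_mul, Function.comp_apply, LinearMap.zero_apply]
      rw [← h4]
      refine Finset.sum_congr rfl fun j _ => ?_
      rw [D.leibniz, hfl, smul_eq_mul, smul_eq_mul]; ring
    intro j
    exact (Fintype.linearIndependent_iff.1 hli) _ h1 j
  let ψ : (Fin s → C) →ₗ[C] (κ → C) :=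
    { toFun := fun g j => ∑ i, g i * ⟨f i j, hfC i j⟩
      map_add' := by intro g g'; funext j; simp [add_mul, Finset.sum_add_distrib]
      map_smul' := by intro r g; funext j; simp [Finset.mul_sum, mul_assoc] }
  let uC : Fin s → Fin n → C := fun i l => ⟨uF i l, huC i l⟩
  let θ : (Fin s → C) →ₗ[C] (Fin n → C) := Fintype.linearCombination C uC
  have hθ : Function.Injective θ := by
    rw [← LinearMap.ker_eq_bot, LinearMap.ker_eq_bot']
    intro g hg
    let fk : k →+* C := (algebraMap k F).codRestrict C (fun c => D.map_algebraMap c)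
    refine li_ext fk u hu g fun l => ?_
    have := congrFun hg l
    simp only [θ, Fintype.linearCombination_apply, Finset.sum_apply, Pi.smul_apply, smul_eq_mul] at this
    exact this
  let W := Submodule.span C (Set.range fun (j : Fin ρ) (l : Fin n) => ((a j l : ℤ) : C))
  have hW : Module.finrank C W ≤ ρ := by
    have := finrank_range_le_card (R := C) (fun (j : Fin ρ) (l : Fin n) => ((a j l : ℤ) : C))
    rw [Fintype.card_fin] at this
    exact this
  have hker : ∀ g, ψ g = 0 → θ g ∈ W := by
    intro g hg
    have h1 := residue (C := C) x hx (θ g) (by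
      intro δ
      have h2 : ∑ l, θ g l • (δ (x l) / x l) = ∑ i, (g i : F) * η i δ := by
        show ∑ l, _ = ∑ i, (g i : F) * ∑ l, uF i l * (δ (x l) / x l)
        simp only [θ, Fintype.linearCombination_apply, Finset.sum_apply, Pi.smul_apply, smul_eq_mul, Finset.mul_sum,
          Finset.sum_smul]
        rw [Finset.sum_comm]
        refine Finset.sum_congr rfl fun i _ => Finset.sum_congr rfl fun l _ => ?_
        rw [Algebra.smul_def, ← mul_assoc]
        rfl
      rw [h2]
      have h3 : ∀ i, η i δ = ∑ j, f i j * η (c j) δ := by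
        intro i
        have := congrArg (fun φ : Module.Dual F V => φ δ) (hf i)
        simp only [LinearMap.sum_apply, LinearMap.smul_apply, smul_eq_mul] at this
        exact this.symm
      rw [Finset.sum_congr rfl fun i _ => by rw [h3 i, Finset.mul_sum]]
      rw [Finset.sum_comm]
      refine Finset.sum_eq_zero fun j _ => ?_
      have h4 := congrArg (fun y : κ → C => ((y j : C) : F)) hg
      have h5 : ∑ i, (g i : F) * f i j = 0 := by
        have : ((∑ i, g i * ⟨f i j, hfC i j⟩ : C) : F) = 0 := h4
        rw [← C.coe_subtype, map_sum] at this
        exact this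
      simp only [← mul_assoc]
      rw [← Finset.sum_mul, h5, zero_mul])
    refine Submodule.span_le.2 ?_ h1
    rintro _ ⟨z, hz, rfl⟩
    have hz2 := ha z (der_alg D C (fun y hy => hy) _ hz)
    obtain ⟨q, hq⟩ := (Submodule.mem_span_range_iff_exists_fun ℚ).1 hz2
    have : (fun l => (z l : C)) = ∑ j, (q j : C) • (fun l => ((a j l : ℤ) : C)) := by
      funext l
      have h6 := congrFun hq l
      rw [Finset.sum_apply]
      simp only [Finset.sum_apply, Pi.smul_apply, cq, smul_eq_mul] at h6 ⊢
      have h7 := congrArg (fun r : ℚ => (r : C)) h6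
      push_cast at h7
      exact h7.symm
    rw [SetLike.mem_coe, this]
    exact Submodule.sum_mem _ fun j _ => Submodule.smul_mem _ _ (Submodule.subset_span ⟨j, rfl⟩)
  have h1 : Module.finrank C (LinearMap.ker ψ) ≤ ρ := by
    let φ : LinearMap.ker ψ →ₗ[C] W := (θ.comp (LinearMap.ker ψ).subtype).codRestrict W (fun g => hker g g.2)
    have : Function.Injective φ := by
      intro g g' h
      have := congrArg Subtype.val h
      exact Subtype.ext (hθ this)
    exact (LinearMap.finrank_le_finrank_of_injective this).trans hW
  have h2 := LinearMap.finrank_range_add_finrank_ker ψ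
  have h3 : Module.finrank C (LinearMap.range ψ) ≤ Fintype.card κ := by
    have := Submodule.finrank_le (LinearMap.range ψ)
    simpa using this
  have h4 : Module.finrank C (Fin s → C) = s := by simp
  omega

end

section
open MvPolynomial

theorem descent_sum {U : Ultrafilter ℕ} {k K ι : Type} [Field k] [Field K] (σ : k →+* K) (S : Finset ι) (f : ι → Ult U k) (c : ι → K)
    (h : ∑ i ∈ S, algebraMap K (Ult U K) (c i) * Ult.map σ (f i) = 0)
    (hli : ∀ c' : ι → k, ∑ i ∈ S, algebraMap k (Ult U k) (c' i) * f i = 0 → ∀ i ∈ S, c' i = 0) : ∀ i ∈ S, c i = 0 := by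
  classical
  choose φ hφ using fun i => Ult.mk_surj (f i)
  let : Algebra k K := σ.toAlgebra
  let B := Module.Basis.ofVectorSpace k K
  have h1 : ∀ᶠ j in (U : Filter ℕ), ∑ i ∈ S, c i * σ (φ i j) = 0 := by
    have h2 : ∑ i ∈ S, algebraMap K (Ult U K) (c i) * Ult.map σ (f i) = Ult.mk U (fun j => ∑ i ∈ S, c i * σ (φ i j)) := by
      have h3 : (fun j => ∑ i ∈ S, c i * σ (φ i j)) = ∑ i ∈ S, fun j => c i * σ (φ i j) := by
        funext j; simp
      rw [h3, map_sum]
      refine Finset.sum_congr rfl fun i _ => ?_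
      rw [← hφ i]
      rfl
    rw [h2, Ult.mk_eq_zero] at h
    exact h
  have h4 : ∀ β, ∀ i ∈ S, B.repr (c i) β = 0 := by
    intro β
    apply hli
    have h5 : ∑ i ∈ S, algebraMap k (Ult U k) (B.repr (c i) β) * f i = Ult.mk U (fun j => ∑ i ∈ S, B.repr (c i) β * φ i j) := by
      have h3 : (fun j => ∑ i ∈ S, B.repr (c i) β * φ i j) = ∑ i ∈ S, fun j => B.repr (c i) β * φ i j := by
        funext j; simp
      rw [h3, map_sum]
      refine Finset.sum_congr rfl fun i _ => ?_
      rw [← hφ i]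
      rfl
    rw [h5, Ult.mk_eq_zero]
    filter_upwards [h1] with j hj
    have h6 := congrArg (fun y => B.repr y β) hj
    have h7 : ∑ i ∈ S, c i * σ (φ i j) = ∑ i ∈ S, (φ i j) • c i := by
      refine Finset.sum_congr rfl fun i _ => ?_
      rw [Algebra.smul_def, mul_comm]; rfl
    simp only [h7, map_sum, map_smul, Finsupp.finsetSum_apply, Finsupp.smul_apply, smul_eq_mul, map_zero, Finsupp.zero_apply] at h6
    rw [← h6]
    exact Finset.sum_congr rfl fun i _ => mul_comm _ _
  intro i hi
  apply B.repr.injective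
  ext β
  rw [h4 β i hi, map_zero]; rfl

theorem descent_ai {U : Ultrafilter ℕ} {k K ι : Type} [Fintype ι] [Field k] [Field K] (σ : k →+* K) (f : ι → Ult U k)
    (hf : AlgebraicIndependent k f) : AlgebraicIndependent K (fun i => Ult.map σ (f i)) := by
  classical
  rw [algebraicIndependent_iff]
  intro p hp
  rw [aeval_def, eval₂_eq'] at hp
  have := descent_sum σ p.support (fun d => ∏ i, f i ^ d i) (fun d => p.coeff d) (by
    rw [← hp]
    refine Finset.sum_congr rfl fun d _ => ?_
    simp only [map_prod, map_pow]) (by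
    intro c' hc' d hd
    have h0 := (algebraicIndependent_iff.1 hf) (∑ d ∈ p.support, monomial d (c' d)) (by
      rw [map_sum, ← hc']
      refine Finset.sum_congr rfl fun d _ => ?_
      rw [aeval_monomial, Finsupp.prod_fintype _ _ (by simp)])
    have h1 := congrArg (coeff d) h0
    rw [coeff_sum] at h1
    simp only [coeff_monomial, coeff_zero, Finset.sum_ite_eq', hd, if_true] at h1
    exact h1)
  ext d
  by_cases hd : d ∈ p.support
  · rw [this d hd]; simp
  · rw [notMem_support_iff.1 hd]; simp

end

section
open MvPolynomial

theorem lat_basis {n : ℕ} (S : Set (Fin n → ℤ)) : ∃ (ρ : ℕ) (a : Fin ρ → Fin n → ℤ), (∀ j, a j ∈ S) ∧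
    LinearIndependent ℚ (fun j => cq (a j)) ∧ ∀ z ∈ S, cq z ∈ Submodule.span ℚ (Set.range fun j => cq (a j)) := by
  classical
  obtain ⟨κ, c, hc, hspan, hli⟩ := exists_linearIndependent' ℚ (fun z : S => cq (z : Fin n → ℤ))
  have : Finite κ := hli.finite
  let := Fintype.ofFinite κ
  let e := Fintype.equivFin κ
  refine ⟨Fintype.card κ, fun j => c (e.symm j), fun j => (c (e.symm j)).2, ?_, ?_⟩
  · exact hli.comp e.symm e.symm.injective
  · intro z hz
    have h1 : cq z ∈ Submodule.span ℚ (Set.range fun z : S => cq (z : Fin n → ℤ)) := Submodule.subset_span ⟨⟨z, hz⟩, rfl⟩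
    rw [← hspan] at h1
    have h2 : (Set.range fun j => cq (c (e.symm j) : Fin n → ℤ)) = Set.range ((fun z : S => cq (z : Fin n → ℤ)) ∘ c) := by
      have := e.symm.surjective.range_comp ((fun z : S => cq (z : Fin n → ℤ)) ∘ c)
      exact this
    rw [h2]; exact h1

theorem alg_sub {k A : Type} [Field k] [Field A] [Algebra k A] {ρ : ℕ} (y : Fin ρ → A) : ∃ (w : ℕ) (ι : Fin w → Fin ρ),
    AlgebraicIndependent k (fun j => y (ι j)) ∧ ∀ i, IsAlgebraic (Algebra.adjoin k (Set.range fun j => y (ι j))) (y i) := by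
  classical
  obtain ⟨B, hB⟩ := (AlgebraicIndependent.matroid k A).exists_isBasis (Set.range y)
  rw [AlgebraicIndependent.matroid_isBasis_iff] at hB
  obtain ⟨h1, h2, h3⟩ := hB
  have hBf : Finite B := (Set.finite_range y).subset h2
  let := Fintype.ofFinite B
  let e := Fintype.equivFin B
  choose g hg using fun b : B => h2 b.2
  have hgy : ∀ j, y (g (e.symm j)) = (e.symm j : A) := fun j => hg _
  have hfun : (fun j => y (g (e.symm j))) = (fun b : B => (b : A)) ∘ e.symm := funext hgy
  refine ⟨Fintype.card B, fun j => g (e.symm j), ?_, ?_⟩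
  · rw [hfun]
    exact AlgebraicIndependent.comp (x := fun b : B => (b : A)) h1 _ e.symm.injective
  · intro i
    rw [hfun, e.symm.surjective.range_comp, Subtype.range_coe]
    exact h3 _ ⟨i, rfl⟩

theorem case2a {n s : ℕ} (U : Ultrafilter ℕ) {X : Set (TorusPt n)} (hX : ZClosed X)
    (P : ℕ → TorusPt n) (hP : ∀ k, P k ∈ X) (xs : Fin n → Ult U Qbar)
    (hxs : xs = fun i => Ult.mk U (fun k => emb (P k) i)) {d : ℕ} (e : Fin d → Fin n)
    (he : AlgebraicIndependent Qbar (fun i => xs (e i))) (σ : Qbar →+* ℂ) (F : IntermediateField ℂ (Ult U ℂ))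
    (x : Fin n → F) (hxF : ∀ l, (x l : Ult U ℂ) = Ult.map σ (xs l)) (ht : IsTranscendenceBasis ℂ (fun i => x (e i)))
    (u : Fin s → Fin n → ℂ) (hu : LinearIndependent ℂ u) (D : Derivation ℂ F F) (hD0 : D ≠ 0)
    (hD : ∀ i, ∑ l, algebraMap ℂ F (u i l) * (D (x l) / x l) = 0) : ∃ k, ∃ Y, IsAnomalous X Y s ∧ P k ∈ Y := by
  classical
  have hxs0 : ∀ l, xs l ≠ 0 := by
    intro i; rw [hxs]; exact Ult.mk_ne_zero.mpr (Filter.Eventually.of_forall fun k => emb_ne _ _)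
  have hx0 : ∀ l, x l ≠ 0 := by
    intro l h0
    have := hxF l
    rw [h0] at this
    exact (map_ne_zero (Ult.map σ)).2 (hxs0 l) this.symm
  obtain ⟨ρ, a, haS, hali, haspan⟩ := lat_basis {z : Fin n → ℤ | D (mon z x) = 0}
  obtain ⟨w, ι, hι, halg⟩ := alg_sub (k := Qbar) (fun i => mon (a i) xs)
  have hmx : ∀ z, ((mon z x : F) : Ult U ℂ) = Ult.map σ (mon z xs) := by
    intro z
    have h1 := mon_map (x := x) F.val.toRingHom z
    have h2 := mon_map (x := xs) (Ult.map (U := U) σ) z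
    rw [h2]
    refine Eq.trans h1 ?_
    congr 1
    funext l; exact hxF l
  have hb : AlgebraicIndependent ℂ (fun j => mon (a (ι j)) x) := by
    have h1 := descent_ai σ _ hι
    have h2 : (fun j => Ult.map σ (mon (a (ι j)) xs)) = F.val ∘ (fun j => mon (a (ι j)) x) := by
      funext j; exact (hmx _).symm
    rw [h2] at h1
    exact (F.val.algebraicIndependent_iff F.val.injective).1 h1
  obtain ⟨h1, h2⟩ := ax x hx0 _ ht u hu D hD0 hD a haspan _ hb (fun j => haS (ι j))
  exact anomaly U hX P hP xs hxs e he a hali ι halg h1 h2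

end

section
open MvPolynomial

theorem pert_rank {ι : Type} [Fintype ι] [DecidableEq ι] (W : ι → ι → ℂ) (hW1 : ∀ j l, ‖W j l‖ = 1)
    (hW : ∀ j j', ∑ l, W j l * (starRingEnd ℂ) (W j' l) = if j = j' then (Fintype.card ι : ℂ) else 0)
    (ε : ι → ι → ℂ) (hε : ∀ j l, ‖ε j l‖ ≤ 1 / 2) (K : Submodule ℂ (EuclideanSpace ℂ ι))
    (hK : ∀ v ∈ K, ∀ l, ∑ j, W j l * (1 + ε j l) * v j = 0) : 4 * Module.finrank ℂ K ≤ Fintype.card ι := by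
  classical
  rcases isEmpty_or_nonempty ι with hι | hι
  · have : Module.finrank ℂ K = 0 := by
      have := Submodule.finrank_le K
      rw [finrank_euclideanSpace, Fintype.card_eq_zero] at this
      omega
    omega
  set N := Fintype.card ι with hN
  have hNpos : 0 < N := Fintype.card_pos
  let b := stdOrthonormalBasis ℂ K
  have hb : Orthonormal ℂ (fun k => (b k : EuclideanSpace ℂ ι)) :=
    b.orthonormal.comp_linearIsometry K.subtypeₗᵢ
  -- Parseval
  have hpars : ∀ v : EuclideanSpace ℂ ι, ∑ l, ‖∑ j, W j l * v j‖ ^ 2 = N * ‖v‖ ^ 2 := by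
    intro v
    have h1 : ((∑ l, ‖∑ j, W j l * v j‖ ^ 2 : ℝ) : ℂ) = ((N * ‖v‖ ^ 2 : ℝ) : ℂ) := by
      rw [EuclideanSpace.norm_sq_eq]
      push_cast
      simp only [← Complex.mul_conj']
      simp only [map_sum, map_mul, Finset.sum_mul_sum]
      rw [Finset.sum_comm]
      rw [Finset.mul_sum]
      refine Finset.sum_congr rfl fun j _ => ?_
      rw [Finset.sum_comm]
      have h2 : ∀ j', ∑ l, W j l * v j * ((starRingEnd ℂ) (W j' l) * (starRingEnd ℂ) (v j')) =
          (if j = j' then (N : ℂ) else 0) * (v j * (starRingEnd ℂ) (v j')) := by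
        intro j'
        rw [← hW, Finset.sum_mul]
        exact Finset.sum_congr rfl fun l _ => by ring
      simp only [h2]
      simp
    exact_mod_cast h1
  have hB : ∀ l, ∑ k, ‖∑ j, W j l * ε j l * (b k : EuclideanSpace ℂ ι) j‖ ^ 2 ≤ N / 4 := by
    intro l
    let y : EuclideanSpace ℂ ι := WithLp.toLp 2 fun j => (starRingEnd ℂ) (W j l * ε j l)
    have h1 := hb.sum_inner_products_le (s := Finset.univ) (x := y)
    have h2 : ‖y‖ ^ 2 ≤ N / 4 := by
      rw [EuclideanSpace.norm_sq_eq]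
      have : ∀ j ∈ Finset.univ, ‖y j‖ ^ 2 ≤ 1 / 4 := by
        intro j _
        show ‖(starRingEnd ℂ) (W j l * ε j l)‖ ^ 2 ≤ 1 / 4
        rw [RCLike.norm_conj, norm_mul, hW1, one_mul]
        have := hε j l
        have h0 := norm_nonneg (ε j l)
        nlinarith
      refine (Finset.sum_le_sum this).trans ?_
      rw [Finset.sum_const, Finset.card_univ, nsmul_eq_mul, ← hN]
      linarith
    refine le_trans (le_of_eq ?_) (h1.trans h2)
    refine Finset.sum_congr rfl fun k _ => ?_
    rw [norm_inner_symm]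
    congr 2
    simp only [PiLp.inner_apply, y]
    refine Finset.sum_congr rfl fun j _ => ?_
    simp [mul_comm]
  have hEq : ∀ k l, ‖∑ j, W j l * ε j l * (b k : EuclideanSpace ℂ ι) j‖ = ‖∑ j, W j l * (b k : EuclideanSpace ℂ ι) j‖ := by
    intro k l
    have h1 := hK (b k) (b k).2 l
    have h2 : ∑ j, W j l * (1 + ε j l) * (b k : EuclideanSpace ℂ ι) j =
        ∑ j, W j l * (b k : EuclideanSpace ℂ ι) j + ∑ j, W j l * ε j l * (b k : EuclideanSpace ℂ ι) j := by
      rw [← Finset.sum_add_distrib]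
      exact Finset.sum_congr rfl fun j _ => by ring
    rw [h2] at h1
    rw [eq_neg_of_add_eq_zero_left h1, norm_neg]
  have hfin : (Module.finrank ℂ K : ℝ) * N ≤ N * (N / 4) := by
    have h1 : ∑ k : Fin (Module.finrank ℂ K), ∑ l, ‖∑ j, W j l * ε j l * (b k : EuclideanSpace ℂ ι) j‖ ^ 2 = (Module.finrank ℂ K : ℝ) * N := by
      simp only [hEq, hpars]
      have : ∀ k, ‖(b k : EuclideanSpace ℂ ι)‖ = 1 := fun k => hb.1 k
      simp [this]
    rw [← h1, Finset.sum_comm]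
    refine (Finset.sum_le_sum fun l _ => hB l).trans ?_
    rw [Finset.sum_const, Finset.card_univ, nsmul_eq_mul, ← hN]
  have hN' : (0 : ℝ) < N := by exact_mod_cast hNpos
  have : (4 * Module.finrank ℂ K : ℝ) ≤ N := by nlinarith
  exact_mod_cast this

theorem dft_orth (m d : ℕ) (hm : 1 ≤ m) (j j' : Fin d → Fin m) :
    ∑ l : Fin d → Fin m, Complex.exp (2 * Real.pi * Complex.I * (∑ i, (j i : ℂ) * (l i : ℂ)) / m) *
      (starRingEnd ℂ) (Complex.exp (2 * Real.pi * Complex.I * (∑ i, (j' i : ℂ) * (l i : ℂ)) / m)) =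
      if j = j' then (Fintype.card (Fin d → Fin m) : ℂ) else 0 := by
  classical
  have hm0 : (m : ℂ) ≠ 0 := by exact_mod_cast (by omega : m ≠ 0)
  let ζ : Fin d → ℂ := fun i => Complex.exp (2 * Real.pi * Complex.I * ((j i : ℂ) - (j' i : ℂ)) / m)
  have h1 : ∀ l : Fin d → Fin m, Complex.exp (2 * Real.pi * Complex.I * (∑ i, (j i : ℂ) * (l i : ℂ)) / m) *
      (starRingEnd ℂ) (Complex.exp (2 * Real.pi * Complex.I * (∑ i, (j' i : ℂ) * (l i : ℂ)) / m)) = ∏ i, ζ i ^ (l i : ℕ) := by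
    intro l
    rw [← Complex.exp_conj, ← Complex.exp_add]
    simp only [ζ, ← Complex.exp_nat_mul]
    rw [← Complex.exp_sum]
    congr 1
    simp only [map_div₀, map_mul, map_sum, Complex.conj_I, map_natCast, map_ofNat, Complex.conj_ofReal]
    simp only [Finset.mul_sum, Finset.sum_div, ← Finset.sum_add_distrib]
    refine Finset.sum_congr rfl fun i _ => ?_
    ring
  simp only [h1]
  have h2 : ∑ l : Fin d → Fin m, ∏ i, ζ i ^ (l i : ℕ) = ∏ i, ∑ c : Fin m, ζ i ^ (c : ℕ) := by
    rw [Finset.prod_univ_sum]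
    simp
  rw [h2]
  split_ifs with hjj
  · subst hjj
    have : ∀ i, ζ i = 1 := fun i => by simp [ζ]
    simp [this]
  · obtain ⟨i, hi⟩ := Function.ne_iff.1 hjj
    apply Finset.prod_eq_zero (Finset.mem_univ i)
    rw [Fin.sum_univ_eq_sum_range (fun c => ζ i ^ c) m]
    have hz : ζ i ≠ 1 := by
      intro h
      rw [Complex.exp_eq_one_iff] at h
      obtain ⟨k, hk⟩ := h
      have hpi : (2 * Real.pi * Complex.I : ℂ) ≠ 0 := Complex.two_pi_I_ne_zero
      have h3 : ((j i : ℂ) - (j' i : ℂ)) = k * m := by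
        field_simp at hk
        rw [hk]; ring
      have h4 : ((j i : ℕ) : ℤ) - ((j' i : ℕ) : ℤ) = k * m := by exact_mod_cast h3
      have h5 := (j i).2
      have h6 := (j' i).2
      have hk0 : k = 0 := by
        by_contra hk0
        rcases lt_or_gt_of_ne hk0 with h | h
        · have : k * m ≤ -1 * m := by
            apply mul_le_mul_of_nonneg_right (by omega) (by omega)
          omega
        · have : 1 * (m : ℤ) ≤ k * m := by
            apply mul_le_mul_of_nonneg_right (by omega) (by omega)
          omega
      rw [hk0] at h4
      apply hi
      apply Fin.ext
      omega
    rw [geom_sum_eq hz]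
    have : ζ i ^ m = 1 := by
      simp only [ζ]
      rw [← Complex.exp_nat_mul, Complex.exp_eq_one_iff]
      refine ⟨(j i : ℤ) - (j' i : ℤ), ?_⟩
      field_simp
      push_cast
      ring
    rw [this]; simp

/-- the interface between the analytic realization and linear algebra -/
theorem dft_apply {A : Type} [AddCommGroup A] [Module ℂ A] {n d s : ℕ} (u : Fin s → Fin n → ℝ) (c : Fin d → Fin s)
    (M : (Fin n → ℤ) → A) (X0 : (Fin n → ℤ) → ℂ) (hX0 : ∀ a, X0 a ≠ 0)
    (h : ∀ δ > (0 : ℝ), ∃ ρ > (0 : ℝ), ∀ w : Fin d → ℂ, (∀ i, ‖w i‖ < ρ) → ∃ lam : Fin n → ℂ, (∀ l, ‖lam l‖ < δ) ∧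
      (∀ i, ∑ l, (u (c i) l : ℂ) * lam l = w i) ∧ ∀ {ι : Type} [Fintype ι] (γ : ι → ℂ) (a : ι → Fin n → ℤ), ∑ j, γ j • M (a j) = 0 →
        ∑ j, γ j * (X0 (a j) * Complex.exp (∑ l, (a j l : ℂ) * lam l)) = 0) :
    ∃ q : ℕ, 1 ≤ q ∧ ∀ m : ℕ, 1 ≤ m → ∀ a : (Fin d → Fin m) → Fin n → ℤ,
      (∀ j l, |(a j l : ℝ) - q * ∑ i, (j i : ℝ) * u (c i) l| ≤ 1) →
      3 * m ^ d ≤ 4 * Module.finrank ℂ (Submodule.span ℂ (Set.range fun j => M (a j))) := by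
  classical
  obtain ⟨ρ, hρ, hh⟩ := h (1 / (4 * (n + 1))) (by positivity)
  obtain ⟨q, hq⟩ := exists_nat_gt (2 * Real.pi / ρ)
  have hq0 : (0 : ℝ) < q := lt_trans (by positivity) hq
  refine ⟨q, by exact_mod_cast hq0, fun m hm a ha => ?_⟩
  have hm0 : (0 : ℝ) < m := by exact_mod_cast hm
  let w : (Fin d → Fin m) → Fin d → ℂ := fun l i => 2 * Real.pi * Complex.I * (l i : ℂ) / (q * m)
  have hw : ∀ l i, ‖w l i‖ < ρ := by
    intro l i
    have h1 : ‖w l i‖ = 2 * Real.pi * (l i : ℝ) / (q * m) := by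
      simp only [w, norm_div, norm_mul, Complex.norm_I, Complex.norm_natCast, Complex.norm_real, mul_one]
      rw [Real.norm_of_nonneg Real.pi_pos.le]; simp
    rw [h1]
    have h2 : (l i : ℝ) ≤ m := by exact_mod_cast (l i).2.le
    calc 2 * Real.pi * (l i : ℝ) / (q * m) ≤ 2 * Real.pi * m / (q * m) := by gcongr
      _ = 2 * Real.pi / q := by field_simp
      _ < ρ := by rw [div_lt_comm₀ hq0 hρ]; exact hq
  choose lam hlam1 hlam2 hlam3 using fun l => hh (w l) (hw l)
  let W : (Fin d → Fin m) → (Fin d → Fin m) → ℂ := fun j l => Complex.exp (2 * Real.pi * Complex.I * (∑ i, (j i : ℂ) * (l i : ℂ)) / m)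
  let bb : (Fin d → Fin m) → Fin n → ℝ := fun j l => (a j l : ℝ) - q * ∑ i, (j i : ℝ) * u (c i) l
  let ε : (Fin d → Fin m) → (Fin d → Fin m) → ℂ := fun j l => Complex.exp (∑ r, (bb j r : ℂ) * lam l r) - 1
  have hexp : ∀ j l, Complex.exp (∑ r, (a j r : ℂ) * lam l r) = W j l * (1 + ε j l) := by
    intro j l
    simp only [W, ε, add_sub_cancel]
    rw [← Complex.exp_add]
    congr 1
    have h1 : ∑ r, (bb j r : ℂ) * lam l r = ∑ r, (a j r : ℂ) * lam l r - q * ∑ i, (j i : ℂ) * ∑ r, (u (c i) r : ℂ) * lam l r := by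
      simp only [bb]
      push_cast
      simp only [sub_mul, Finset.sum_sub_distrib, Finset.mul_sum, Finset.sum_mul]
      congr 1
      rw [Finset.sum_comm]
      refine Finset.sum_congr rfl fun i _ => Finset.sum_congr rfl fun r _ => ?_
      ring
    rw [h1]
    simp only [hlam2, w]
    have hqc : (q : ℂ) ≠ 0 := by exact_mod_cast hq0.ne'
    have hmc : (m : ℂ) ≠ 0 := by exact_mod_cast hm0.ne'
    have h2 : (q : ℂ) * ∑ i, (j i : ℂ) * (2 * Real.pi * Complex.I * (l i : ℂ) / (q * m)) =
        2 * Real.pi * Complex.I * (∑ i, (j i : ℂ) * (l i : ℂ)) / m := by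
      rw [Finset.mul_sum, Finset.mul_sum, Finset.sum_div]
      refine Finset.sum_congr rfl fun i _ => ?_
      field_simp
    rw [h2]; ring
  have hε : ∀ j l, ‖ε j l‖ ≤ 1 / 2 := by
    intro j l
    have h1 : ‖∑ r, (bb j r : ℂ) * lam l r‖ ≤ 1 / 4 := by
      refine (norm_sum_le _ _).trans ?_
      have : ∀ r ∈ Finset.univ, ‖(bb j r : ℂ) * lam l r‖ ≤ 1 / (4 * (n + 1)) := by
        intro r _
        rw [norm_mul, Complex.norm_real, Real.norm_eq_abs]
        calc |bb j r| * ‖lam l r‖ ≤ 1 * (1 / (4 * (n + 1))) :=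
              mul_le_mul (ha j r) (hlam1 l r).le (norm_nonneg _) zero_le_one
          _ = _ := one_mul _
      refine (Finset.sum_le_sum this).trans ?_
      rw [Finset.sum_const, Finset.card_univ, Fintype.card_fin, nsmul_eq_mul]
      rw [mul_one_div, div_le_iff₀ (by positivity)]
      linarith
    have := Complex.norm_exp_sub_one_le (h1.trans (by norm_num))
    exact this.trans (by linarith)
  let T : (EuclideanSpace ℂ (Fin d → Fin m)) →ₗ[ℂ] A :=
    { toFun := fun v => ∑ j, (v j * (X0 (a j))⁻¹) • M (a j)
      map_add' := by intro v v'; simp [add_mul, add_smul, Finset.sum_add_distrib]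
      map_smul' := by intro r v; simp [Finset.smul_sum, smul_smul, mul_assoc] }
  have hK := pert_rank W (fun j l => by
      simp only [W]
      rw [Complex.norm_exp]
      have : (2 * Real.pi * Complex.I * (∑ i, (j i : ℂ) * (l i : ℂ)) / m) =
        ((2 * Real.pi * (∑ i, (j i : ℝ) * (l i : ℝ)) / m : ℝ) : ℂ) * Complex.I := by push_cast; ring
      rw [this]
      simp) (dft_orth m d hm) ε hε (LinearMap.ker T) (by
      intro v hv l
      have h1 := hlam3 l (fun j => v j * (X0 (a j))⁻¹) a hv
      rw [← h1]
      refine Finset.sum_congr rfl fun j _ => ?_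
      rw [hexp]
      have := hX0 (a j)
      field_simp)
  have h1 := LinearMap.finrank_range_add_finrank_ker T
  have h2 : LinearMap.range T ≤ Submodule.span ℂ (Set.range fun j => M (a j)) := by
    rintro _ ⟨v, rfl⟩
    exact Submodule.sum_mem _ fun j _ => Submodule.smul_mem _ _ (Submodule.subset_span ⟨j, rfl⟩)
  have : Module.Finite ℂ (Submodule.span ℂ (Set.range fun j => M (a j))) := Module.Finite.span_of_finite _ (Set.finite_range _)
  have h3 := Submodule.finrank_mono h2
  rw [finrank_euclideanSpace] at h1
  have h4 : Fintype.card (Fin d → Fin m) = m ^ d := by simp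
  rw [h4] at h1 hK
  omega

end

section
open MvPolynomial

theorem fse_pderiv {k : Type} [Field k] {d : ℕ} (p : MvPolynomial (Fin (d + 1)) k) :
    finSuccEquiv k d (pderiv 0 p) = Polynomial.derivative (finSuccEquiv k d p) := by
  induction p using MvPolynomial.induction_on with
  | C a => simp [finSuccEquiv_apply]
  | add p q hp hq => simp [hp, hq]
  | mul_X p i hp =>
    rw [Derivation.leibniz, smul_eq_mul, smul_eq_mul, map_add, map_mul, map_mul, hp, map_mul, Polynomial.derivative_mul]
    refine Fin.cases ?_ (fun j => ?_) i
    · simp [finSuccEquiv_X_zero]; ring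
    · simp [finSuccEquiv_X_succ, pderiv_X_of_ne (Fin.succ_ne_zero j)]; ring

theorem hypersurface {F : Type} [Field F] [Algebra ℂ F] {d : ℕ} (z : Fin (d + 1) → F)
    (h1 : AlgebraicIndependent ℂ (fun i : Fin d => z i.succ)) (h2 : ¬ AlgebraicIndependent ℂ z) :
    ∃ G l : MvPolynomial (Fin (d + 1)) ℂ, aeval z G = 0 ∧ aeval z l ≠ 0 ∧ aeval z (pderiv 0 G) ≠ 0 ∧
      ∀ g, aeval z g = 0 → ∃ N : ℕ, G ∣ l ^ N * g := by
  classical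
  have h3 : ∃ m : ℕ, ∃ G : MvPolynomial (Fin (d + 1)) ℂ, G ≠ 0 ∧ aeval z G = 0 ∧ (finSuccEquiv ℂ d G).natDegree = m := by
    rw [algebraicIndependent_iff] at h2
    push Not at h2
    obtain ⟨p, hp, hp0⟩ := h2
    exact ⟨_, p, hp0, hp, rfl⟩
  obtain ⟨G, hG0, hGz, hGd⟩ := Nat.find_spec h3
  have hmin : ∀ g : MvPolynomial (Fin (d + 1)) ℂ, aeval z g = 0 →
      (finSuccEquiv ℂ d g).natDegree < (finSuccEquiv ℂ d G).natDegree → g = 0 := by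
    intro g hg hlt
    by_contra hne
    rw [hGd] at hlt
    exact Nat.find_min h3 hlt ⟨g, hne, hg, rfl⟩
  have hC : ∀ q : MvPolynomial (Fin d) ℂ, aeval z ((finSuccEquiv ℂ d).symm (Polynomial.C q)) = aeval (fun i : Fin d => z i.succ) q := by
    intro q
    have : (finSuccEquiv ℂ d).symm (Polynomial.C q) = rename Fin.succ q := by
      rw [AlgEquiv.symm_apply_eq]
      induction q using MvPolynomial.induction_on with
      | C a => simp [finSuccEquiv_apply]
      | add p q hp hq => simp only [map_add, hp, hq]
      | mul_X p i hp => simp only [map_mul, hp, rename_X, finSuccEquiv_X_succ]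
    rw [this, aeval_rename]; rfl
  have hcI : ∀ q : MvPolynomial (Fin d) ℂ, aeval z ((finSuccEquiv ℂ d).symm (Polynomial.C q)) = 0 → q = 0 := by
    intro q hq
    rw [hC] at hq
    exact (algebraicIndependent_iff.1 h1) q hq
  have hGe : finSuccEquiv ℂ d G ≠ 0 := by simpa using hG0
  have hdeg : (finSuccEquiv ℂ d G).natDegree ≠ 0 := by
    intro h
    obtain ⟨q, hq⟩ := Polynomial.natDegree_eq_zero.1 h
    have hGq : G = (finSuccEquiv ℂ d).symm (Polynomial.C q) := by rw [hq]; simp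
    have : q = 0 := hcI q (by rw [← hGq]; exact hGz)
    rw [this] at hq
    rw [map_zero] at hq
    exact hGe hq.symm
  set lc := (finSuccEquiv ℂ d G).leadingCoeff with hlc
  have hlc0 : lc ≠ 0 := by simpa [hlc] using hG0
  refine ⟨G, (finSuccEquiv ℂ d).symm (Polynomial.C lc), hGz, fun h => hlc0 (hcI _ h), ?_, ?_⟩
  · intro h
    have h4 := hmin _ h (by rw [fse_pderiv]; exact Polynomial.natDegree_derivative_lt hdeg)
    have h5 : Polynomial.derivative (finSuccEquiv ℂ d G) = 0 := by rw [← fse_pderiv, h4, map_zero]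
    exact hdeg (Polynomial.derivative_eq_zero.1 h5)
  · suffices H : ∀ m : ℕ, ∀ g : MvPolynomial (Fin (d + 1)) ℂ, (finSuccEquiv ℂ d g).natDegree < m → aeval z g = 0 →
        ∃ N : ℕ, G ∣ ((finSuccEquiv ℂ d).symm (Polynomial.C lc)) ^ N * g by
      exact fun g hg => H _ g (Nat.lt_succ_self _) hg
    intro m
    induction m with
    | zero => intro g h; omega
    | succ m ih =>
      intro g hgm hg
      by_cases hlt : (finSuccEquiv ℂ d g).natDegree < (finSuccEquiv ℂ d G).natDegree
      · exact ⟨0, by rw [hmin g hg hlt]; simp⟩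
      push Not at hlt
      by_cases hg0 : g = 0
      · exact ⟨0, by rw [hg0]; simp⟩
      have hge : finSuccEquiv ℂ d g ≠ 0 := by simpa using hg0
      let p := finSuccEquiv ℂ d g
      let Q := finSuccEquiv ℂ d G
      let r : Polynomial (MvPolynomial (Fin d) ℂ) := Polynomial.C lc * p - Polynomial.C p.leadingCoeff * Polynomial.X ^ (p.natDegree - Q.natDegree) * Q
      have hr : r.natDegree < p.natDegree := by
        have hpl : p.leadingCoeff ≠ 0 := by simpa [p] using hg0
        have e1 : (Polynomial.C lc * p).natDegree = p.natDegree := Polynomial.natDegree_C_mul hlc0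
        have e2 : (Polynomial.C p.leadingCoeff * Polynomial.X ^ (p.natDegree - Q.natDegree) * Q).natDegree = p.natDegree := by
          rw [mul_assoc, Polynomial.natDegree_C_mul hpl, Polynomial.natDegree_X_pow_mul (hp := hGe)]
          exact Nat.add_sub_cancel' hlt
        refine lt_of_le_of_ne ?_ ?_
        · refine (Polynomial.natDegree_sub_le _ _).trans ?_
          rw [e1, e2, max_self]
        · intro heq
          have hp0 : p.natDegree ≠ 0 := by
            have : Q.natDegree ≤ p.natDegree := hlt
            have : Q.natDegree ≠ 0 := hdeg
            omega
          have : r.coeff p.natDegree = 0 := by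
            have c1 : (Polynomial.C lc * p).coeff p.natDegree = lc * p.leadingCoeff := by simp
            have c2 : (Polynomial.C p.leadingCoeff * Polynomial.X ^ (p.natDegree - Q.natDegree) * Q).coeff p.natDegree = p.leadingCoeff * lc := by
              rw [mul_assoc, Polynomial.coeff_C_mul]
              have : p.natDegree = Q.natDegree + (p.natDegree - Q.natDegree) := (Nat.add_sub_cancel' hlt).symm
              conv_lhs => rw [this]
              simp only [Nat.add_sub_cancel_left]
              rw [Polynomial.coeff_X_pow_mul]
              rfl
            rw [Polynomial.coeff_sub, c1, c2]; ring
          rw [← heq] at this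
          have h6 : r = 0 := by rwa [Polynomial.coeff_natDegree, Polynomial.leadingCoeff_eq_zero] at this
          rw [h6] at heq
          simp at heq
          omega
      let g' := (finSuccEquiv ℂ d).symm r
      have hg'e : g' = (finSuccEquiv ℂ d).symm (Polynomial.C lc) * g - (finSuccEquiv ℂ d).symm (Polynomial.C p.leadingCoeff * Polynomial.X ^ (p.natDegree - Q.natDegree)) * G := by
        simp only [g', r, map_sub, map_mul, p, Q, AlgEquiv.symm_apply_apply]
      obtain ⟨N, hN⟩ := ih g' (by
          have : finSuccEquiv ℂ d g' = r := by simp [g']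
          rw [this]
          have : p.natDegree < m + 1 := hgm
          omega) (by rw [hg'e]; simp [hg, hGz])
      refine ⟨N + 1, ?_⟩
      have : ((finSuccEquiv ℂ d).symm (Polynomial.C lc)) ^ (N + 1) * g =
        ((finSuccEquiv ℂ d).symm (Polynomial.C lc)) ^ N * g' + (((finSuccEquiv ℂ d).symm (Polynomial.C lc)) ^ N * (finSuccEquiv ℂ d).symm (Polynomial.C p.leadingCoeff * Polynomial.X ^ (p.natDegree - Q.natDegree))) * G := by
        rw [hg'e]; ring
      rw [this]
      exact dvd_add hN (Dvd.intro_left _ rfl)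

theorem field_point {B : Type} [Field B] [Algebra ℂ B] [Algebra.FiniteType ℂ B] : Nonempty (B →ₐ[ℂ] ℂ) := by
  have h2 : Module.Finite ℂ B := finite_of_finite_type_of_isJacobsonRing ℂ B
  exact ⟨IsAlgClosed.lift⟩

/-- points of finitely generated algebras -/
theorem alg_point {F : Type} [Field F] [Algebra ℂ F] (S : Set F) (hS : S.Finite) :
    Nonempty (Algebra.adjoin ℂ S →ₐ[ℂ] ℂ) := by
  let A := Algebra.adjoin ℂ S
  have hft : Algebra.FiniteType ℂ A := (Subalgebra.fg_iff_finiteType _).1 ⟨hS.toFinset, by simp [A]⟩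
  obtain ⟨m, hm⟩ := Ideal.exists_maximal A
  let : Field (A ⧸ m) := Ideal.Quotient.field m
  have h1 : Algebra.FiniteType ℂ (A ⧸ m) := inferInstance
  obtain ⟨f⟩ := field_point (B := A ⧸ m)
  exact ⟨f.comp (Ideal.Quotient.mkₐ ℂ m)⟩

theorem eval_strict {m : ℕ} (p : MvPolynomial (Fin m) ℂ) (z : Fin m → ℂ) :
    HasStrictFDerivAt (fun ζ : Fin m → ℂ => eval ζ p)
      (∑ i, (eval z (pderiv i p)) • (ContinuousLinearMap.proj i : (Fin m → ℂ) →L[ℂ] ℂ)) z := by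
  induction p using MvPolynomial.induction_on with
  | C a => 
    refine ((hasStrictFDerivAt_const (𝕜 := ℂ) a z).congr_fderiv ?_).congr_of_eventuallyEq (Filter.Eventually.of_forall fun ζ => ?_)
    · ext w; simp
    · simp
  | add p q hp hq =>
    have := hp.add hq
    refine (this.congr_fderiv ?_).congr_of_eventuallyEq (Filter.Eventually.of_forall fun ζ => ?_)
    · rw [← Finset.sum_add_distrib]
      exact Finset.sum_congr rfl fun i _ => by ext w; simp [add_mul]
    · simp
  | mul_X p i hp =>
    have h1 : HasStrictFDerivAt (fun ζ : Fin m → ℂ => ζ i) (ContinuousLinearMap.proj i : (Fin m → ℂ) →L[ℂ] ℂ) z := hasStrictFDerivAt_apply i z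
    have h2 := hp.mul h1
    simp only [map_mul, eval_X]
    refine h2.congr_fderiv ?_
    ext w
    simp [Derivation.leibniz, pderiv_X, Pi.single_apply, add_mul, Finset.sum_add_distrib, Finset.mul_sum, apply_ite (eval z)]
    simp only [mul_assoc]

end

section
open MvPolynomial

def dP {m : ℕ} (p : MvPolynomial (Fin m) ℂ) (z : Fin m → ℂ) : (Fin m → ℂ) →L[ℂ] ℂ :=
  ∑ i, (eval z (pderiv i p)) • (ContinuousLinearMap.proj i : (Fin m → ℂ) →L[ℂ] ℂ)

theorem dP_apply {m : ℕ} (p : MvPolynomial (Fin m) ℂ) (z v : Fin m → ℂ) : dP p z v = ∑ i, eval z (pderiv i p) * v i := by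
  simp [dP]

theorem log_strict {m : ℕ} (p : MvPolynomial (Fin m) ℂ) (z : Fin m → ℂ) (h : eval z p ≠ 0) :
    HasStrictFDerivAt (fun ζ : Fin m → ℂ => Complex.log ((eval z p)⁻¹ * eval ζ p)) ((eval z p)⁻¹ • dP p z) z := by
  have h1 : HasStrictFDerivAt (fun ζ : Fin m → ℂ => (eval z p)⁻¹ * eval ζ p) ((eval z p)⁻¹ • dP p z) z :=
    (eval_strict p z).const_mul _
  have h2 : (eval z p)⁻¹ * eval z p = 1 := inv_mul_cancel₀ h
  have h3 := h1.clog (by rw [h2]; exact Complex.one_mem_slitPlane)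
  refine h3.congr_fderiv ?_
  rw [h2]; simp

theorem open_map {n d : ℕ} (z0 : Fin (d + 1) → ℂ) (r s : Fin n → MvPolynomial (Fin (d + 1)) ℂ) (G l : MvPolynomial (Fin (d + 1)) ℂ)
    (u : Fin d → Fin n → ℂ) (hr : ∀ j, eval z0 (r j) ≠ 0) (hs : ∀ j, eval z0 (s j) ≠ 0) (hl : eval z0 l ≠ 0) (hG : eval z0 G = 0)
    (hinj : ∀ v, dP G z0 v = 0 → (∀ i, ∑ j, u i j * ((eval z0 (r j))⁻¹ * dP (r j) z0 v - (eval z0 (s j))⁻¹ * dP (s j) z0 v) = 0) → v = 0)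
    (δ : ℝ) (hδ : 0 < δ) : ∃ ρ : ℝ, 0 < ρ ∧ ∀ w : Fin d → ℂ, (∀ i, ‖w i‖ < ρ) → ∃ (ζ : Fin (d + 1) → ℂ) (lam : Fin n → ℂ),
      (∀ j, ‖lam j‖ < δ) ∧ (∀ i, ∑ j, u i j * lam j = w i) ∧ eval ζ G = 0 ∧ eval ζ l ≠ 0 ∧ (∀ j, eval ζ (r j) ≠ 0) ∧
      (∀ j, eval ζ (s j) ≠ 0) ∧ ∀ j, eval ζ (r j) / eval ζ (s j) = eval z0 (r j) / eval z0 (s j) * Complex.exp (lam j) := by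
  let lm : Fin n → (Fin (d + 1) → ℂ) → ℂ := fun j ζ => Complex.log ((eval z0 (r j))⁻¹ * eval ζ (r j)) - Complex.log ((eval z0 (s j))⁻¹ * eval ζ (s j))
  let dl : Fin n → (Fin (d + 1) → ℂ) →L[ℂ] ℂ := fun j => (eval z0 (r j))⁻¹ • dP (r j) z0 - (eval z0 (s j))⁻¹ • dP (s j) z0
  have hlm : ∀ j, HasStrictFDerivAt (lm j) (dl j) z0 := fun j => (log_strict _ _ (hr j)).sub (log_strict _ _ (hs j))
  let A : (Fin (d + 1) → ℂ) →L[ℂ] (Fin d → ℂ) := ContinuousLinearMap.pi fun i => ∑ j, u i j • dl j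
  let Ψ : (Fin (d + 1) → ℂ) → (Fin d → ℂ) × ℂ := fun ζ => (fun i => ∑ j, u i j * lm j ζ, eval ζ G)
  have hΨ : HasStrictFDerivAt Ψ (A.prod (dP G z0)) z0 := by
    refine HasStrictFDerivAt.prodMk (hasStrictFDerivAt_pi.2 fun i => ?_) (eval_strict G z0)
    exact HasStrictFDerivAt.fun_sum fun j _ => (hlm j).const_mul (u i j)
  have hΨ0 : Ψ z0 = (0, 0) := by
    simp only [Ψ, hG]
    congr 1
    funext i
    refine Finset.sum_eq_zero fun j _ => ?_
    simp only [lm, inv_mul_cancel₀ (hr j), inv_mul_cancel₀ (hs j)]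
    simp
  have hin : Function.Injective (A.prod (dP G z0)).toLinearMap := by
    rw [← LinearMap.ker_eq_bot, LinearMap.ker_eq_bot']
    intro v hv
    have hv' : (A v, dP G z0 v) = (0, 0) := hv
    rw [Prod.mk.injEq] at hv'
    refine hinj v hv'.2 fun i => ?_
    have := congrFun hv'.1 i
    rw [← (show (0 : Fin d → ℂ) i = 0 from rfl), ← this]
    simp [A, dl]
  have hsurj : Function.Surjective (A.prod (dP G z0)).toLinearMap :=
    (LinearMap.injective_iff_surjective_of_finrank_eq_finrank (by simp)).1 hin
  have hmap := hΨ.map_nhds_eq_of_surj (LinearMap.range_eq_top.2 hsurj)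
  have hc : ∀ p : MvPolynomial (Fin (d + 1)) ℂ, ContinuousAt (fun ζ => eval ζ p) z0 := fun p => (eval_strict p z0).continuousAt
  have hev : ∀ᶠ ζ in nhds z0, (∀ j, ‖lm j ζ‖ < δ) ∧ eval ζ l ≠ 0 ∧ (∀ j, eval ζ (r j) ≠ 0) ∧ (∀ j, eval ζ (s j) ≠ 0) := by
    refine Filter.Eventually.and ?_ (Filter.Eventually.and ((hc l).eventually_ne hl) (Filter.Eventually.and
      (Filter.eventually_all.2 fun j => (hc _).eventually_ne (hr j)) (Filter.eventually_all.2 fun j => (hc _).eventually_ne (hs j))))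
    refine Filter.eventually_all.2 fun j => ?_
    have h1 : ContinuousAt (fun ζ => ‖lm j ζ‖) z0 := (hlm j).continuousAt.norm
    refine h1.eventually_lt_const ?_
    simp only [lm, inv_mul_cancel₀ (hr j), inv_mul_cancel₀ (hs j)]
    simpa using hδ
  have him := Filter.image_mem_map (m := Ψ) hev
  rw [hmap, hΨ0] at him
  obtain ⟨ρ, hρ, hball⟩ := Metric.mem_nhds_iff.1 him
  refine ⟨ρ, hρ, fun w hw => ?_⟩
  have hmem : ((w, 0) : (Fin d → ℂ) × ℂ) ∈ Metric.ball ((0, 0) : (Fin d → ℂ) × ℂ) ρ := by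
    rw [Metric.mem_ball, Prod.dist_eq]
    simp only [dist_self, dist_zero_right]
    exact max_lt ((pi_norm_lt_iff hρ).2 hw) hρ
  obtain ⟨ζ, hζ, hζe⟩ := hball hmem
  obtain ⟨c1, c2, c3, c4⟩ := hζ
  have e := Prod.mk.inj hζe
  refine ⟨ζ, fun j => lm j ζ, c1, fun i => congrFun e.1 i, e.2, c2, c3, c4, fun j => ?_⟩
  simp only [lm]
  rw [Complex.exp_sub, Complex.exp_log (mul_ne_zero (inv_ne_zero (hr j)) (c3 j)), Complex.exp_log (mul_ne_zero (inv_ne_zero (hs j)) (c4 j))]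
  have := hr j
  have := hs j
  have := c4 j
  field_simp

end

section
open MvPolynomial

theorem clear_den {k : Type} [Field k] {n : ℕ} (r s : Fin n → k) (hr : ∀ l, r l ≠ 0) (hs : ∀ l, s l ≠ 0) (a : Fin n → ℤ) (E : ℕ)
    (hE : ∀ l, |a l| ≤ E) : ∏ l, (r l ^ ((E : ℤ) + a l).toNat * s l ^ ((E : ℤ) - a l).toNat) =
      (∏ l, (r l * s l) ^ E) * mon a (fun l => r l / s l) := by
  rw [mon, ← Finset.prod_mul_distrib]
  refine Finset.prod_congr rfl fun l _ => ?_
  have h1 := abs_le.1 (hE l)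
  rw [← zpow_natCast, ← zpow_natCast, Int.toNat_of_nonneg (by linarith), Int.toNat_of_nonneg (by linarith),
    zpow_add₀ (hr l), zpow_sub₀ (hs l), div_zpow, mul_pow, zpow_natCast, zpow_natCast]
  ring

theorem transfer {F : Type} [Field F] [Algebra ℂ F] {n m : ℕ} (z : Fin m → F) (r s : Fin n → MvPolynomial (Fin m) ℂ)
    (hr : ∀ l, aeval z (r l) ≠ 0) (hs : ∀ l, aeval z (s l) ≠ 0) (ζ : Fin m → ℂ) (hrζ : ∀ l, eval ζ (r l) ≠ 0) (hsζ : ∀ l, eval ζ (s l) ≠ 0)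
    (hker : ∀ g, aeval z g = 0 → eval ζ g = 0) {ι : Type} [Fintype ι] (γ : ι → ℂ) (a : ι → Fin n → ℤ)
    (h : ∑ j, γ j • mon (a j) (fun l => aeval z (r l) / aeval z (s l)) = 0) :
    ∑ j, γ j * mon (a j) (fun l => eval ζ (r l) / eval ζ (s l)) = 0 := by
  let E : ℕ := ∑ j, ∑ l, (a j l).natAbs
  have hE : ∀ j l, |a j l| ≤ E := by
    intro j l
    rw [Int.abs_eq_natAbs]
    have h1 : (a j l).natAbs ≤ ∑ l, (a j l).natAbs := Finset.single_le_sum (f := fun l => (a j l).natAbs) (fun _ _ => Nat.zero_le _) (Finset.mem_univ l)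
    have h2 : ∑ l, (a j l).natAbs ≤ E := Finset.single_le_sum (f := fun j => ∑ l, (a j l).natAbs) (fun _ _ => Nat.zero_le _) (Finset.mem_univ j)
    exact_mod_cast h1.trans h2
  let g : MvPolynomial (Fin m) ℂ := ∑ j, C (γ j) * ∏ l, (r l ^ ((E : ℤ) + a j l).toNat * s l ^ ((E : ℤ) - a j l).toNat)
  have hg : aeval z g = 0 := by
    have : aeval z g = (∏ l, (aeval z (r l) * aeval z (s l)) ^ E) * ∑ j, γ j • mon (a j) (fun l => aeval z (r l) / aeval z (s l)) := by
      simp only [g, map_sum, map_mul, map_prod, map_pow, aeval_C]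
      rw [Finset.mul_sum]
      refine Finset.sum_congr rfl fun j _ => ?_
      rw [clear_den _ _ hr hs (a j) E (hE j), Algebra.smul_def]; ring
    rw [this, h, mul_zero]
  have h1 := hker g hg
  have : eval ζ g = (∏ l, (eval ζ (r l) * eval ζ (s l)) ^ E) * ∑ j, γ j * mon (a j) (fun l => eval ζ (r l) / eval ζ (s l)) := by
      simp only [g, map_sum, map_mul, map_prod, map_pow, eval_C]
      rw [Finset.mul_sum]
      refine Finset.sum_congr rfl fun j _ => ?_
      rw [clear_den _ _ hrζ hsζ (a j) E (hE j)]; ring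
  rw [this] at h1
  exact (mul_eq_zero.1 h1).resolve_left (Finset.prod_ne_zero_iff.2 fun l _ => pow_ne_zero _ (mul_ne_zero (hrζ l) (hsζ l)))

theorem primitive {F : Type} [Field F] [Algebra ℂ F] {n d : ℕ} (x : Fin n → F) (hxt : IntermediateField.adjoin ℂ (Set.range x) = ⊤)
    (t : Fin d → F) (ht : IsTranscendenceBasis ℂ t) : ∃ y : F, ∀ f : F, ∃ r s : MvPolynomial (Fin (d + 1)) ℂ,
      f = aeval (Fin.cons y t : Fin (d + 1) → F) r / aeval (Fin.cons y t : Fin (d + 1) → F) s := by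
  let E := IntermediateField.adjoin ℂ (Set.range t)
  have halg : Algebra.IsAlgebraic E F := ht.isAlgebraic_field
  have htop : IntermediateField.adjoin E (Set.range x) = ⊤ := by
    rw [eq_top_iff]
    intro f _
    have h1 : f ∈ IntermediateField.adjoin ℂ (Set.range x) := by rw [hxt]; trivial
    have h2 : IntermediateField.adjoin ℂ (Set.range x) ≤ (IntermediateField.adjoin E (Set.range x)).restrictScalars ℂ := by
      rw [IntermediateField.adjoin_le_iff]
      exact IntermediateField.subset_adjoin E (Set.range x)
    exact h2 h1
  have hfin : FiniteDimensional E (IntermediateField.adjoin E (Set.range x)) := by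
    have : Finite (Set.range x) := inferInstance
    exact IntermediateField.finiteDimensional_adjoin fun y _ => (halg.isAlgebraic y).isIntegral
  have hfin' : FiniteDimensional E F := by
    rw [htop] at hfin
    exact (IntermediateField.topEquiv (F := E) (E := F)).toLinearEquiv.finiteDimensional
  obtain ⟨y, hy⟩ := Field.exists_primitive_element E F
  refine ⟨y, fun f => ?_⟩
  have h1 : f ∈ (IntermediateField.adjoin E {y}).restrictScalars ℂ := by rw [hy]; trivial
  rw [IntermediateField.adjoin_adjoin_left] at h1
  have h2 : Set.range t ∪ {y} = Set.range (Fin.cons y t : Fin (d + 1) → F) := by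
    rw [Fin.range_cons, Set.union_singleton]
  rw [h2, IntermediateField.mem_adjoin_range_iff] at h1
  exact h1

theorem rows_pick {F : Type} [Field F] {s d : ℕ} (M : Matrix (Fin s) (Fin d) F) (hM : ∀ τ, M.mulVec τ = 0 → τ = 0) :
    ∃ (c : Fin d → Fin s) (N : Matrix (Fin d) (Fin d) F), N * M.submatrix c id = 1 := by
  have h1 : M.rank = d := by
    have hinj : Function.Injective M.mulVecLin := by
      rw [← LinearMap.ker_eq_bot, LinearMap.ker_eq_bot']; exact hM
    rw [Matrix.rank, LinearMap.finrank_range_of_inj hinj]; simp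
  rw [Matrix.rank_eq_finrank_span_row] at h1
  obtain ⟨f, hf1, hf2, hf3⟩ := Submodule.exists_fun_fin_finrank_span_eq F (Set.range M.row)
  have : ∃ f : Fin d → Fin d → F, (∀ i, f i ∈ Set.range M.row) ∧ LinearIndependent F f := by
    revert f
    rw [h1]
    exact fun f a b c => ⟨f, a, c⟩
  obtain ⟨f, hf, hli⟩ := this
  choose c hc using hf
  refine ⟨c, (M.submatrix c id)⁻¹, ?_⟩
  have : f = (M.submatrix c id).row := by funext i; rw [← hc i]; rfl
  rw [this, Matrix.linearIndependent_rows_iff_isUnit] at hli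
  exact Matrix.nonsing_inv_mul _ ((Matrix.isUnit_iff_isUnit_det _).1 hli)

end

section
open MvPolynomial

theorem der_aeval {F : Type} [Field F] [Algebra ℂ F] {m : ℕ} (D : Derivation ℂ F F) (z : Fin m → F) (p : MvPolynomial (Fin m) ℂ) :
    D (aeval z p) = ∑ i, aeval z (pderiv i p) * D (z i) := by
  induction p using MvPolynomial.induction_on with
  | C a => simp
  | add p q hp hq => simp only [map_add, hp, hq, add_mul, Finset.sum_add_distrib]
  | mul_X p i hp =>
    simp only [map_mul, aeval_X, Derivation.leibniz, hp, smul_eq_mul, map_add, add_mul, Finset.sum_add_distrib, pderiv_X, Pi.single_apply,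
      apply_ite (aeval z), map_one, map_zero]
    simp [Finset.mul_sum]
    exact Finset.sum_congr rfl fun _ _ => by ring

theorem realize {F : Type} [Field F] [Algebra ℂ F] {n d s : ℕ} (x : Fin n → F) (hx : ∀ l, x l ≠ 0)
    (hxt : IntermediateField.adjoin ℂ (Set.range x) = ⊤) (t : Fin d → F) (ht : IsTranscendenceBasis ℂ t) (u : Fin s → Fin n → ℝ)
    (hinj : ∀ D : Derivation ℂ F F, (∀ i, ∑ l, algebraMap ℂ F (u i l : ℂ) * (D (x l) / x l) = 0) → D = 0) :
    ∃ (c : Fin d → Fin s) (X0 : (Fin n → ℤ) → ℂ), (∀ a, X0 a ≠ 0) ∧ ∀ δ > 0, ∃ ρ > 0, ∀ w : Fin d → ℂ, (∀ i, ‖w i‖ < ρ) →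
      ∃ lam : Fin n → ℂ, (∀ l, ‖lam l‖ < δ) ∧ (∀ i, ∑ l, (u (c i) l : ℂ) * lam l = w i) ∧
        ∀ {ι : Type} [Fintype ι] (γ : ι → ℂ) (a : ι → Fin n → ℤ), ∑ j, γ j • mon (a j) x = 0 →
          ∑ j, γ j * (X0 (a j) * Complex.exp (∑ l, (a j l : ℂ) * lam l)) = 0 := by
  classical
  obtain ⟨y, hy⟩ := primitive x hxt t ht
  let z : Fin (d + 1) → F := Fin.cons y t
  choose r' q' hrq' using hy
  let r : Fin n → MvPolynomial (Fin (d + 1)) ℂ := fun l => r' (x l)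
  let q : Fin n → MvPolynomial (Fin (d + 1)) ℂ := fun l => q' (x l)
  have hrq : ∀ l, x l = aeval z (r l) / aeval z (q l) := fun l => hrq' (x l)
  have hr : ∀ l, aeval z (r l) ≠ 0 := fun l h => hx l (by rw [hrq, h, zero_div])
  have hq : ∀ l, aeval z (q l) ≠ 0 := fun l h => hx l (by rw [hrq, h, div_zero])
  have hnai : ¬ AlgebraicIndependent ℂ z := by
    intro h
    have h1 := h.cardinalMk_le_trdeg
    rw [← ht.cardinalMk_eq_trdeg] at h1
    simp only [Cardinal.mk_fin, Nat.cast_le] at h1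
    omega
  obtain ⟨G, ℓ, hG, hℓ, hG0, hdiv⟩ := hypersurface z (by simpa [z] using ht.1) hnai
  have hD : ∀ j : Fin d, ∃ D : Derivation ℂ F F, ∀ i, D (t i) = if i = j then 1 else 0 := fun j => ext_trbasis t ht _
  choose D hD using hD
  -- logarithmic derivative matrix
  let M : Matrix (Fin s) (Fin d) F := fun i j => ∑ l, algebraMap ℂ F (u i l : ℂ) * (D j (x l) / x l)
  obtain ⟨c, N, hN⟩ := rows_pick M (by
    intro τ hτ
    let D' : Derivation ℂ F F := ∑ j, τ j • D j
    have hD' : ∀ f, D' f = ∑ j, τ j * D j f := by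
      intro f
      show Derivation.coeFnAddMonoidHom D' f = _
      simp [D', map_sum, Finset.sum_apply, Derivation.coeFnAddMonoidHom]
    have h0 : D' = 0 := hinj D' (by
      intro i
      have := congrFun hτ i
      simp only [Matrix.mulVec, dotProduct, M, Pi.zero_apply] at this
      rw [← this]
      simp only [hD', Finset.sum_mul, Finset.sum_div, Finset.mul_sum]
      rw [Finset.sum_comm]
      refine Finset.sum_congr rfl fun _ _ => Finset.sum_congr rfl fun _ _ => by ring)
    funext i
    have h1 := hD' (t i)
    rw [h0] at h1
    simpa [hD] using h1.symm)
  let S : Set F := Set.range z ∪ Set.range (fun l => (aeval z (r l))⁻¹) ∪ Set.range (fun l => (aeval z (q l))⁻¹) ∪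
    {(aeval z ℓ)⁻¹, (aeval z (pderiv 0 G))⁻¹} ∪ Set.range (fun j => D j y) ∪ Set.range (fun p : Fin d × Fin d => N p.1 p.2)
  have hSf : S.Finite := by
    refine Set.Finite.union (Set.Finite.union (Set.Finite.union (Set.Finite.union (Set.Finite.union ?_ ?_) ?_) ?_) ?_) ?_
    any_goals exact Set.finite_range _
    exact Set.toFinite _
  obtain ⟨φ⟩ := alg_point S hSf
  let A := Algebra.adjoin ℂ S
  have hSA : S ⊆ A := Algebra.subset_adjoin
  let zA : Fin (d + 1) → A := fun i => ⟨z i, hSA (by simp [S])⟩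
  let rA : Fin n → A := fun l => ⟨(aeval z (r l))⁻¹, hSA (by simp [S])⟩
  let qA : Fin n → A := fun l => ⟨(aeval z (q l))⁻¹, hSA (by simp [S])⟩
  let ℓA : A := ⟨(aeval z ℓ)⁻¹, hSA (by simp [S])⟩
  let gA : A := ⟨(aeval z (pderiv 0 G))⁻¹, hSA (by simp [S])⟩
  let YA : Fin d → A := fun j => ⟨D j y, hSA (by simp [S])⟩
  let NA : Fin d → Fin d → A := fun i j => ⟨N i j, hSA (Or.inr ⟨(i, j), rfl⟩)⟩
  let z0 : Fin (d + 1) → ℂ := fun i => φ (zA i)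
  have hcoe : ∀ p : MvPolynomial (Fin (d + 1)) ℂ, ((aeval zA p : A) : F) = aeval z p := by
    intro p
    have := MvPolynomial.aeval_algebraMap_apply (B := F) zA p
    exact this.symm
  have hφ : ∀ p : MvPolynomial (Fin (d + 1)) ℂ, φ (aeval zA p) = eval z0 p := by
    intro p
    have h1 := MvPolynomial.comp_aeval_apply (f := zA) φ p
    rw [h1, ← MvPolynomial.aeval_eq_eval]
  have inv_ne : ∀ (p : MvPolynomial (Fin (d + 1)) ℂ) (b : A), aeval z p ≠ 0 → (b : F) = (aeval z p)⁻¹ → eval z0 p * φ b = 1 := by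
    intro p b hp hb
    rw [← hφ, ← map_mul, ← map_one φ]
    congr 1
    apply Subtype.ext
    rw [MulMemClass.coe_mul, hcoe, hb, mul_inv_cancel₀ hp]; rfl
  have hr0 : ∀ l, eval z0 (r l) * φ (rA l) = 1 := fun l => inv_ne _ _ (hr l) rfl
  have hq0 : ∀ l, eval z0 (q l) * φ (qA l) = 1 := fun l => inv_ne _ _ (hq l) rfl
  have hℓ0 : eval z0 ℓ * φ ℓA = 1 := inv_ne _ _ hℓ rfl
  have hg0 : eval z0 (pderiv 0 G) * φ gA = 1 := inv_ne _ _ hG0 rfl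
  have nz : ∀ {a b : ℂ}, a * b = 1 → a ≠ 0 := fun h h0 => by simp [h0] at h
  have hGz0 : eval z0 G = 0 := by
    rw [← hφ, ← map_zero φ]
    congr 1
    exact Subtype.ext (by rw [hcoe, hG]; rfl)
  -- derivatives of the coordinates
  let DzA : Fin d → Fin (d + 1) → A := fun j => Fin.cons (YA j) (fun i => if i = j then 1 else 0)
  have hDz : ∀ j i, ((DzA j i : A) : F) = D j (z i) := by
    intro j i
    refine Fin.cases ?_ (fun i => ?_) i
    · simp [DzA, YA, z]
    · simp only [DzA, z, Fin.cons_succ, hD]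
      split_ifs <;> rfl
  let dA : Fin d → MvPolynomial (Fin (d + 1)) ℂ → A := fun j p => ∑ i, aeval zA (pderiv i p) * DzA j i
  have hdA : ∀ j p, ((dA j p : A) : F) = D j (aeval z p) := by
    intro j p
    rw [der_aeval]
    simp only [dA, AddSubmonoidClass.coe_finsetSum, MulMemClass.coe_mul, hcoe, hDz]
  let MA : Fin d → Fin d → A := fun i j => ∑ l, algebraMap ℂ A (u (c i) l : ℂ) * (rA l * dA j (r l) - qA l * dA j (q l))
  have hMA : ∀ i j, ((MA i j : A) : F) = M (c i) j := by
    intro i j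
    simp only [MA, M, AddSubmonoidClass.coe_finsetSum, MulMemClass.coe_mul, AddSubgroupClass.coe_sub, hdA]
    refine Finset.sum_congr rfl fun l _ => ?_
    congr 1
    rw [hrq l, Derivation.leibniz_div]
    have h1 := hr l
    have h2 := hq l
    simp only [rA, qA, smul_eq_mul]
    field_simp
  have hNM : ∀ i k, ∑ j, φ (NA i j) * φ (MA j k) = if i = k then 1 else 0 := by
    intro i k
    have h1 := congrFun (congrFun hN i) k
    rw [Matrix.mul_apply, Matrix.one_apply] at h1
    have h2 : ∑ j, NA i j * MA j k = if i = k then 1 else 0 := by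
      apply Subtype.ext
      simp only [AddSubmonoidClass.coe_finsetSum, MulMemClass.coe_mul, hMA]
      rw [apply_ite Subtype.val]
      exact h1
    rw [← map_one φ, ← map_zero φ, ← apply_ite φ, ← h2, map_sum]
    simp only [map_mul]
  refine ⟨c, fun a => mon a (fun l => eval z0 (r l) / eval z0 (q l)), fun a => mon_ne_zero (fun l => div_ne_zero (nz (hr0 l)) (nz (hq0 l))) a, ?_⟩
  intro δ hδ
  obtain ⟨ρ, hρ, H⟩ := open_map z0 r q G ℓ (fun i l => (u (c i) l : ℂ)) (fun l => nz (hr0 l)) (fun l => nz (hq0 l)) (nz hℓ0) hGz0 (by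
    intro v hv1 hv2
    have hv0 : ∀ i, v i = ∑ j : Fin d, v j.succ * φ (DzA j i) := by
      have hs : ∀ i : Fin d, v i.succ = ∑ j : Fin d, v j.succ * φ (DzA j i.succ) := by
        intro i
        simp [DzA, apply_ite φ]
      intro i
      refine Fin.cases ?_ hs i
      have h1 : ∀ j, ∑ i, eval z0 (pderiv i G) * φ (DzA j i) = 0 := by
        intro j
        have : dA j G = 0 := Subtype.ext (by rw [hdA, hG, map_zero]; rfl)
        rw [← map_zero φ, ← this]
        simp [dA, hφ]
      have h2 : ∑ i, eval z0 (pderiv i G) * (∑ j : Fin d, v j.succ * φ (DzA j i)) = 0 := by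
        simp only [Finset.mul_sum]
        rw [Finset.sum_comm]
        refine Finset.sum_eq_zero fun j _ => ?_
        have := congrArg (v j.succ * ·) (h1 j)
        simp only [mul_zero, Finset.mul_sum] at this
        rw [← this]
        exact Finset.sum_congr rfl fun _ _ => by ring
      rw [dP_apply] at hv1
      rw [Fin.sum_univ_succ] at hv1 h2
      have h3 : ∑ i : Fin d, eval z0 (pderiv i.succ G) * v i.succ = ∑ i : Fin d, eval z0 (pderiv i.succ G) * (∑ j : Fin d, v j.succ * φ (DzA j i.succ)) :=
        Finset.sum_congr rfl fun i _ => by rw [← hs i]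
      rw [h3] at hv1
      exact mul_left_cancel₀ (nz hg0) (add_right_cancel (hv1.trans h2.symm))
    have hdP : ∀ p, dP p z0 v = ∑ j : Fin d, v j.succ * φ (dA j p) := by
      intro p
      rw [dP_apply]
      have : ∀ i, eval z0 (pderiv i p) * v i = ∑ j : Fin d, v j.succ * (eval z0 (pderiv i p) * φ (DzA j i)) := by
        intro i
        conv_lhs => rw [hv0 i]
        rw [Finset.mul_sum]
        exact Finset.sum_congr rfl fun _ _ => by ring
      rw [Finset.sum_congr rfl fun i _ => this i, Finset.sum_comm]
      refine Finset.sum_congr rfl fun j _ => ?_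
      simp [dA, hφ, Finset.mul_sum]
    have hτ : ∀ i, ∑ j : Fin d, φ (MA i j) * v j.succ = 0 := by
      intro i
      rw [← hv2 i]
      have e1 : ∀ l, (eval z0 (r l))⁻¹ = φ (rA l) := fun l => inv_eq_of_mul_eq_one_right (hr0 l)
      have e2 : ∀ l, (eval z0 (q l))⁻¹ = φ (qA l) := fun l => inv_eq_of_mul_eq_one_right (hq0 l)
      simp only [e1, e2, hdP, MA, map_sum, map_mul, map_sub, Finset.mul_sum, Finset.sum_mul, ← Finset.sum_sub_distrib]
      rw [Finset.sum_comm]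
      refine Finset.sum_congr rfl fun l _ => Finset.sum_congr rfl fun j _ => ?_
      have e3 : φ (algebraMap ℂ A (u (c i) l : ℂ)) = (u (c i) l : ℂ) := φ.commutes _
      rw [e3]
      ring
    have hτ0 : ∀ k : Fin d, v k.succ = 0 := by
      intro k
      have h1 : ∑ i, φ (NA k i) * ∑ j : Fin d, φ (MA i j) * v j.succ = 0 := Finset.sum_eq_zero fun i _ => by rw [hτ i, mul_zero]
      simp only [Finset.mul_sum, ← mul_assoc] at h1
      rw [Finset.sum_comm] at h1
      simp only [← Finset.sum_mul, hNM] at h1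
      simpa using h1
    funext i
    rw [hv0 i]
    exact Finset.sum_eq_zero fun j _ => by rw [hτ0 j, zero_mul]) δ hδ
  refine ⟨ρ, hρ, fun w hw => ?_⟩
  obtain ⟨ζ, lam, c1, c2, c3, c4, c5, c6, c7⟩ := H w hw
  refine ⟨lam, c1, c2, ?_⟩
  intro ι _ γ a hγ
  have h1 := transfer z r q hr hq ζ c5 c6 (by
    intro g hg
    obtain ⟨m, b, hb⟩ := hdiv g hg
    have := congrArg (eval ζ) hb
    rw [map_mul, map_mul, c3, zero_mul, map_pow] at this
    exact (mul_eq_zero.1 this).resolve_left (pow_ne_zero _ c4)) γ a (by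
      rw [← hγ]
      exact Finset.sum_congr rfl fun j _ => by congr 2; funext l; exact (hrq l).symm)
  rw [← h1]
  refine Finset.sum_congr rfl fun j _ => ?_
  congr 1
  simp only [mon, Complex.exp_sum, ← Finset.prod_mul_distrib]
  refine Finset.prod_congr rfl fun l _ => ?_
  rw [c7 l, mul_zpow, ← Complex.exp_int_mul]

end

section
open MvPolynomial
open scoped TensorProduct

section
variable {k A : Type} [Field k] [Field A] [Algebra k A]

def Fdim (V : Submodule k A) (c : ℕ) : Prop := Module.Finite k V ∧ Module.finrank k V ≤ c

theorem Fdim.mul {V W : Submodule k A} {a b : ℕ} (hV : Fdim V a) (hW : Fdim W b) : Fdim (V * W) (a * b) := by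
  have := hV.1
  have := hW.1
  have h1 : Module.Finite k (V * W : Submodule k A) := by
    rw [← Submodule.mulMap_range]; infer_instance
  refine ⟨h1, ?_⟩
  have h2 : Module.finrank k (V * W : Submodule k A) ≤ Module.finrank k (V ⊗[k] W) := by
    rw [← Submodule.mulMap_range]
    exact LinearMap.finrank_range_le _
  rw [Module.finrank_tensorProduct] at h2
  exact h2.trans (Nat.mul_le_mul hV.2 hW.2)

theorem Fdim.one : Fdim (1 : Submodule k A) 1 := by
  rw [Submodule.one_eq_span]
  refine ⟨Module.Finite.span_of_finite _ (Set.finite_singleton _), ?_⟩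
  have := finrank_span_finset_le_card (R := k) ({1} : Finset A)
  rw [Finset.coe_singleton] at this
  exact this

theorem sub_prod_mem {ι : Type} (s : Finset ι) {V : ι → Submodule k A} {a : ι → A} (h : ∀ i ∈ s, a i ∈ V i) :
    ∏ i ∈ s, a i ∈ ∏ i ∈ s, V i := by
  classical
  induction s using Finset.induction_on with
  | empty => simp
  | insert i s hi ih =>
    rw [Finset.prod_insert hi, Finset.prod_insert hi]
    exact Submodule.mul_mem_mul (h i (Finset.mem_insert_self _ _)) (ih fun j hj => h j (Finset.mem_insert_of_mem hj))

theorem Fdim.prod {ι : Type} (s : Finset ι) {V : ι → Submodule k A} {a : ι → ℕ} (h : ∀ i ∈ s, Fdim (V i) (a i)) :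
    Fdim (∏ i ∈ s, V i) (∏ i ∈ s, a i) := by
  classical
  induction s using Finset.induction_on with
  | empty => simpa using Fdim.one
  | insert i s hi ih =>
    rw [Finset.prod_insert hi, Finset.prod_insert hi]
    exact (h i (Finset.mem_insert_self _ _)).mul (ih fun j hj => h j (Finset.mem_insert_of_mem hj))

theorem Fdim.mono {V W : Submodule k A} {a b : ℕ} (hW : Fdim W a) (h : V ≤ W) (hab : a ≤ b) : Fdim V b := by
  have := hW.1
  exact ⟨Submodule.finiteDimensional_of_le h, (Submodule.finrank_mono h).trans (hW.2.trans hab)⟩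

def powSp (t : A) (N : ℕ) : Submodule k A := Submodule.span k (Set.range fun j : Fin N => t ^ (j : ℕ))

theorem powSp_mem (t : A) {N j : ℕ} (h : j < N) : t ^ j ∈ (powSp t N : Submodule k A) := Submodule.subset_span ⟨⟨j, h⟩, rfl⟩

theorem powSp_dim (t : A) (N : ℕ) : Fdim (powSp t N : Submodule k A) N := by
  refine ⟨Module.Finite.span_of_finite _ (Set.finite_range _), ?_⟩
  have := finrank_range_le_card (R := k) (fun j : Fin N => t ^ (j : ℕ))
  rw [Fintype.card_fin] at this
  exact this

theorem powSp_pow (t : A) (N : ℕ) : ((powSp t 2 : Submodule k A)) ^ N ≤ powSp t (N + 1) := by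
  induction N with
  | zero =>
    rw [pow_zero, Submodule.one_le]
    have := powSp_mem (k := k) t (N := 1) (j := 0) (by omega)
    rwa [pow_zero] at this
  | succ N ih =>
    rw [pow_succ]
    refine (mul_le_mul' ih le_rfl).trans ?_
    rw [powSp, powSp, Submodule.span_mul_span, Submodule.span_le]
    rintro _ ⟨_, ⟨i, rfl⟩, _, ⟨j, rfl⟩, rfl⟩
    simp only [← pow_add]
    exact powSp_mem t (by omega)

/-- the polynomial filtration -/
def Vf {d : ℕ} (t : Fin d → A) : Submodule k A := ∏ i, powSp (t i) 2

theorem Vf_pow_dim {d : ℕ} (t : Fin d → A) (N : ℕ) : Fdim ((Vf t : Submodule k A) ^ N) ((N + 1) ^ d) := by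
  rw [Vf, ← Finset.prod_pow]
  have := Fdim.prod (k := k) Finset.univ (V := fun i => (powSp (t i) 2) ^ N) (a := fun _ => N + 1)
    (fun i _ => (powSp_dim (t i) (N + 1)).mono (powSp_pow _ _) le_rfl)
  simpa using this

theorem Vf_one {d : ℕ} (t : Fin d → A) : (1 : A) ∈ (Vf t : Submodule k A) := by
  rw [← Finset.prod_const_one (ι := Fin d) (s := Finset.univ)]
  exact sub_prod_mem _ fun i _ => by simpa using powSp_mem (k := k) (t i) (N := 2) (j := 0) (by omega)

theorem Vf_mono {d : ℕ} (t : Fin d → A) {M N : ℕ} (h : M ≤ N) : (Vf t : Submodule k A) ^ M ≤ (Vf t) ^ N :=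
  pow_le_pow_right' (Submodule.one_le.2 (Vf_one t)) h

theorem Vf_gen {d : ℕ} (t : Fin d → A) (i : Fin d) : t i ∈ (Vf t : Submodule k A) := by
  classical
  have : t i = ∏ j, t j ^ (if j = i then 1 else 0) := by simp
  rw [this]
  exact sub_prod_mem _ fun j _ => by
    split_ifs
    · exact powSp_mem (k := k) (t j) (N := 2) (j := 1) (by omega)
    · exact powSp_mem (k := k) (t j) (N := 2) (j := 0) (by omega)

theorem Vf_all {d : ℕ} (t : Fin d → A) (p : MvPolynomial (Fin d) k) : ∃ E, aeval t p ∈ (Vf t : Submodule k A) ^ E := by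
  induction p using MvPolynomial.induction_on with
  | C a => exact ⟨0, by rw [pow_zero, aeval_C, Submodule.mem_one]; exact ⟨a, rfl⟩⟩
  | add p q hp hq =>
    obtain ⟨E, hE⟩ := hp
    obtain ⟨E', hE'⟩ := hq
    exact ⟨max E E', by rw [map_add]; exact Submodule.add_mem _ (Vf_mono t (le_max_left _ _) hE) (Vf_mono t (le_max_right _ _) hE')⟩
  | mul_X p i hp =>
    obtain ⟨E, hE⟩ := hp
    exact ⟨E + 1, by rw [map_mul, aeval_X, pow_succ]; exact Submodule.mul_mem_mul hE (Vf_gen t i)⟩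

theorem alg_step {d : ℕ} (t : Fin d → A) (x : A) (hx : IsAlgebraic (Algebra.adjoin k (Set.range t)) x) :
    ∃ (ℓ : A) (E D : ℕ), ℓ ≠ 0 ∧ ℓ ∈ (Vf t : Submodule k A) ^ E ∧ ∀ m, ℓ ^ m * x ^ m ∈ (Vf t : Submodule k A) ^ (m * E) * powSp x D := by
  classical
  obtain ⟨H, hl, hH⟩ := alg_rel t x hx
  choose E hE using fun j => Vf_all (k := k) t (H.coeff j)
  let E0 := ∑ j ∈ Finset.range (H.natDegree + 1), E j
  have hE0 : ∀ j ≤ H.natDegree, aeval t (H.coeff j) ∈ (Vf t : Submodule k A) ^ E0 := fun j hj =>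
    Vf_mono t (Finset.single_le_sum (f := E) (fun _ _ => Nat.zero_le _) (Finset.mem_range.2 (by omega))) (hE j)
  set D := H.natDegree with hDdef
  have hD : D ≠ 0 := by
    intro h0
    rw [Polynomial.eq_C_of_natDegree_eq_zero h0, Polynomial.eval₂_C] at hH
    have : H.leadingCoeff = H.coeff 0 := by rw [Polynomial.leadingCoeff, ← hDdef, h0]
    rw [this] at hl
    exact hl hH
  let ℓ : A := aeval t H.leadingCoeff
  have hℓ : ℓ ∈ (Vf t : Submodule k A) ^ E0 := hE0 D le_rfl
  have key : ℓ * x ^ D ∈ (Vf t : Submodule k A) ^ E0 * powSp x D := by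
    rw [Polynomial.eval₂_eq_sum_range, Finset.sum_range_succ] at hH
    have h1 : ℓ * x ^ D = - ∑ j ∈ Finset.range D, aeval t (H.coeff j) * x ^ j := eq_neg_of_add_eq_zero_right hH
    rw [h1]
    refine Submodule.neg_mem _ (Submodule.sum_mem _ fun j hj => ?_)
    have := Finset.mem_range.1 hj
    exact Submodule.mul_mem_mul (hE0 j this.le) (powSp_mem x this)
  have hQ : ∀ q ∈ (powSp x D : Submodule k A), ℓ * x * q ∈ (Vf t : Submodule k A) ^ E0 * powSp x D := by
    intro q hq
    rw [powSp] at hq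
    induction hq using Submodule.span_induction with
    | mem q hq =>
      obtain ⟨j, rfl⟩ := hq
      simp only
      by_cases hj : (j : ℕ) + 1 = D
      · rw [mul_assoc, ← pow_succ', hj]; exact key
      · rw [mul_assoc, ← pow_succ']
        exact Submodule.mul_mem_mul hℓ (powSp_mem x (by omega))
    | zero => rw [mul_zero]; exact Submodule.zero_mem _
    | add a b _ _ ha hb => rw [mul_add]; exact Submodule.add_mem _ ha hb
    | smul c a _ ha => rw [mul_smul_comm]; exact Submodule.smul_mem _ _ ha
  refine ⟨ℓ, E0, D, hl, hℓ, fun m => ?_⟩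
  induction m with
  | zero =>
    have := powSp_mem (k := k) x (N := D) (j := 0) (by omega)
    simpa using this
  | succ m ih =>
    have h1 : ℓ ^ (m + 1) * x ^ (m + 1) = ℓ * x * (ℓ ^ m * x ^ m) := by ring
    rw [h1]
    generalize ℓ ^ m * x ^ m = y at ih
    induction ih using Submodule.mul_induction_on' with
    | mem_mul_mem a ha b hb =>
      have h2 : ℓ * x * (a * b) = a * (ℓ * x * b) := by ring
      rw [h2, Nat.succ_mul, pow_add, mul_assoc]
      exact Submodule.mul_mem_mul ha (hQ b hb)
    | add a _ b _ ha hb => rw [mul_add]; exact Submodule.add_mem _ ha hb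

theorem hilb {n d : ℕ} (t : Fin d → A) (x : Fin n → A) (hx0 : ∀ i, x i ≠ 0)
    (hx : ∀ i, IsAlgebraic (Algebra.adjoin k (Set.range t)) (x i)) :
    ∃ C : ℕ, ∀ R : ℕ, 1 ≤ R → Fdim (Submodule.span k {y : A | ∃ a : Fin n → ℤ, (∀ l, |a l| ≤ R) ∧ mon a x = y}) (C * R ^ d) := by
  classical
  choose ℓ E D hℓ0 hℓ hstep using fun i => alg_step (k := k) t (x i) (hx i)
  let T := ∑ i, 2 * E i
  refine ⟨(T + 1) ^ d * ∏ i, D i, fun R hR => ?_⟩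
  let g : A := ∏ i, (ℓ i ^ (2 * R) * x i ^ R)
  have hg : g ≠ 0 := Finset.prod_ne_zero_iff.2 fun i _ => mul_ne_zero (pow_ne_zero _ (hℓ0 i)) (pow_ne_zero _ (hx0 i))
  let W : Submodule k A := (Vf t) ^ (R * T) * ∏ i, powSp (x i) (D i)
  have hW : Fdim W ((R * T + 1) ^ d * ∏ i, D i) := (Vf_pow_dim t _).mul (Fdim.prod _ fun i _ => powSp_dim _ _)
  let m : A →ₗ[k] A := LinearMap.mulLeft k g
  have hminj : Function.Injective m := fun a b h => mul_left_cancel₀ hg h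
  have hle : Submodule.span k {y : A | ∃ a : Fin n → ℤ, (∀ l, |a l| ≤ R) ∧ mon a x = y} ≤ W.comap m := by
    rw [Submodule.span_le]
    rintro _ ⟨a, ha, rfl⟩
    show g * mon a x ∈ W
    have h1 : g * mon a x = ∏ i, (ℓ i ^ (2 * R - ((R : ℤ) + a i).toNat) * (ℓ i ^ ((R : ℤ) + a i).toNat * x i ^ ((R : ℤ) + a i).toNat)) := by
      rw [mon, ← Finset.prod_mul_distrib]
      refine Finset.prod_congr rfl fun i _ => ?_
      have h2 := abs_le.1 (ha i)
      have h3 : ((R : ℤ) + a i).toNat ≤ 2 * R := by omega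
      rw [← mul_assoc, ← pow_add, Nat.sub_add_cancel h3, mul_assoc]
      congr 1
      rw [← zpow_natCast (x i) (Int.toNat _), Int.toNat_of_nonneg (by linarith), zpow_add₀ (hx0 i), zpow_natCast]
    rw [h1]
    have h4 : W = ∏ i, ((Vf t : Submodule k A) ^ (R * (2 * E i)) * powSp (x i) (D i)) := by
      rw [Finset.prod_mul_distrib, Finset.prod_pow_eq_pow_sum, ← Finset.mul_sum]
    rw [h4]
    refine sub_prod_mem _ fun i _ => ?_
    have h2 := abs_le.1 (ha i)
    have h3 : ((R : ℤ) + a i).toNat ≤ 2 * R := by omega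
    have h5 := Submodule.mul_mem_mul (Submodule.pow_mem_pow _ (hℓ i) (2 * R - ((R : ℤ) + a i).toNat)) (hstep i ((R : ℤ) + a i).toNat)
    rw [← pow_mul, ← mul_assoc, ← pow_add] at h5
    have h6 : E i * (2 * R - ((R : ℤ) + a i).toNat) + ((R : ℤ) + a i).toNat * E i = R * (2 * E i) := by
      rw [mul_comm (E i), ← add_mul, Nat.sub_add_cancel h3]; ring
    rw [h6] at h5
    exact h5
  have hC : (R * T + 1) ^ d * ∏ i, D i ≤ (T + 1) ^ d * (∏ i, D i) * R ^ d := by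
    have : (R * T + 1) ^ d ≤ ((T + 1) * R) ^ d := Nat.pow_le_pow_left (by nlinarith) d
    rw [mul_pow] at this
    calc _ ≤ _ := Nat.mul_le_mul_right _ this
      _ = _ := by ring
  refine Fdim.mono ?_ hle hC
  have := hW.1
  let m' : W.comap m →ₗ[k] W := m.restrict fun y hy => hy
  have hm' : Function.Injective m' := fun a b h => Subtype.ext (hminj (congrArg Subtype.val h))
  exact ⟨Module.Finite.of_injective m' hm', (LinearMap.finrank_le_finrank_of_injective hm').trans hW.2⟩

end

section
open MvPolynomial

theorem place_top {E : Type} [Field E] (v : AbsoluteValue E ℝ) {I M : ℕ} (y : E) (f : Fin I → E) (top : Fin I)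
    (hz : ∀ i, top < i → f i = 0) (hrel : ∑ i : Fin I, y ^ ((i : ℕ) * M) * f i = 0) (ht : f top ≠ 0) (Q Bd : ℝ) (hQ : 1 ≤ Q) (hBd : 0 ≤ Bd)
    (hf : ∀ i, v (f i) ≤ Bd)
    (hs : ∀ (s : Finset (Fin I)) (g : Fin I → E) (b : ℝ), 0 ≤ b → (∀ i ∈ s, v (g i) ≤ b) → v (∑ i ∈ s, g i) ≤ Q * b) :
    (max 1 (v y)) ^ M * v (f top) ≤ Q * Bd := by
  classical
  rcases le_or_gt (v y) 1 with h | h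
  · rw [max_eq_left h, one_pow, one_mul]
    exact (hf top).trans (by nlinarith)
  rw [max_eq_right h.le]
  have h1 : y ^ ((top : ℕ) * M) * f top = - ∑ i ∈ Finset.univ.filter (fun i => i < top), y ^ ((i : ℕ) * M) * f i := by
    rw [eq_neg_iff_add_eq_zero, ← hrel]
    rw [← Finset.sum_filter_add_sum_filter_not Finset.univ (fun i => i < top), add_comm]
    congr 1
    rw [Finset.sum_eq_single top]
    · intro b hb hne
      have : ¬ b < top := (Finset.mem_filter.1 hb).2
      rw [hz b (lt_of_le_of_ne (not_lt.1 this) hne.symm), mul_zero]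
    · intro h; simp at h
  have hvy : 0 < v y := by linarith
  rcases Nat.eq_zero_or_pos (top : ℕ) with h0 | h0
  · exfalso
    apply ht
    have : Finset.univ.filter (fun i => i < top) = ∅ := by
      ext i
      simp only [Finset.mem_filter, Finset.mem_univ, true_and, Finset.notMem_empty, iff_false, not_lt]
      exact Fin.le_def.2 (by omega)
    rw [this, h0] at h1
    simpa using h1
  · have h2 : v (y ^ ((top : ℕ) * M) * f top) ≤ Q * (v y ^ (((top : ℕ) - 1) * M) * Bd) := by
      rw [h1, AbsoluteValue.map_neg]
      refine hs _ _ _ (by positivity) fun i hi => ?_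
      rw [map_mul, map_pow]
      have hi' : (i : ℕ) < top := (Finset.mem_filter.1 hi).2
      refine mul_le_mul (pow_le_pow_right₀ h.le (Nat.mul_le_mul_right _ (by omega))) (hf i) (apply_nonneg _ _) (by positivity)
    rw [map_mul, map_pow] at h2
    have h3 : (top : ℕ) * M = ((top : ℕ) - 1) * M + M := by
      conv_lhs => rw [← Nat.sub_add_cancel h0]
      ring
    rw [h3, pow_add] at h2
    have h4 : 0 < v y ^ (((top : ℕ) - 1) * M) := pow_pos hvy _
    refine le_of_mul_le_mul_left ?_ h4
    linarith

theorem one_le_prod_r {T : Type} (s : Finset T) (f : T → ℝ) (h : ∀ i, 1 ≤ f i) : 1 ≤ ∏ i ∈ s, f i := by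
  have := Finset.prod_le_prod (s := s) (f := fun _ => (1 : ℝ)) (g := f) (fun _ _ => zero_le_one) (fun i _ => h i)
  simpa using this

theorem le_prod_one {T : Type} [Fintype T] (f : T → ℝ) (h : ∀ i, 1 ≤ f i) (j : T) : f j ≤ ∏ i, f i := by
  classical
  rw [← Finset.mul_prod_erase Finset.univ f (Finset.mem_univ j)]
  exact le_mul_of_one_le_right (by linarith [h j]) (one_le_prod_r _ _ h)

theorem place_log {E : Type} [Field E] (v : AbsoluteValue E ℝ) {I M n : ℕ} {J : Type} [Fintype J] (p : Fin n → E) (hp : ∀ l, p l ≠ 0)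
    (a : J → Fin n → ℤ) (K : ℝ) (hK : ∀ j, Real.log (v (mon (a j) p)) ≤ K) (c c' : Fin I → J → E) (hc : ∀ i j, c i j = c' i j ∨ c i j = 0)
    (hc' : ∀ i j, c' i j ≠ 0)
    (l0 : Fin n) (top : Fin I)
    (hz : ∀ i, top < i → ∑ j, c i j * mon (a j) p = 0) (hrel : ∑ i : Fin I, p l0 ^ ((i : ℕ) * M) * ∑ j, c i j * mon (a j) p = 0)
    (ht : ∑ j, c top j * mon (a j) p ≠ 0) (Q Q' : ℝ) (hQ : 1 ≤ Q) (hQ' : 1 ≤ Q')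
    (hs : ∀ (s : Finset (Fin I)) (g : Fin I → E) (b : ℝ), 0 ≤ b → (∀ i ∈ s, v (g i) ≤ b) → v (∑ i ∈ s, g i) ≤ Q * b)
    (hs' : ∀ (g : J → E) (b : ℝ), 0 ≤ b → (∀ i, v (g i) ≤ b) → v (∑ i, g i) ≤ Q' * b) :
    M * Real.log (max 1 (v (p l0))) + Real.log (v (∑ j, c top j * mon (a j) p)) ≤
      K + ∑ i, ∑ j, Real.log (max 1 (v (c' i j))) + Real.log (Q * Q') := by
  let cc : ℝ := ∏ i, ∏ j, max 1 (v (c' i j))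
  have hcc : ∀ i j, v (c i j) ≤ cc := by
    intro i j
    have h1 : v (c i j) ≤ max 1 (v (c' i j)) := by
      rcases hc i j with h | h
      · rw [h]; exact le_max_right _ _
      · rw [h, map_zero]; positivity
    refine h1.trans ?_
    have h2 : max 1 (v (c' i j)) ≤ ∏ j, max 1 (v (c' i j)) :=
      le_prod_one (fun j => max 1 (v (c' i j))) (fun _ => le_max_left _ _) j
    have h3 : ∏ j, max 1 (v (c' i j)) ≤ cc :=
      le_prod_one (fun i => ∏ j, max 1 (v (c' i j))) (fun _ => one_le_prod_r _ _ fun _ => le_max_left _ _) i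
    exact h2.trans h3
  have hcc0 : 0 < cc := Finset.prod_pos fun _ _ => Finset.prod_pos fun _ _ => by positivity
  have hcl : Real.log cc = ∑ i, ∑ j, Real.log (max 1 (v (c' i j))) := by
    rw [Real.log_prod (fun i _ => (Finset.prod_pos fun _ _ => by positivity).ne')]
    refine Finset.sum_congr rfl fun i _ => ?_
    rw [Real.log_prod (fun i _ => by positivity)]
  have hf : ∀ i, v (∑ j, c i j * mon (a j) p) ≤ Q' * (cc * Real.exp K) := by
    intro i
    refine hs' _ _ (by positivity) fun j => ?_
    rw [map_mul]
    have h1 : 0 < v (mon (a j) p) := AbsoluteValue.pos _ (mon_ne_zero hp _)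
    refine mul_le_mul (hcc i j) ?_ h1.le hcc0.le
    rw [← Real.log_le_iff_le_exp h1]
    exact hK j
  have h1 := place_top v (p l0) (fun i => ∑ j, c i j * mon (a j) p) top hz hrel ht Q _ hQ (by positivity) hf hs
  have hvt : 0 < v (∑ j, c top j * mon (a j) p) := AbsoluteValue.pos _ ht
  have h2 := Real.log_le_log (by positivity) h1
  rw [Real.log_mul (by positivity) (by positivity), Real.log_pow, Real.log_mul (by positivity) (by positivity),
    Real.log_mul (by positivity) (by positivity), Real.log_mul (by positivity) (by positivity), Real.log_exp, hcl] at h2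
  rw [Real.log_mul (by positivity) (by positivity)]
  linarith

theorem sum_arch {E T : Type} [Field E] (v : AbsoluteValue E ℝ) (s : Finset T) (g : T → E) (b : ℝ) (h : ∀ i ∈ s, v (g i) ≤ b) :
    v (∑ i ∈ s, g i) ≤ s.card * b := by
  refine (v.sum_le s g).trans ?_
  have := Finset.sum_le_sum h
  simpa using this

theorem sum_na {E T : Type} [Field E] (v : AbsoluteValue E ℝ) (hv : ∀ y z, v (y + z) ≤ max (v y) (v z)) (s : Finset T) (g : T → E) (b : ℝ)
    (hb : 0 ≤ b) (h : ∀ i ∈ s, v (g i) ≤ b) : v (∑ i ∈ s, g i) ≤ b := by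
  classical
  induction s using Finset.induction_on with
  | empty => simpa using hb
  | insert i s hi ih =>
    rw [Finset.sum_insert hi]
    exact (hv _ _).trans (max_le (h i (Finset.mem_insert_self _ _)) (ih fun j hj => h j (Finset.mem_insert_of_mem hj)))

end

section
open MvPolynomial

theorem log_max_eq (x : ℝ) (hx : 0 < x) : Real.log (max 1 x) = (Real.log x + |Real.log x|) / 2 := by
  rcases le_total x 1 with h | h
  · rw [max_eq_left h, Real.log_one, abs_of_nonpos (Real.log_nonpos hx.le h)]; ring
  · rw [max_eq_right h, abs_of_nonneg (Real.log_nonneg h)]; ring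

theorem log_v_mon {E : Type} [Field E] (v : AbsoluteValue E ℝ) {n : ℕ} (p : Fin n → E) (hp : ∀ l, p l ≠ 0) (a : Fin n → ℤ) :
    Real.log (v (mon a p)) = ∑ l, (a l : ℝ) * Real.log (v (p l)) := by
  unfold mon
  rw [map_prod, Real.log_prod (fun l _ => (v.ne_zero_iff).2 (zpow_ne_zero _ (hp l)))]
  refine Finset.sum_congr rfl fun l _ => ?_
  rw [map_zpow₀, Real.log_zpow]

/-- the pairing with logarithms -/
def lamF {n : ℕ} (lam : Fin n → ℝ) : EuclideanSpace ℝ (Fin n) →ₗ[ℝ] ℝ where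
  toFun x := ∑ l, x l * lam l
  map_add' x y := by simp [add_mul, Finset.sum_add_distrib]
  map_smul' c x := by simp [Finset.mul_sum, mul_assoc]

theorem lamF_apply {n : ℕ} (lam : Fin n → ℝ) (x : EuclideanSpace ℝ (Fin n)) : lamF lam x = ∑ l, x l * lam l := rfl

/-- weighted sum of absolute values -/
def wSem {n : ℕ} {ι : Type} [Fintype ι] (w : ι → ℝ) (w0 : ∀ i, 0 ≤ w i) (lam : ι → Fin n → ℝ) :
    Seminorm ℝ (EuclideanSpace ℝ (Fin n)) :=
  Seminorm.of (fun x => (∑ i, w i * |lamF (lam i) x|) / 2)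
    (fun x y => by
      rw [← add_div, ← Finset.sum_add_distrib]
      refine div_le_div_of_nonneg_right (Finset.sum_le_sum fun i _ => ?_) (by norm_num)
      rw [← mul_add, map_add]
      exact mul_le_mul_of_nonneg_left (abs_add_le _ _) (w0 i))
    (fun c x => by
      simp only [map_smul, smul_eq_mul, abs_mul, Real.norm_eq_abs]
      rw [← mul_div_assoc, Finset.mul_sum]
      congr 1
      refine Finset.sum_congr rfl fun i _ => by ring)

theorem wSem_apply {n : ℕ} {ι : Type} [Fintype ι] (w : ι → ℝ) (w0 : ∀ i, 0 ≤ w i) (lam : ι → Fin n → ℝ)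
    (x : EuclideanSpace ℝ (Fin n)) : wSem w w0 lam x = (∑ i, w i * |lamF (lam i) x|) / 2 := rfl

theorem ht_point {n : ℕ} (P : TorusPt n) (S : Set (Fin n → ℤ)) (hS : ∀ b ∈ S, mon b (emb P) = 1) {J : Type} [Fintype J] [Nonempty J]
    (a : J → Fin n → ℤ) (y : J → EuclideanSpace ℝ (Fin n)) (hy : ∀ j, y j ∈ Submodule.span ℝ (cr '' S))
    (hay : ∀ j l, |(a j l : ℝ) - y j l| ≤ 1) {I : ℕ} (c c' : Fin n → Fin I → J → Qbar)
    (hc : ∀ l i j, c l i j = c' l i j ∨ c l i j = 0) (hc' : ∀ l i j, c' l i j ≠ 0) (top : Fin n → Fin I)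
    (hrel : ∀ l, ∑ i : Fin I, emb P l ^ ((i : ℕ) * (2 * n + 1)) * ∑ j, c l i j * mon (a j) (emb P) = 0)
    (hz : ∀ l i, top l < i → ∑ j, c l i j * mon (a j) (emb P) = 0)
    (ht : ∀ l, ∑ j, c l (top l) j * mon (a j) (emb P) ≠ 0) :
    ∃ N, HtSys P (∑ l, (∑ i, ∑ j, hB (c' l i j) + Real.log (I * Fintype.card J))) N := by
  classical
  let z : Fin n ⊕ Fin n ⊕ (Fin n × Fin I × J) → Qbar := Sum.elim (emb P)
    (Sum.elim (fun l => ∑ j, c l (top l) j * mon (a j) (emb P)) (fun q => c' q.1 q.2.1 q.2.2))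
  have hz0 : ∀ j, z j ≠ 0 := by
    rintro (l | l | q)
    · exact emb_ne P l
    · exact ht l
    · exact hc' _ _ _
  obtain ⟨G⟩ := places_exist z hz0
  let hfin : Fintype G.ι := G.fin
  let p : Fin n → G.E := fun l => ⟨emb P l, G.mem (Sum.inl l)⟩
  have hp : ∀ l, p l ≠ 0 := fun l h => emb_ne P l (congrArg Subtype.val h)
  have hcE : ∀ l i j, c l i j ∈ G.E := by
    intro l i j
    rcases hc l i j with h | h
    · rw [h]; exact G.mem (Sum.inr (Sum.inr (l, i, j)))
    · rw [h]; exact zero_mem _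
  let cE : Fin n → Fin I → J → G.E := fun l i j => ⟨c l i j, hcE l i j⟩
  let cE' : Fin n → Fin I → J → G.E := fun l i j => ⟨c' l i j, G.mem (Sum.inr (Sum.inr (l, i, j)))⟩
  have hmonp : ∀ b, ((mon b p : G.E) : Qbar) = mon b (emb P) := fun b => by
    have := mon_map (x := p) (G.E.val : G.E →+* Qbar) b
    exact this
  have hfE : ∀ l i, ((∑ j, cE l i j * mon (a j) p : G.E) : Qbar) = ∑ j, c l i j * mon (a j) (emb P) := by
    intro l i
    rw [AddSubmonoidClass.coe_finsetSum]
    refine Finset.sum_congr rfl fun j _ => ?_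
    rw [MulMemClass.coe_mul, hmonp]
  let lam : G.ι → Fin n → ℝ := fun i l => Real.log (G.v i (p l))
  have hlogmon : ∀ i b, Real.log (G.v i (mon b p)) = lamF (lam i) (cr b) := by
    intro i b
    rw [log_v_mon _ p hp, lamF_apply]; rfl
  have hspan : ∀ i, ∀ u ∈ Submodule.span ℝ (cr '' S), lamF (lam i) u = 0 := by
    intro i u hu
    have : Submodule.span ℝ (cr '' S) ≤ LinearMap.ker (lamF (lam i)) := by
      rw [Submodule.span_le]
      rintro _ ⟨b, hb, rfl⟩
      show lamF (lam i) (cr b) = 0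
      rw [← hlogmon]
      have : mon b p = 1 := Subtype.ext (by rw [hmonp, hS b hb]; rfl)
      rw [this, map_one, Real.log_one]
    exact this hu
  have hK : ∀ i j, Real.log (G.v i (mon (a j) p)) ≤ ∑ l, |lam i l| := by
    intro i j
    rw [hlogmon, ← sub_zero (lamF (lam i) (cr (a j))), ← hspan i _ (hy j), ← map_sub, lamF_apply]
    refine (le_abs_self _).trans ((Finset.abs_sum_le_sum_abs _ _).trans (Finset.sum_le_sum fun l _ => ?_))
    rw [abs_mul]
    have := mul_le_mul_of_nonneg_right (hay j l) (abs_nonneg (lam i l))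
    rw [one_mul] at this
    exact this
  have prodp : ∀ l, ∑ i, G.w i * lam i l = 0 := fun l => G.prod (Sum.inl l)
  have sumabs : ∀ l, ∑ i, G.w i * |lam i l| = 2 * ∑ i, G.w i * Real.log (max 1 (G.v i (p l))) := by
    intro l
    have : ∀ i, G.w i * Real.log (max 1 (G.v i (p l))) = (G.w i * lam i l + G.w i * |lam i l|) / 2 := fun i => by
      rw [log_max_eq _ (by simpa using hp l)]
      show _ * ((lam i l + |lam i l|) / 2) = _
      ring
    simp only [this]
    rw [← Finset.sum_div, Finset.sum_add_distrib, prodp]; ring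
  set η : Fin n → ℝ := fun l => ∑ i, G.w i * Real.log (max 1 (G.v i (p l))) with hη
  have hη0 : ∀ l, 0 ≤ η l := fun l => Finset.sum_nonneg fun i _ => mul_nonneg (G.w0 i) (Real.log_nonneg (le_max_left _ _))
  have hJ1 : (1 : ℝ) ≤ Fintype.card J := by exact_mod_cast Fintype.card_pos
  set Q0 : ℝ := Real.log (I * Fintype.card J) with hQ0
  have key : ∀ l i, (2 * n + 1 : ℕ) * Real.log (max 1 (G.v i (p l))) + Real.log (G.v i (∑ j, cE l (top l) j * mon (a j) p)) ≤
      ∑ l, |lam i l| + ∑ i', ∑ j, Real.log (max 1 (G.v i (cE' l i' j))) + (if i ∈ G.A then Q0 else 0) := by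
    intro l i
    have hI1 : (1 : ℝ) ≤ I := by
      have : 1 ≤ I := by have := (top l).2; omega
      exact_mod_cast this
    have a1 : ∀ i' j, cE l i' j = cE' l i' j ∨ cE l i' j = 0 := fun i' j => by
      rcases hc l i' j with h | h
      · exact Or.inl (Subtype.ext h)
      · exact Or.inr (Subtype.ext h)
    have a2 : ∀ i' j, cE' l i' j ≠ 0 := fun i' j h => hc' l i' j (congrArg Subtype.val h)
    have a3 : ∀ i', top l < i' → ∑ j, cE l i' j * mon (a j) p = 0 := fun i' h =>
      Subtype.ext (by rw [hfE, hz l i' h]; rfl)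
    have a4 : ∑ i' : Fin I, p l ^ ((i' : ℕ) * (2 * n + 1)) * ∑ j, cE l i' j * mon (a j) p = 0 := by
      apply Subtype.ext
      rw [AddSubmonoidClass.coe_finsetSum]
      refine Eq.trans (Finset.sum_congr rfl fun i' _ => ?_) (hrel l)
      rw [MulMemClass.coe_mul, hfE]; rfl
    have a5 : ∑ j, cE l (top l) j * mon (a j) p ≠ 0 := fun h => ht l (by rw [← hfE, h]; rfl)
    by_cases hi : i ∈ G.A
    · rw [if_pos hi]
      refine place_log (G.v i) p hp a _ (hK i) (cE l) (cE' l) a1 a2 l (top l) a3 a4 a5 I (Fintype.card J) hI1 hJ1 ?_ ?_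
      · intro s g b hb h
        refine (sum_arch _ s g b h).trans (mul_le_mul_of_nonneg_right ?_ hb)
        have := s.card_le_univ
        rw [Fintype.card_fin] at this
        exact_mod_cast this
      · intro g b hb h
        exact sum_arch _ Finset.univ g b fun i _ => h i
    · rw [if_neg hi]
      have := place_log (G.v i) p hp a _ (hK i) (cE l) (cE' l) a1 a2 l (top l) a3 a4 a5 1 1 le_rfl le_rfl
        (fun s g b hb h => by rw [one_mul]; exact sum_na _ (G.na i hi) s g b hb h)
        (fun g b hb h => by rw [one_mul]; exact sum_na _ (G.na i hi) _ g b hb fun i _ => h i)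
      rw [one_mul, Real.log_one] at this
      exact this
  have key2 : ∀ l, (2 * n + 1 : ℕ) * η l ≤ 2 * ∑ l', η l' + (∑ i, ∑ j, hB (c' l i j) + Q0) := by
    intro l
    have h1 := Finset.sum_le_sum (s := Finset.univ) fun i _ => mul_le_mul_of_nonneg_left (key l i) (G.w0 i)
    have e1 : ∑ i, G.w i * ((2 * n + 1 : ℕ) * Real.log (max 1 (G.v i (p l))) + Real.log (G.v i (∑ j, cE l (top l) j * mon (a j) p))) =
        (2 * n + 1 : ℕ) * η l := by
      simp only [mul_add, Finset.sum_add_distrib]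
      have := G.prod (Sum.inr (Sum.inl l))
      have e : (⟨z (Sum.inr (Sum.inl l)), G.mem (Sum.inr (Sum.inl l))⟩ : G.E) = ∑ j, cE l (top l) j * mon (a j) p :=
        Subtype.ext (hfE l (top l)).symm
      rw [e] at this
      rw [this, add_zero, hη, Finset.mul_sum]
      refine Finset.sum_congr rfl fun i _ => by ring
    have e2 : ∑ i, G.w i * (∑ l, |lam i l| + ∑ i', ∑ j, Real.log (max 1 (G.v i (cE' l i' j))) + (if i ∈ G.A then Q0 else 0)) ≤
        2 * ∑ l', η l' + (∑ i, ∑ j, hB (c' l i j) + Q0) := by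
      simp only [mul_add, Finset.sum_add_distrib]
      have f1 : ∑ i, G.w i * ∑ l, |lam i l| = 2 * ∑ l', η l' := by
        simp only [Finset.mul_sum]
        rw [Finset.sum_comm]
        refine Finset.sum_congr rfl fun l' _ => ?_
        rw [sumabs, Finset.mul_sum]
      have f2 : ∑ i, G.w i * ∑ i', ∑ j, Real.log (max 1 (G.v i (cE' l i' j))) ≤ ∑ i, ∑ j, hB (c' l i j) := by
        simp only [Finset.mul_sum]
        rw [Finset.sum_comm]
        refine Finset.sum_le_sum fun i' _ => ?_
        rw [Finset.sum_comm]
        refine Finset.sum_le_sum fun j _ => ?_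
        exact G.bound (Sum.inr (Sum.inr (l, i', j)))
      have f3 : ∑ i, G.w i * (if i ∈ G.A then Q0 else 0) = Q0 := by
        simp only [mul_ite, mul_zero]
        rw [Finset.sum_ite_mem, Finset.univ_inter, ← Finset.sum_mul, G.wA, one_mul]
      rw [f1, f3]; linarith
    rw [e1] at h1
    exact h1.trans e2
  have key3 : ∑ l, η l ≤ ∑ l, (∑ i, ∑ j, hB (c' l i j) + Q0) := by
    have h1 := Finset.sum_le_sum (s := Finset.univ) fun l _ => key2 l
    rw [← Finset.mul_sum, Finset.sum_add_distrib (f := fun _ => 2 * ∑ l', η l')] at h1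
    simp only [Finset.sum_const, Finset.card_univ, Fintype.card_fin, nsmul_eq_mul] at h1
    push_cast at h1
    linarith
  refine ⟨wSem G.w G.w0 lam, ?_, ?_, ?_⟩
  · intro b
    have h1 := G.height (Sum.elim b 0)
    have e1 : ∏ j, z j ^ (Sum.elim b 0 : _ → ℤ) j = mon b (emb P) := by
      rw [Fintype.prod_sum_type]; simp [z, mon]
    have e2 : ∏ j, (⟨z j, G.mem j⟩ : G.E) ^ (Sum.elim b 0 : _ → ℤ) j = mon b p := by
      rw [Fintype.prod_sum_type]; simp [z, mon, p]
    rw [e1, e2] at h1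
    refine h1.trans (le_of_eq ?_)
    rw [wSem_apply]
    have : ∀ i, G.w i * Real.log (max 1 (G.v i (mon b p))) = (∑ l, (b l : ℝ) * (G.w i * lam i l) + G.w i * |lamF (lam i) (cr b)|) / 2 := fun i => by
      rw [log_max_eq _ (by simpa using mon_ne_zero hp b), hlogmon]
      have : ∑ l, (b l : ℝ) * (G.w i * lam i l) = G.w i * lamF (lam i) (cr b) := by
        rw [lamF_apply, Finset.mul_sum]
        refine Finset.sum_congr rfl fun l _ => ?_
        rw [cr_apply]; ring
      rw [this]; ring
    simp only [this]
    rw [← Finset.sum_div, Finset.sum_add_distrib, Finset.sum_comm]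
    simp only [← Finset.mul_sum, prodp]
    simp
  · rintro b ⟨k, hk, hb⟩
    rw [wSem_apply]
    have : ∀ i, lamF (lam i) (cr b) = 0 := fun i => by
      rw [← hlogmon]
      have h1 : (mon b p) ^ k = 1 := Subtype.ext (by
        rw [SubmonoidClass.coe_pow, hmonp, hb]; rfl)
      have h2 : (G.v i (mon b p)) ^ k = 1 := by rw [← map_pow, h1, map_one]
      rw [(pow_eq_one_iff_of_nonneg (apply_nonneg _ _) (by omega)).1 h2, Real.log_one]
    simp [this]
  · intro l
    rw [wSem_apply]
    have : ∀ i, lamF (lam i) (EuclideanSpace.single l 1) = lam i l := fun i => by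
      rw [lamF_apply]; simp [Pi.single_apply]
    simp only [this]
    rw [sumabs]
    have := Finset.single_le_sum (f := η) (s := Finset.univ) (fun l _ => hη0 l) (Finset.mem_univ l)
    have h3 : (2 * ∑ i, G.w i * Real.log (max 1 (G.v i (p l)))) / 2 = η l := by rw [hη]; ring
    linarith

end

section
open MvPolynomial

theorem rel_exists {k A : Type} [Field k] [Field A] [Algebra k A] {n d : ℕ} (x : Fin n → A) (hx0 : ∀ i, x i ≠ 0) (C : ℕ)
    (hC : ∀ R : ℕ, 1 ≤ R → Fdim (Submodule.span k {y : A | ∃ a : Fin n → ℤ, (∀ l, |a l| ≤ R) ∧ mon a x = y}) (C * R ^ d))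
    {J : Type} [Fintype J] (a : J → Fin n → ℤ) (m c3 I M0 : ℕ) (hm : 1 ≤ m) (ha : ∀ j l, |a j l| ≤ (c3 * m : ℕ)) (hI : I * M0 ≤ m)
    (hIC : 4 * (C * (c3 + 1) ^ d) < 3 * I)
    (hdim : 3 * m ^ d ≤ 4 * Module.finrank k (Submodule.span k (Set.range fun j => mon (a j) x))) (l : Fin n) :
    ∃ (c : Fin I → J → k) (top : Fin I), (∑ i : Fin I, x l ^ ((i : ℕ) * M0) * ∑ j, algebraMap k A (c i j) * mon (a j) x = 0) ∧
      (∀ i, top < i → ∑ j, algebraMap k A (c i j) * mon (a j) x = 0) ∧ ∑ j, algebraMap k A (c top j) * mon (a j) x ≠ 0 := by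
  classical
  set V := Submodule.span k (Set.range fun j => mon (a j) x) with hV
  obtain ⟨hWf, hWd⟩ := hC ((c3 + 1) * m) (by nlinarith)
  set W := Submodule.span k {y : A | ∃ a : Fin n → ℤ, (∀ l, |a l| ≤ ((c3 + 1) * m : ℕ)) ∧ mon a x = y} with hW
  let T0 : (Fin I → V) →ₗ[k] A := ∑ i : Fin I, (LinearMap.mulLeft k (x l ^ ((i : ℕ) * M0))) ∘ₗ V.subtype ∘ₗ LinearMap.proj i
  have hT0 : ∀ f, T0 f = ∑ i : Fin I, x l ^ ((i : ℕ) * M0) * (f i : A) := by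
    intro f; simp [T0]
  have hmem : ∀ f, T0 f ∈ W := by
    intro f
    rw [hT0]
    refine Submodule.sum_mem _ fun i _ => ?_
    have hle : V ≤ W.comap (LinearMap.mulLeft k (x l ^ ((i : ℕ) * M0))) := by
      rw [hV, Submodule.span_le]
      rintro _ ⟨j, rfl⟩
      show x l ^ ((i : ℕ) * M0) * mon (a j) x ∈ W
      refine Submodule.subset_span ⟨(((i : ℕ) * M0 : ℕ) : ℤ) • Pi.single l 1 + a j, ?_, ?_⟩
      · intro l'
        have h1 : (((i : ℕ) * M0 : ℕ) : ℤ) ≤ m := by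
          have : (i : ℕ) * M0 ≤ I * M0 := Nat.mul_le_mul_right _ i.2.le
          exact_mod_cast this.trans hI
        have h2 := ha j l'
        have h3 : |((((i : ℕ) * M0 : ℕ) : ℤ) • (Pi.single l 1 : Fin n → ℤ)) l'| ≤ m := by
          by_cases h : l' = l
          · subst h
            rw [Pi.smul_apply, Pi.single_eq_same, smul_eq_mul, mul_one, abs_of_nonneg (by positivity)]; exact h1
          · simp [Pi.single_eq_of_ne h]
        rw [Pi.add_apply]
        refine (abs_add_le _ _).trans ?_
        push_cast at h2 h3 ⊢
        linarith
      · rw [mon_add hx0, mon_zsmul, mon_single, zpow_natCast]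
    exact hle (f i).2
  let T : (Fin I → V) →ₗ[k] W := T0.codRestrict W hmem
  have hni : ¬ Function.Injective T := by
    intro h
    have h1 := LinearMap.finrank_le_finrank_of_injective h
    have hVf : Module.Finite k V := Module.Finite.span_of_finite k (Set.finite_range _)
    rw [Module.finrank_pi_fintype] at h1
    simp only [Finset.sum_const, Finset.card_univ, Fintype.card_fin, smul_eq_mul] at h1
    have h2 : 0 < m ^ d := by positivity
    have h3 := h1.trans hWd
    rw [mul_pow, ← mul_assoc] at h3
    have h4 : I * (3 * m ^ d) ≤ I * (4 * Module.finrank k V) := Nat.mul_le_mul_left _ hdim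
    have h5 : 4 * (C * (c3 + 1) ^ d) * m ^ d < 3 * I * m ^ d := Nat.mul_lt_mul_of_pos_right hIC h2
    nlinarith
  rw [← LinearMap.ker_eq_bot, Submodule.eq_bot_iff] at hni
  push Not at hni
  obtain ⟨f, hf, hf0⟩ := hni
  have hf1 : ∑ i : Fin I, x l ^ ((i : ℕ) * M0) * (f i : A) = 0 := by
    rw [← hT0]; exact congrArg Subtype.val (LinearMap.mem_ker.1 hf)
  have hex : ∀ i, ∃ c : J → k, ∑ j, c j • mon (a j) x = (f i : A) := fun i =>
    (Submodule.mem_span_range_iff_exists_fun k).1 (f i).2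
  choose c hc using hex
  have hc1 : ∀ i, ∑ j, algebraMap k A (c i j) * mon (a j) x = (f i : A) := fun i => by
    rw [← hc i]; exact Finset.sum_congr rfl fun j _ => (Algebra.smul_def _ _).symm
  obtain ⟨i0, hi0⟩ : ∃ i, f i ≠ 0 := by
    by_contra h; push Not at h; exact hf0 (funext h)
  let s := Finset.univ.filter fun i => f i ≠ 0
  have hs : s.Nonempty := ⟨i0, by simp [s, hi0]⟩
  refine ⟨c, s.max' hs, ?_, ?_, ?_⟩
  · simp only [hc1]; exact hf1
  · intro i hi
    rw [hc1]
    by_contra h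
    have : i ∈ s := by
      simp only [s, Finset.mem_filter, Finset.mem_univ, true_and]
      intro h'; exact h (by rw [h']; rfl)
    exact absurd (s.le_max' i this) (not_le.2 hi)
  · rw [hc1]
    have := s.max'_mem hs
    simp only [s, Finset.mem_filter, Finset.mem_univ, true_and] at this
    exact fun h => this (Subtype.ext h)

theorem rank_descent {U : Ultrafilter ℕ} {k K J : Type} [Fintype J] [Field k] [Field K] (σ : k →+* K) (y : J → Ult U k) :
    Module.finrank K (Submodule.span K (Set.range fun j => Ult.map σ (y j))) ≤
      Module.finrank k (Submodule.span k (Set.range y)) := by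
  classical
  have : Module.Finite k (Submodule.span k (Set.range y)) := Module.Finite.span_of_finite k (Set.finite_range y)
  let b := Module.finBasis k (Submodule.span k (Set.range y))
  let g : Fin (Module.finrank k (Submodule.span k (Set.range y))) → Ult U K := fun i => Ult.map σ (b i : Ult U k)
  have hle : Submodule.span K (Set.range fun j => Ult.map σ (y j)) ≤ Submodule.span K (Set.range g) := by
    rw [Submodule.span_le]
    rintro _ ⟨j, rfl⟩
    have hyj : y j ∈ Submodule.span k (Set.range y) := Submodule.subset_span ⟨j, rfl⟩
    have h1 := b.sum_repr ⟨y j, hyj⟩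
    have h2 : _ = y j := congrArg Subtype.val h1
    rw [AddSubmonoidClass.coe_finsetSum] at h2
    show Ult.map σ (y j) ∈ _
    have h3 : Ult.map σ (y j) = ∑ i, σ (b.repr ⟨y j, hyj⟩ i) • g i := by
      refine Eq.trans (congrArg (Ult.map σ) h2.symm) ?_
      rw [map_sum]
      refine Finset.sum_congr rfl fun i _ => ?_
      rw [Submodule.coe_smul, Algebra.smul_def, Algebra.smul_def, map_mul]
      rfl
    rw [h3]
    exact Submodule.sum_mem _ fun i _ => Submodule.smul_mem _ _ (Submodule.subset_span ⟨i, rfl⟩)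
  have : Module.Finite K (Submodule.span K (Set.range g)) := Module.Finite.span_of_finite K (Set.finite_range g)
  refine (Submodule.finrank_mono hle).trans ?_
  have := finrank_range_le_card (R := K) g
  simpa [Set.finrank] using this

end

section
open MvPolynomial

theorem field_setup {U : Ultrafilter ℕ} {n d : ℕ} (xs : Fin n → Ult U Qbar) (e : Fin d → Fin n)
    (he : AlgebraicIndependent Qbar (fun i => xs (e i)))
    (halg : ∀ i, IsAlgebraic (Algebra.adjoin Qbar (Set.range fun j => xs (e j))) (xs i)) (σ : Qbar →+* ℂ) :
    ∃ (F : IntermediateField ℂ (Ult U ℂ)) (x : Fin n → F), (∀ l, (x l : Ult U ℂ) = Ult.map σ (xs l)) ∧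
      IntermediateField.adjoin ℂ (Set.range x) = ⊤ ∧ IsTranscendenceBasis ℂ (fun i => x (e i)) := by
  classical
  let F := IntermediateField.adjoin ℂ (Set.range fun l => Ult.map σ (xs l))
  let x : Fin n → F := fun l => ⟨Ult.map σ (xs l), IntermediateField.subset_adjoin _ _ ⟨l, rfl⟩⟩
  have htop : IntermediateField.adjoin ℂ (Set.range x) = ⊤ := by
    apply IntermediateField.map_injective F.val
    rw [IntermediateField.adjoin_map, ← Set.range_comp, ← AlgHom.fieldRange_eq_map, IntermediateField.fieldRange_val]
    rfl
  have hai : AlgebraicIndependent ℂ (fun i => x (e i)) := by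
    have h1 := descent_ai σ (fun i => xs (e i)) he
    exact (F.val.algebraicIndependent_iff F.val.injective).1 h1
  have hxalg : ∀ l, IsAlgebraic (Algebra.adjoin ℂ (Set.range fun i => x (e i))) (x l) := by
    intro l
    by_contra htr
    have h1 := (hai.option_iff_transcendental (x l)).2 htr
    have h2 : ¬ AlgebraicIndependent Qbar (fun o : Option (Fin d) => o.elim (xs l) fun i => xs (e i)) := fun h =>
      (he.option_iff_transcendental (xs l)).1 h (halg l)
    rw [algebraicIndependent_iff] at h1 h2
    push Not at h2
    obtain ⟨p, hp, hp0⟩ := h2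
    apply hp0
    have h3 := h1 (MvPolynomial.map σ p) (by
      apply (show Function.Injective F.val from F.val.injective)
      rw [map_zero, MvPolynomial.comp_aeval_apply, MvPolynomial.aeval_def, MvPolynomial.eval₂_map]
      have h4 := congrArg (Ult.map σ) hp
      rw [map_zero, MvPolynomial.aeval_def, MvPolynomial.hom_eval₂] at h4
      rw [← h4]
      congr 1
      funext o
      cases o <;> rfl)
    exact MvPolynomial.map_injective σ σ.injective (by rw [h3, map_zero])
  refine ⟨F, x, fun l => rfl, htop, ?_⟩
  rw [hai.isTranscendenceBasis_iff_isAlgebraic]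
  rw [← IntermediateField.isAlgebraic_adjoin_iff_top]
  let k' := IntermediateField.adjoin ℂ (Set.range fun i => x (e i))
  have hle : (⊤ : IntermediateField ℂ F) ≤ (algebraicClosure k' F).restrictScalars ℂ := by
    rw [← htop, IntermediateField.adjoin_le_iff]
    rintro _ ⟨l, rfl⟩
    show x l ∈ algebraicClosure k' F
    rw [mem_algebraicClosure_iff]
    exact IntermediateField.isAlgebraic_adjoin_iff.2 (hxalg l)
  refine ⟨fun z => ?_⟩
  have : z ∈ algebraicClosure k' F := hle (IntermediateField.mem_top)
  exact mem_algebraicClosure_iff.1 this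

theorem d_pos {n d : ℕ} (P : ℕ → TorusPt n) (hP : Function.Injective P) (xs : Fin n → Ult (Filter.hyperfilter ℕ) Qbar)
    (hxs : xs = fun i => Ult.mk (Filter.hyperfilter ℕ) (fun k => emb (P k) i)) (e : Fin d → Fin n)
    (halg : ∀ i, IsAlgebraic (Algebra.adjoin Qbar (Set.range fun j => xs (e j))) (xs i)) : 1 ≤ d := by
  classical
  by_contra hd
  obtain rfl : d = 0 := by omega
  have h1 : ∀ i, ∃ c : Qbar, ∀ᶠ k in (Filter.hyperfilter ℕ : Filter ℕ), emb (P k) i = c := by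
    intro i
    have h2 : IsAlgebraic Qbar (xs i) := by
      have := IntermediateField.isAlgebraic_adjoin_iff.2 (halg i)
      rw [Set.range_eq_empty, IntermediateField.adjoin_empty] at this
      obtain ⟨p, hp0, hp⟩ := this
      exact IsAlgebraic.restrictScalars (R := Qbar) (S := (⊥ : IntermediateField Qbar (Ult (Filter.hyperfilter ℕ) Qbar))) ⟨p, hp0, hp⟩
    have h3 := IntermediateField.isAlgebraic_adjoin_simple h2.isIntegral
    obtain ⟨c, hc⟩ := IsAlgClosed.algebraMap_bijective_of_isIntegral (k := Qbar) (K := IntermediateField.adjoin Qbar {xs i}) |>.2 ⟨xs i, IntermediateField.mem_adjoin_simple_self _ _⟩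
    refine ⟨c, ?_⟩
    have h4 : algebraMap Qbar _ c = xs i := congrArg Subtype.val hc
    rw [Ult.algebraMap_eq, hxs, eq_comm, Ult.mk_eq] at h4
    exact h4
  choose c hc using h1
  have h2 : ∀ᶠ k in (Filter.hyperfilter ℕ : Filter ℕ), ∀ i, emb (P k) i = c i := Filter.eventually_all.2 hc
  obtain ⟨k0, hk0⟩ := h2.exists
  have h3 : ∀ᶠ k in (Filter.hyperfilter ℕ : Filter ℕ), k = k0 := by
    filter_upwards [h2] with k hk
    apply hP
    funext i
    exact Units.ext ((hk i).trans (hk0 i).symm)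
  have h4 : ({k0} : Set ℕ)ᶜ ∈ Filter.hyperfilter ℕ := (Set.finite_singleton k0).compl_mem_hyperfilter
  obtain ⟨k, hk, hk'⟩ := (h3.and h4).exists
  exact hk' hk

end

section
open MvPolynomial

theorem round_bounds {n d s m q : ℕ} (hm : 1 ≤ m) (u u' : Fin s → EuclideanSpace ℝ (Fin n)) (hu : ∀ i, ‖u i‖ = 1) (c : Fin d → Fin s)
    (j : Fin d → Fin m) (l : Fin n) :
    |round ((q : ℝ) * ∑ i, (j i : ℝ) * u (c i) l)| ≤ (((q * d + 1) * m : ℕ) : ℤ) ∧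
    ∀ ε : ℝ, (∀ i, ‖u i - u' i‖ < ε) → (q * d * m + 1) * ε ≤ 1 / 2 →
      |((round ((q : ℝ) * ∑ i, (j i : ℝ) * u (c i) l) : ℤ) : ℝ) - ((q : ℝ) • ∑ i, (j i : ℝ) • u' (c i)) l| ≤ 1 := by
  have hj : ∀ i, (j i : ℝ) ≤ m := fun i => by exact_mod_cast (j i).2.le
  have hj0 : ∀ i, (0:ℝ) ≤ (j i : ℝ) := fun i => by positivity
  have hr := abs_sub_round ((q : ℝ) * ∑ i, (j i : ℝ) * u (c i) l)
  have hm' : (1 : ℝ) ≤ m := by exact_mod_cast hm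
  have gen : ∀ (b : ℝ) (v : Fin s → EuclideanSpace ℝ (Fin n)), (∀ i, ‖v i‖ ≤ b) → |(q : ℝ) * ∑ i, (j i : ℝ) * v (c i) l| ≤ q * (d * (m * b)) := by
    intro b v hv
    rw [abs_mul, abs_of_nonneg (by positivity : (0:ℝ) ≤ q)]
    refine mul_le_mul_of_nonneg_left ?_ (by positivity)
    refine (Finset.abs_sum_le_sum_abs _ _).trans ((Finset.sum_le_sum (g := fun _ => m * b) fun i _ => ?_).trans (by simp))
    rw [abs_mul, abs_of_nonneg (hj0 i)]
    have : |v (c i) l| ≤ b := (PiLp.norm_apply_le (v (c i)) l).trans (hv _)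
    exact mul_le_mul (hj i) this (abs_nonneg _) (by positivity)
  constructor
  · have h1 := gen 1 u fun i => (hu i).le
    have h2 : |((round ((q : ℝ) * ∑ i, (j i : ℝ) * u (c i) l) : ℤ) : ℝ)| ≤ (q * d + 1) * m := by
      rw [abs_le] at h1 hr ⊢
      constructor <;> nlinarith
    exact_mod_cast h2
  · intro ε hε hε2
    have h1 := gen ε (fun i => u i - u' i) fun i => (hε i).le
    have h3 : (q : ℝ) * ∑ i, (j i : ℝ) * (u (c i) - u' (c i)) l = (q : ℝ) * ∑ i, (j i : ℝ) * u (c i) l -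
        ((q : ℝ) • ∑ i, (j i : ℝ) • u' (c i)) l := by
      have : ((q : ℝ) • ∑ i, (j i : ℝ) • u' (c i)) l = (q : ℝ) * ∑ i, (j i : ℝ) * u' (c i) l := by
        simp
      rw [this, ← mul_sub, ← Finset.sum_sub_distrib]
      congr 1
      refine Finset.sum_congr rfl fun i _ => ?_
      rw [PiLp.sub_apply]; ring
    rw [h3] at h1
    have hε0 : 0 ≤ ε ∨ d = 0 := by
      rcases Nat.eq_zero_or_pos d with h | h
      · exact Or.inr h
      · exact Or.inl ((norm_nonneg _).trans (hε (c ⟨0, h⟩)).le)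
    have h4 : (q : ℝ) * (d * (m * ε)) ≤ 1 / 2 := by
      rcases hε0 with h | h
      · nlinarith
      · subst h; norm_num
    rw [abs_le] at h1 hr ⊢
    constructor <;> linarith

theorem main_core {n s : ℕ} (L : IntermediateField ℚ Qbar) (hL : HasBogomolov L) {X : Set (TorusPt n)} (hX : ZClosed X)
    (P : ℕ → TorusPt n) (hinj : Function.Injective P) (hP : ∀ k, P k ∈ X)
    (hPL : ∀ k i, emb (P k) i ∈ L) (H : ℕ → Set (TorusPt n)) (hH : ∀ k, IsAlgSubgroup (H k))
    (hHc : ∀ k, ZConnected (H k)) (hHs : ∀ k, s + zdim (H k) ≤ n) (hPH : ∀ k, P k ∈ H k) :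
    ∃ k, ∃ Y, IsAnomalous X Y s ∧ P k ∈ Y := by
  classical
  let U : Ultrafilter ℕ := Filter.hyperfilter ℕ
  let xs : Fin n → Ult U Qbar := fun i => Ult.mk U (fun k => emb (P k) i)
  have hxs : xs = fun i => Ult.mk U (fun k => emb (P k) i) := rfl
  have hxs0 : ∀ i, xs i ≠ 0 := fun i => Ult.mk_ne_zero.mpr (Filter.Eventually.of_forall fun k => emb_ne _ _)
  obtain ⟨d, e, he, halg⟩ := alg_sub (k := Qbar) xs
  have hd : 1 ≤ d := d_pos P hinj xs hxs e halg
  let σ : Qbar →+* ℂ := (IsAlgClosed.lift (R := ℚ) (S := Qbar) (M := ℂ) : Qbar →ₐ[ℚ] ℂ)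
  obtain ⟨F, x, hxF, hxtop, htb⟩ := field_setup xs e he halg σ
  have hx0 : ∀ l, x l ≠ 0 := by
    intro l h0
    have := hxF l
    rw [h0] at this
    exact (map_ne_zero (Ult.map σ)).2 (hxs0 l) this.symm
  let S : ℕ → Set (Fin n → ℤ) := fun k => {a | LamH (H k) a}
  obtain ⟨u, huo, hu⟩ := frame (r := s) U S (Filter.Eventually.of_forall fun k => LamH_rank (hH k) (hHs k))
  let uu : Fin s → Fin n → ℝ := fun i l => u i l
  have hli : LinearIndependent ℝ uu := by
    have h1 := huo.linearIndependent
    exact h1.map' ((WithLp.linearEquiv 2 ℝ (Fin n → ℝ)).toLinearMap) (LinearEquiv.ker _)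
  by_cases hder : ∀ D : Derivation ℂ F F, (∀ i, ∑ l, algebraMap ℂ F (uu i l : ℂ) * (D (x l) / x l) = 0) → D = 0
  swap
  · push Not at hder
    obtain ⟨D, hD, hD0⟩ := hder
    refine case2a U hX P hP xs hxs e he σ F x hxF htb (fun i l => (uu i l : ℂ)) ?_ D hD0 hD
    rw [Fintype.linearIndependent_iff]
    intro g hg i
    refine congrFun (li_ext Complex.ofRealHom uu hli g fun l => ?_) i
    have := congrFun hg l
    simpa using this
  obtain ⟨c, X0, hX0, hre⟩ := realize x hx0 hxtop (fun i => x (e i)) htb uu hder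
  obtain ⟨q, hq, hdft⟩ := dft_apply uu c (fun a => mon a x) X0 hX0 hre
  obtain ⟨C, hC⟩ := hilb (k := Qbar) (fun i => xs (e i)) xs hxs0 halg
  set c3 := q * d + 1 with hc3
  set I := 2 * (C * (c3 + 1) ^ d) + 1 with hI
  set m := I * (2 * n + 1) with hm
  have hm1 : 1 ≤ m := by rw [hm, hI]; exact Nat.mul_pos (by omega) (by omega)
  let a : (Fin d → Fin m) → Fin n → ℤ := fun j l => round ((q : ℝ) * ∑ i, (j i : ℝ) * u (c i) l)
  have hu1 : ∀ i, ‖u i‖ = 1 := huo.1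
  have ha : ∀ j l, |a j l| ≤ (c3 * m : ℕ) := fun j l => (round_bounds hm1 u u hu1 c j l).1
  have hrank : 3 * m ^ d ≤ 4 * Module.finrank Qbar (Submodule.span Qbar (Set.range fun j => mon (a j) xs)) := by
    refine (hdft m hm1 a fun j l => ?_).trans (Nat.mul_le_mul_left 4 ?_)
    · have := abs_sub_round ((q : ℝ) * ∑ i, (j i : ℝ) * u (c i) l)
      rw [abs_sub_comm]
      exact this.trans (by norm_num)
    · refine le_trans ?_ (rank_descent σ (fun j => mon (a j) xs))
      rw [(Submodule.equivMapOfInjective F.val.toLinearMap (show Function.Injective F.val from F.val.injective) _).finrank_eq,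
        Submodule.map_span, ← Set.range_comp]
      have : (F.val.toLinearMap ∘ fun j => mon (a j) x) = fun j => Ult.map σ (mon (a j) xs) := by
        funext j
        have h1 := mon_map (x := x) (F.val : F →+* Ult U ℂ) (a j)
        have h2 := mon_map (x := xs) (Ult.map σ) (a j)
        refine Eq.trans h1 (Eq.trans ?_ h2.symm)
        congr 1
        funext l
        exact hxF l
      exact le_of_eq (by rw [← this])
  choose cc top hr1 hr2 hr3 using fun l => rel_exists xs hxs0 C hC a m c3 I (2 * n + 1) hm1 ha le_rfl (by omega) hrank l
  let cc' : Fin n → Fin I → (Fin d → Fin m) → Qbar := fun l i j => if cc l i j = 0 then 1 else cc l i j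
  have hmk : ∀ γ : (Fin d → Fin m) → Qbar, ∑ j, algebraMap Qbar (Ult U Qbar) (γ j) * mon (a j) xs =
      Ult.mk U (fun k => ∑ j, γ j * mon (a j) (emb (P k))) := by
    intro γ
    have : (fun k => ∑ j, γ j * mon (a j) (emb (P k))) = ∑ j, (fun _ => γ j) * (fun k => mon (a j) (emb (P k))) := by
      funext k; simp
    rw [this, map_sum]
    refine Finset.sum_congr rfl fun j _ => ?_
    rw [map_mul, Ult.algebraMap_eq, ← Ult.mk_mon]
  have hr1' : ∀ l, ∀ᶠ k in (U : Filter ℕ), ∑ i : Fin I, emb (P k) l ^ ((i : ℕ) * (2 * n + 1)) * ∑ j, cc l i j * mon (a j) (emb (P k)) = 0 := by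
    intro l
    rw [← Ult.mk_eq_zero, ← hr1 l]
    have : (fun k => ∑ i : Fin I, emb (P k) l ^ ((i : ℕ) * (2 * n + 1)) * ∑ j, cc l i j * mon (a j) (emb (P k))) =
        ∑ i : Fin I, (fun k => emb (P k) l) ^ ((i : ℕ) * (2 * n + 1)) * (fun k => ∑ j, cc l i j * mon (a j) (emb (P k))) := by
      funext k; simp
    rw [this, map_sum]
    refine Finset.sum_congr rfl fun i _ => ?_
    rw [map_mul, map_pow, hmk]
  have hr2' : ∀ l, ∀ᶠ k in (U : Filter ℕ), ∀ i, top l < i → ∑ j, cc l i j * mon (a j) (emb (P k)) = 0 := by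
    intro l
    refine Filter.eventually_all.2 fun i => ?_
    by_cases hi : top l < i
    · have := hr2 l i hi
      rw [hmk, Ult.mk_eq_zero] at this
      filter_upwards [this] with k hk _ using hk
    · exact Filter.Eventually.of_forall fun k h => absurd h hi
  have hr3' : ∀ l, ∀ᶠ k in (U : Filter ℕ), ∑ j, cc l (top l) j * mon (a j) (emb (P k)) ≠ 0 := by
    intro l
    have := hr3 l
    rw [hmk] at this
    exact Ult.mk_ne_zero.1 this
  let ε : ℝ := 1 / (2 * (q * d * m + 1))
  have hε : 0 < ε := by positivity
  have hε2 : (q * d * m + 1) * ε ≤ 1 / 2 := by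
    have : (0:ℝ) < q * d * m + 1 := by positivity
    show ((q : ℝ) * d * m + 1) * (1 / (2 * ((q : ℝ) * d * m + 1))) ≤ 1 / 2
    rw [mul_one_div, div_le_div_iff₀ (by positivity) (by norm_num)]
    linarith
  have hJ : Nonempty (Fin d → Fin m) := ⟨fun _ => ⟨0, hm1⟩⟩
  have hev : ∀ᶠ k in (U : Filter ℕ), ∃ N, HtSys (P k) (∑ l, (∑ i, ∑ j, hB (cc' l i j) + Real.log (I * Fintype.card (Fin d → Fin m)))) N := by
    filter_upwards [hu ε hε, Filter.eventually_all.2 hr1', Filter.eventually_all.2 hr2', Filter.eventually_all.2 hr3'] with k ⟨u', hu'⟩ h1 h2 h3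
    refine ht_point (P k) (S k) (fun b hb => hb (P k) (hPH k)) a (fun j => (q : ℝ) • ∑ i, (j i : ℝ) • u' (c i)) ?_ ?_ cc cc' ?_ ?_ top h1 h2 h3
    · intro j
      exact Submodule.smul_mem _ _ (Submodule.sum_mem _ fun i _ => Submodule.smul_mem _ _ (hu' (c i)).1)
    · intro j l
      exact (round_bounds hm1 u u' hu1 c j l).2 ε (fun i => (hu' i).2) hε2
    · intro l i j
      by_cases h : cc l i j = 0
      · exact Or.inr h
      · left; simp [cc', h]
    · intro l i j
      by_cases h : cc l i j = 0
      · simp [cc', h]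
      · simp [cc', h]
  let N : ℕ → Seminorm ℝ (EuclideanSpace ℝ (Fin n)) := fun k =>
    if h : ∃ N, HtSys (P k) (∑ l, (∑ i, ∑ j, hB (cc' l i j) + Real.log (I * Fintype.card (Fin d → Fin m)))) N then h.choose else 0
  refine case1 U hX P hP L hL hPL H hH hHc hHs hPH hd e xs hxs he (fun i => IntermediateField.isAlgebraic_adjoin_iff.2 (halg i)) N
    (∑ l, (∑ i, ∑ j, hB (cc' l i j) + Real.log (I * Fintype.card (Fin d → Fin m)))) ?_
  filter_upwards [hev] with k hk
  simp only [N, dif_pos hk]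
  exact hk.choose_spec

theorem main_final
    (n s : ℕ) (K L : IntermediateField ℚ Qbar) [FiniteDimensional ℚ K] (hKL : K ≤ L)
    (hL : HasBogomolov L) (X : Set (TorusPt n)) (hXcl : ZClosed X) (hXirr : ZIrred X)
    (hXK : DefinedOver K X) :
    {P : TorusPt n | P ∈ openAnom X s ∧ (∀ i, (P i : Qbar) ∈ L) ∧
      ∃ H : Set (TorusPt n), IsAlgSubgroup H ∧ ZConnected H ∧
        s + zdim H ≤ n ∧ P ∈ H}.Finite := by
  by_contra hinf
  have hinf' : Set.Infinite _ := hinf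
  let f := Set.Infinite.natEmbedding _ hinf'
  have h1 : ∀ k, (f k : TorusPt n) ∈ openAnom X s := fun k => (f k).2.1
  have h2 : ∀ k i, ((f k : TorusPt n) i : Qbar) ∈ L := fun k => (f k).2.2.1
  choose H hH using fun k => (f k).2.2.2
  obtain ⟨k, Y, hY, hk⟩ := main_core L hL hXcl (fun k => (f k : TorusPt n)) (fun a b h => f.injective (Subtype.ext h))
    (fun k => (h1 k).1) h2 H (fun k => (hH k).1) (fun k => (hH k).2.1) (fun k => (hH k).2.2.1) (fun k => (hH k).2.2.2)
  exact (h1 k).2 (Set.mem_iUnion₂.2 ⟨Y, hY, hk⟩)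

end

/-- `X^{oa,s} ∩ G̃^{[s]}(L)` is finite for every non-negative
integer `s` (the case `s = dim X` gives `X^{oa} ∩ G̃^{[dim X]}(L)` finite). -/
theorem nonanomalous_inter_connected_subgroups_finite
    (n s : ℕ) (K L : IntermediateField ℚ Qbar) [FiniteDimensional ℚ K] (hKL : K ≤ L)
    (hL : HasBogomolov L) (X : Set (TorusPt n)) (hXcl : ZClosed X) (hXirr : ZIrred X)
    (hXK : DefinedOver K X) :
    {P : TorusPt n | P ∈ openAnom X s ∧ (∀ i, (P i : Qbar) ∈ L) ∧
      ∃ H : Set (TorusPt n), IsAlgSubgroup H ∧ ZConnected H ∧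
        s + zdim H ≤ n ∧ P ∈ H}.Finite := by
  exact main_final n s K L hKL hL X hXcl hXirr hXK

end
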